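/- Let d ≥ 4 and let P be a centrally symmetric simplicial d-polytope. Suppose there exists a vertex u of P and d distinct antipodal pairs {v_1, −v_1}, …, {v_d, −v_d} of vertices such that for each i, both v_i and −v_i are common neighbors of u and −u in the graph of ∂P (equivalently, st(u) and st(−u) share at least d pairs of antipodal vertices). Then g_2(P) > C(d,2) − d. -/

import Mathlib

open Finset
open scoped Classical

noncomputable section

/-- A finite graph: a finite vertex set together with a finite set of edges,
where each edge is (intended to be) a 2-element subset of the vertex set. -/
structure FinGraph (ι : Type) where
  verts : Finset ι
  edges : Finset (Finset ι)

/-- Every edge is a 2-element subset of the vertex set. -/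
def FinGraph.Good {ι : Type} (G : FinGraph ι) : Prop :=
  ∀ e ∈ G.edges, e ⊆ G.verts ∧ e.card = 2

/-- The standard inner (dot) product on `ℝ^d`. -/
def dotR {d : ℕ} (x y : Fin d → ℝ) : ℝ := ∑ i, x i * y i

/-- An infinitesimal motion of the framework `(G, p)`. -/
def IsMotion {ι : Type} {d : ℕ} (G : FinGraph ι) (p m : ι → Fin d → ℝ) : Prop :=
  ∀ e ∈ G.edges, ∀ u ∈ e, ∀ v ∈ e, dotR (p u - p v) (m u - m v) = 0

/-- The framework `(G, p)` is infinitesimally rigid in `ℝ^d`: every infinitesimal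
motion is the restriction of a motion `x ↦ A x + b` of `ℝ^d` with `A` skew-symmetric. -/
def IsInfRigid {ι : Type} (d : ℕ) (G : FinGraph ι) (p : ι → Fin d → ℝ) : Prop :=
  ∀ m : ι → Fin d → ℝ, IsMotion G p m →
    ∃ (A : Matrix (Fin d) (Fin d) ℝ) (b : Fin d → ℝ),
      A.transpose = -A ∧ ∀ v ∈ G.verts, m v = A.mulVec (p v) + b

/-- A stress on the framework `(G, p)`. -/
def IsStress {ι : Type} {d : ℕ} (G : FinGraph ι) (p : ι → Fin d → ℝ)
    (ω : Finset ι → ℝ) : Prop :=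
  ∀ v ∈ G.verts,
    (∑ e ∈ G.edges.filter (fun e => v ∈ e), ∑ u ∈ e.erase v, ω e • (p v - p u)) = 0

/-- A centrally symmetric framework with free involution `ν` satisfying `p (ν v) = -(p v)`. -/
def IsCSFramework {ι : Type} {d : ℕ} (G : FinGraph ι) (p : ι → Fin d → ℝ) (ν : ι → ι) : Prop :=
  (∀ v ∈ G.verts, ν (ν v) = v) ∧
  (∀ v ∈ G.verts, ν v ∈ G.verts) ∧
  (∀ v ∈ G.verts, ν v ≠ v) ∧
  (∀ e ∈ G.edges, e.image ν ∈ G.edges) ∧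
  (∀ e ∈ G.edges, e.image ν ≠ e) ∧
  (∀ v ∈ G.verts, p (ν v) = -(p v))

/-- The convex body spanned by a finite point set. -/
def polyBody {d : ℕ} (V : Finset (Fin d → ℝ)) : Set (Fin d → ℝ) :=
  convexHull ℝ (V : Set (Fin d → ℝ))

/-- `(f, c)` is a supporting functional for `conv V` exposing the face `F`. -/
def IsSupport {d : ℕ} (V : Finset (Fin d → ℝ)) (f : (Fin d → ℝ) →ₗ[ℝ] ℝ) (c : ℝ)
    (F : Set (Fin d → ℝ)) : Prop :=
  (∀ y ∈ polyBody V, f y ≤ c) ∧ F = {y ∈ polyBody V | f y = c}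

/-- A proper face of the polytope `conv V`. -/
def IsProperFace {d : ℕ} (V : Finset (Fin d → ℝ)) (F : Set (Fin d → ℝ)) : Prop :=
  (∃ f c, IsSupport V f c F) ∧ F ≠ polyBody V

/-- A simplicial `d`-polytope in `ℝ^d`, recorded by its vertex set `V`: the polytope is
`conv V`, it is `d`-dimensional, every element of `V` is a vertex, and every proper face
is a simplex (the convex hull of its affinely independent vertex set). -/
structure SPolytope (d : ℕ) where
  V : Finset (Fin d → ℝ)
  span_top : affineSpan ℝ (V : Set (Fin d → ℝ)) = ⊤
  extreme : ∀ v ∈ V, v ∉ convexHull ℝ ((V.erase v : Finset (Fin d → ℝ)) : Set (Fin d → ℝ))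
  simplicial : ∀ F : Set (Fin d → ℝ), IsProperFace V F →
    AffineIndependent ℝ
      (fun x : {y : Fin d → ℝ // y ∈ (V : Set (Fin d → ℝ)) ∩ F} => (x : Fin d → ℝ)) ∧
    F = convexHull ℝ ((V : Set (Fin d → ℝ)) ∩ F)

/-- `s` is a face of the boundary complex `∂P`. -/
def BFace {d : ℕ} (P : SPolytope d) (s : Finset (Fin d → ℝ)) : Prop :=
  s ⊆ P.V ∧ ∃ F : Set (Fin d → ℝ), IsProperFace P.V F ∧ (s : Set (Fin d → ℝ)) ⊆ F

/-- The number of vertices of `∂P`. -/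
def f0 {d : ℕ} (P : SPolytope d) : ℕ := P.V.card

/-- The edges of `∂P`. -/
def edgeFinset {d : ℕ} (P : SPolytope d) : Finset (Finset (Fin d → ℝ)) :=
  P.V.powerset.filter fun e => e.card = 2 ∧ BFace P e

/-- The number of edges of `∂P`. -/
def f1 {d : ℕ} (P : SPolytope d) : ℕ := (edgeFinset P).card

/-- `g₂(P) = f₁ - d f₀ + C(d+1, 2)`. -/
def g2 {d : ℕ} (P : SPolytope d) : ℤ :=
  (f1 P : ℤ) - (d : ℤ) * (f0 P : ℤ) + ((d + 1).choose 2 : ℤ)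

/-- `P` is centrally symmetric. -/
def IsCS {d : ℕ} (P : SPolytope d) : Prop := ∀ v ∈ P.V, -v ∈ P.V

/-- A missing face of `∂P`. -/
def IsMissingFace {d : ℕ} (P : SPolytope d) (σ : Finset (Fin d → ℝ)) : Prop :=
  σ ⊆ P.V ∧ ¬ BFace P σ ∧ ∀ τ ⊂ σ, BFace P τ

/-- `P` is prime: `∂P` has no missing facet, i.e. no missing face of cardinality `d`. -/
def IsPrimePoly {d : ℕ} (P : SPolytope d) : Prop :=
  ¬ ∃ σ : Finset (Fin d → ℝ), IsMissingFace P σ ∧ σ.card = d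

/-- The graph (1-skeleton) of `∂P` as a framework graph. -/
def fullGraph {d : ℕ} (P : SPolytope d) : FinGraph (Fin d → ℝ) :=
  ⟨P.V, edgeFinset P⟩

/-- The graph (1-skeleton) of the star of the face `τ` in `∂P`. -/
def starGraph {d : ℕ} (P : SPolytope d) (τ : Finset (Fin d → ℝ)) : FinGraph (Fin d → ℝ) :=
  ⟨P.V.filter fun v => BFace P (insert v τ),
   P.V.powerset.filter fun e => e.card = 2 ∧ BFace P (e ∪ τ)⟩

/-- Adjacency in the graph of `∂P`. -/
def Adj {d : ℕ} (P : SPolytope d) (u v : Fin d → ℝ) : Prop :=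
  u ≠ v ∧ BFace P {u, v}

/-- `σ` is a face of the link of the face `τ` in `∂P`. -/
def LinkFace {d : ℕ} (P : SPolytope d) (τ σ : Finset (Fin d → ℝ)) : Prop :=
  Disjoint σ τ ∧ BFace P (σ ∪ τ)

/-- `P` is a `d`-dimensional cross-polytope: its vertex set is `{±b₁, …, ±b_d}`
for some basis `b₁, …, b_d` of `ℝ^d`. -/
def IsCrossPolytope {d : ℕ} (P : SPolytope d) : Prop :=
  ∃ b : Fin d → (Fin d → ℝ), LinearIndependent ℝ b ∧
    (P.V : Set (Fin d → ℝ)) = Set.range b ∪ Set.range (fun i => -(b i))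

/-- A facet of `P`: a proper face with `d` vertices. -/
def IsFacet {d : ℕ} (P : SPolytope d) (F : Set (Fin d → ℝ)) : Prop :=
  IsProperFace P.V F ∧ ((P.V : Set (Fin d → ℝ)) ∩ F).ncard = d

/-- `x` lies beyond exactly one facet of `P`: it is strictly separated from `P` by the
affine hull of one facet `F`, and not separated from `P` by the affine hull of any
other facet. -/
def BeyondExactlyOne {d : ℕ} (P : SPolytope d) (x : Fin d → ℝ) : Prop :=
  ∃ F : Set (Fin d → ℝ), IsFacet P F ∧
    (∀ f c, IsSupport P.V f c F → c < f x) ∧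
    (∀ F' : Set (Fin d → ℝ), IsFacet P F' → F' ≠ F →
      ∀ f c, IsSupport P.V f c F' → f x < c)

/-- `P` is obtained from a `d`-dimensional cross-polytope by symmetric stacking: there is
a sequence of cs simplicial `d`-polytopes starting at a cross-polytope and ending at `P`,
each obtained from the previous one as `conv (P_k ∪ {v, -v})` for a point `v` lying
beyond exactly one facet of `P_k`. -/
def SymmetricStackingFrom {d : ℕ} (P : SPolytope d) : Prop :=
  ∃ (m : ℕ) (Q : Fin (m + 1) → SPolytope d),
    (∀ k, IsCS (Q k)) ∧
    IsCrossPolytope (Q 0) ∧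
    Q (Fin.last m) = P ∧
    ∀ k : Fin m, ∃ v : Fin d → ℝ,
      BeyondExactlyOne (Q (Fin.castSucc k)) v ∧
      polyBody (Q (Fin.succ k)).V =
        convexHull ℝ (polyBody (Q (Fin.castSucc k)).V ∪ {v, -v})

/-- `P` is a stacked `d`-polytope: obtained from a `d`-simplex by repeatedly adding a
point beyond exactly one facet. -/
def IsStacked {d : ℕ} (P : SPolytope d) : Prop :=
  ∃ (m : ℕ) (R : Fin (m + 1) → SPolytope d),
    (R 0).V.card = d + 1 ∧
    R (Fin.last m) = P ∧
    ∀ k : Fin m, ∃ v : Fin d → ℝ,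
      BeyondExactlyOne (R (Fin.castSucc k)) v ∧
      polyBody (R (Fin.succ k)).V =
        convexHull ℝ (polyBody (R (Fin.castSucc k)).V ∪ {v})

/-- Every `d` vertices of `P`, no two of which are antipodal, are affinely independent. -/
def GenPos {d : ℕ} (P : SPolytope d) : Prop :=
  ∀ S : Finset (Fin d → ℝ), S ⊆ P.V → S.card = d →
    (∀ x ∈ S, ∀ y ∈ S, x ≠ -y) →
    AffineIndependent ℝ (fun s : {x : Fin d → ℝ // x ∈ S} => (s : Fin d → ℝ))

/-- The graph of the cone `v₀ * S` over a simplicial complex `S` (a set of finsets):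
the vertices of `S` together with `v₀`, and the edges of `S` together with all edges
from `v₀` to vertices of `S`. -/
def coneGraph {d : ℕ} (P : SPolytope d) (v0 : Fin d → ℝ)
    (S : Set (Finset (Fin d → ℝ))) : FinGraph (Fin d → ℝ) :=
  ⟨insert v0 (P.V.filter fun u => ({u} : Finset (Fin d → ℝ)) ∈ S),
   (P.V.powerset.filter fun e => e.card = 2 ∧ e ∈ S) ∪
     (P.V.filter fun u => ({u} : Finset (Fin d → ℝ)) ∈ S).image
       fun u => ({v0, u} : Finset (Fin d → ℝ))⟩

/-- Abstract centrally symmetric simplicial polytope. -/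
structure CSP (d : ℕ) (ι : Type) [Fintype ι] where
  hd : 4 ≤ d
  p : ι → (Fin d → ℝ)
  neg : ι → ι
  p_inj : Function.Injective p
  p_neg : ∀ i, p (neg i) = - p i
  span : Submodule.span ℝ (Set.range p) = ⊤
  indep : ∀ l : (Fin d → ℝ) →ₗ[ℝ] ℝ, (∀ i, l (p i) ≤ 1) →
    LinearIndependent ℝ (fun i : {i // l (p i) = 1} => p i)
  vert : ∀ i, ∃ l : (Fin d → ℝ) →ₗ[ℝ] ℝ, (∀ j, l (p j) ≤ 1) ∧ l (p i) = 1

theorem exists_small {κ : Type*} [Fintype κ] (a b : κ → ℝ) (h : ∀ i, 0 < a i) :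
    ∃ e : ℝ, 0 < e ∧ ∀ i, e * b i < a i := by
  have h1 : ∀ᶠ e in nhdsWithin (0:ℝ) (Set.Ioi 0), ∀ i, e * b i < a i := by
    rw [Filter.eventually_all]
    intro i
    apply Filter.Eventually.filter_mono nhdsWithin_le_nhds
    have : Filter.Tendsto (fun e : ℝ => e * b i) (nhds 0) (nhds (0 * b i)) :=
      (continuous_id.mul continuous_const).tendsto 0
    apply this.eventually_lt_const
    simpa using h i
  obtain ⟨e, h2, h3⟩ := (h1.and self_mem_nhdsWithin).exists
  exact ⟨e, h3, h2⟩

theorem exists_dual_of_indep {κ V : Type*} [AddCommGroup V] [Module ℝ V] {v : κ → V}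
    (h : LinearIndependent ℝ v) (c : κ → ℝ) : ∃ l : V →ₗ[ℝ] ℝ, ∀ i, l (v i) = c i := by
  let e : Set.range v → ℝ := fun y => c (y.2.choose)
  have he : ∀ i, e ⟨v i, i, rfl⟩ = c i := by
    intro i
    have : (⟨i, rfl⟩ : ∃ y, v y = v i).choose = i :=
      h.injective (⟨i, rfl⟩ : ∃ y, v y = v i).choose_spec
    simp only [e]
    congr 1
  let B := Module.Basis.extend h.linearIndepOn_id
  let e2 : h.linearIndepOn_id.extend (Set.subset_univ _) → ℝ := fun y =>
    if hy : (y:V) ∈ Set.range v then e ⟨y, hy⟩ else 0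
  refine ⟨B.constr ℝ e2, fun i => ?_⟩
  have hm : v i ∈ h.linearIndepOn_id.extend (Set.subset_univ _) :=
    h.linearIndepOn_id.subset_extend _ ⟨i, rfl⟩
  have : v i = B ⟨v i, hm⟩ := by simp [B]
  rw [this, Module.Basis.constr_basis]
  simp only [e2]
  rw [dif_pos ⟨i, rfl⟩]
  exact he i

namespace CSP

section geom

variable {d : ℕ} {ι : Type} [Fintype ι] (X : CSP d ι)

def Sup (l : (Fin d → ℝ) →ₗ[ℝ] ℝ) : Prop := ∀ i, l (X.p i) ≤ 1

def Face (s : Finset ι) : Prop := ∃ l : (Fin d → ℝ) →ₗ[ℝ] ℝ, X.Sup l ∧ ∀ i ∈ s, l (X.p i) = 1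

theorem neg_neg (i : ι) : X.neg (X.neg i) = i := by
  apply X.p_inj; rw [X.p_neg, X.p_neg, _root_.neg_neg]

theorem p_ne (i : ι) : X.p i ≠ 0 := by
  obtain ⟨l, -, h⟩ := X.vert i
  intro h0; rw [h0] at h; simp at h

theorem neg_ne (i : ι) : X.neg i ≠ i := by
  intro h
  have h1 := X.p_neg i
  rw [h] at h1
  have : X.p i = 0 := by
    ext k; have := congrFun h1 k; simp at this ⊢; linarith
  exact X.p_ne i this

theorem neg_inj : Function.Injective X.neg := Function.LeftInverse.injective X.neg_neg

theorem neg_eq_iff (i j : ι) : X.neg i = j ↔ i = X.neg j := by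
  constructor <;> rintro rfl <;> simp [X.neg_neg]

/-- negation as an equivalence -/
def ne : ι ≃ ι := ⟨X.neg, X.neg, X.neg_neg, X.neg_neg⟩

theorem ne_apply (i : ι) : X.ne i = X.neg i := rfl

theorem sum_neg {M : Type*} [AddCommMonoid M] (f : ι → M) : ∑ i, f (X.neg i) = ∑ i, f i :=
  Equiv.sum_comp X.ne f

variable {X}

theorem Face.mono {s t : Finset ι} (h : X.Face t) (hs : s ⊆ t) : X.Face s := by
  obtain ⟨l, h1, h2⟩ := h
  exact ⟨l, h1, fun i hi => h2 i (hs hi)⟩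

theorem Face.neg {s : Finset ι} (h : X.Face s) : X.Face (s.image X.neg) := by
  obtain ⟨l, h1, h2⟩ := h
  refine ⟨-l, fun i => ?_, fun i hi => ?_⟩
  · have := h1 (X.neg i); rw [X.p_neg] at this; simpa using this
  · obtain ⟨j, hj, rfl⟩ := mem_image.1 hi
    rw [X.p_neg]; simpa using h2 j hj

theorem image_neg_neg (s : Finset ι) : (s.image X.neg).image X.neg = s := by
  ext i; simp [X.neg_neg]

theorem face_neg_iff {s : Finset ι} : X.Face (s.image X.neg) ↔ X.Face s :=
  ⟨fun h => by simpa [image_neg_neg] using h.neg, fun h => h.neg⟩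

theorem Face.not_neg {s : Finset ι} (h : X.Face s) {i : ι} (hi : i ∈ s) : X.neg i ∉ s := by
  obtain ⟨l, h1, h2⟩ := h
  intro h3
  have a := h2 i hi
  have b := h2 _ h3
  rw [X.p_neg, map_neg] at b; linarith

theorem face_single (i : ι) : X.Face {i} := by
  obtain ⟨l, h1, h2⟩ := X.vert i
  exact ⟨l, h1, by simpa using h2⟩

theorem face_empty : X.Face ∅ := ⟨0, fun i => by simp, by simp⟩

theorem Face.indep {s : Finset ι} (h : X.Face s) :
    LinearIndependent ℝ (fun i : s => X.p i) := by
  obtain ⟨l, h1, h2⟩ := h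
  exact (X.indep l h1).comp (fun i : s => ⟨i, h2 i i.2⟩) (fun a b hab => by
    apply Subtype.ext; simpa using hab)

theorem Face.card_le {s : Finset ι} (h : X.Face s) : s.card ≤ d := by
  have := h.indep.fintype_card_le_finrank
  simpa using this

theorem Face.exact {s : Finset ι} (h : X.Face s) :
    ∃ l, X.Sup l ∧ ∀ i, l (X.p i) = 1 ↔ i ∈ s := by
  obtain ⟨l, h1, h2⟩ := h
  obtain ⟨m, hm⟩ := exists_dual_of_indep (X.indep l h1) (fun i => if (i : ι) ∈ s then 0 else 1)
  obtain ⟨e, he, h3⟩ := exists_small (fun i : ι => if l (X.p i) = 1 then 1 else 1 - l (X.p i))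
    (fun i : ι => if l (X.p i) = 1 then 0 else - m (X.p i)) (by
      intro i; have := h1 i
      by_cases h : l (X.p i) = 1
      · simp [h]
      · simp only [h, if_false, sub_pos]; exact lt_of_le_of_ne this h)
  refine ⟨l - e • m, fun i => ?_, fun i => ?_⟩
  · by_cases h : l (X.p i) = 1
    · have := hm ⟨i, h⟩
      simp only at this
      simp only [LinearMap.sub_apply, LinearMap.smul_apply, this, h, smul_eq_mul]
      split_ifs <;> linarith
    · have := h3 i
      simp only [h, if_false] at this
      simp only [LinearMap.sub_apply, LinearMap.smul_apply, smul_eq_mul]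
      linarith
  · by_cases h : l (X.p i) = 1
    · have := hm ⟨i, h⟩
      simp only at this
      simp only [LinearMap.sub_apply, LinearMap.smul_apply, this, h, smul_eq_mul]
      by_cases hs : i ∈ s
      · simp [hs]
      · simp [hs]; linarith
    · have := h3 i
      simp only [h, if_false] at this
      simp only [LinearMap.sub_apply, LinearMap.smul_apply, smul_eq_mul]
      constructor
      · intro; linarith
      · intro hi; exact absurd (h2 i hi) h

variable (X)

theorem exists_pos {n : (Fin d → ℝ) →ₗ[ℝ] ℝ} (hn : n ≠ 0) : ∃ i, 0 < n (X.p i) := by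
  by_contra! h
  apply hn
  apply LinearMap.ext_on_range X.span
  intro i
  have h1 := h i
  have h2 := h (X.neg i)
  rw [X.p_neg, map_neg] at h2
  simp; linarith

variable {X}

theorem pivot {l n : (Fin d → ℝ) →ₗ[ℝ] ℝ} (hl : X.Sup l)
    (h : ∀ i, l (X.p i) = 1 → n (X.p i) ≤ 0) (hn : n ≠ 0) :
    ∃ t : ℝ, 0 < t ∧ X.Sup (l + t • n) ∧ ∃ w, 0 < n (X.p w) ∧ (l + t • n) (X.p w) = 1 := by
  have hne : (univ.filter (fun i => 0 < n (X.p i))).Nonempty := by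
    obtain ⟨i, hi⟩ := X.exists_pos hn
    exact ⟨i, by simpa using hi⟩
  obtain ⟨w, hw, hmin⟩ := exists_min_image _ (fun i => (1 - l (X.p i)) / n (X.p i)) hne
  simp only [mem_filter, mem_univ, true_and] at hw hmin
  have hw1 : 0 < 1 - l (X.p w) := by
    have := hl w
    rcases this.lt_or_eq with h1 | h1
    · linarith
    · exact absurd (h w h1) (by linarith)
  refine ⟨(1 - l (X.p w)) / n (X.p w), by positivity, fun i => ?_, w, hw, ?_⟩
  · simp only [LinearMap.add_apply, LinearMap.smul_apply, smul_eq_mul]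
    by_cases hi : 0 < n (X.p i)
    · have := hmin i hi
      rw [le_div_iff₀ hi] at this
      linarith
    · have : (1 - l (X.p w)) / n (X.p w) * n (X.p i) ≤ 0 :=
        mul_nonpos_of_nonneg_of_nonpos (by positivity) (not_lt.1 hi)
      linarith [hl i]
  · simp only [LinearMap.add_apply, LinearMap.smul_apply, smul_eq_mul]
    field_simp; ring

theorem Face.exists_facet {s : Finset ι} (h : X.Face s) :
    ∃ F, s ⊆ F ∧ X.Face F ∧ F.card = d := by
  induction hk : d - s.card using Nat.strong_induction_on generalizing s with
  | _ k ih =>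
    rcases h.card_le.eq_or_lt with h1 | h1
    · exact ⟨s, Subset.rfl, h, h1⟩
    · have hlt : Submodule.span ℝ (Set.range (fun i : s => X.p i)) < ⊤ := by
        rw [lt_top_iff_ne_top]
        intro htop
        have h2 := finrank_range_le_card (R := ℝ) (fun i : s => X.p i)
        rw [Set.finrank, htop] at h2
        simp at h2; omega
      obtain ⟨n, hn, hle⟩ := Submodule.exists_le_ker_of_lt_top _ hlt
      have hs0 : ∀ i ∈ s, n (X.p i) = 0 := fun i hi =>
        hle (Submodule.subset_span ⟨⟨i, hi⟩, rfl⟩)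
      obtain ⟨l, hl, hl2⟩ := h.exact
      obtain ⟨t, ht, hS, w, hw, hw1⟩ := pivot hl (fun i hi => by rw [hs0 i ((hl2 i).1 hi)]) hn
      have hws : w ∉ s := fun hh => by rw [hs0 w hh] at hw; exact lt_irrefl _ hw
      have hF : X.Face (insert w s) := ⟨_, hS, fun i hi => by
        rcases mem_insert.1 hi with rfl | hi
        · exact hw1
        · simp [hs0 i hi, (hl2 i).2 hi]⟩
      have hc := card_insert_of_notMem hws
      obtain ⟨F, h1, h2, h3⟩ := ih (d - (insert w s).card) (by omega) hF rfl
      exact ⟨F, (subset_insert _ _).trans h1, h2, h3⟩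

variable (X)

/-- Ordered facets. -/
def IsOF (f : Fin d → ι) : Prop := Function.Injective f ∧ X.Face (univ.image f)

def OF : Type := {f : Fin d → ι // X.IsOF f}

instance : Fintype X.OF := by unfold OF; infer_instance

instance : CoeFun X.OF (fun _ => Fin d → ι) := ⟨fun f => f.1⟩

variable {X}

theorem OF.inj (f : X.OF) : Function.Injective f := f.2.1

theorem OF.face (f : X.OF) : X.Face (univ.image f) := f.2.2

theorem OF.indep (f : X.OF) : LinearIndependent ℝ (fun j => X.p (f j)) := by
  have := f.face.indep
  exact this.comp (fun j => ⟨f j, mem_image_of_mem _ (mem_univ j)⟩) (fun a b hab => by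
    apply f.inj; simpa using hab)

def OF.basis (f : X.OF) : Module.Basis (Fin d) ℝ (Fin d → ℝ) :=
  Module.Basis.mk f.indep (by
    rw [f.indep.span_eq_top_of_card_eq_finrank' (by simp)])

theorem OF.basis_apply (f : X.OF) (j : Fin d) : f.basis j = X.p (f j) := by
  simp [OF.basis]

def OF.co (f : X.OF) (j : Fin d) : (Fin d → ℝ) →ₗ[ℝ] ℝ := f.basis.coord j

theorem OF.co_self (f : X.OF) (i j : Fin d) : f.co j (X.p (f i)) = if i = j then 1 else 0 := by
  rw [← f.basis_apply, OF.co, Module.Basis.coord_apply, Module.Basis.repr_self,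
    Finsupp.single_apply]

theorem OF.sum_co (f : X.OF) (x : Fin d → ℝ) : ∑ j, f.co j x • X.p (f j) = x := by
  have := f.basis.sum_repr x
  simpa only [OF.co, Module.Basis.coord_apply, ← f.basis_apply] using this

theorem OF.lin_eq (f : X.OF) (l : (Fin d → ℝ) →ₗ[ℝ] ℝ) (x : Fin d → ℝ) :
    l x = ∑ j, f.co j x * l (X.p (f j)) := by
  conv_lhs => rw [← f.sum_co x]
  simp

theorem OF.lin_ext (f : X.OF) {M : Type*} [AddCommMonoid M] [Module ℝ M]
    {l m : (Fin d → ℝ) →ₗ[ℝ] M}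
    (h : ∀ j, l (X.p (f j)) = m (X.p (f j))) : l = m :=
  f.basis.ext (fun j => by rw [f.basis_apply]; exact h j)

/-- The supporting functional. -/
def OF.sf (f : X.OF) : (Fin d → ℝ) →ₗ[ℝ] ℝ := ∑ j, f.co j

theorem OF.sf_apply (f : X.OF) (x : Fin d → ℝ) : f.sf x = ∑ j, f.co j x := by
  simp [OF.sf]

theorem OF.sf_self (f : X.OF) (i : Fin d) : f.sf (X.p (f i)) = 1 := by
  simp [OF.sf_apply, OF.co_self]

theorem OF.eq_sf (f : X.OF) {l : (Fin d → ℝ) →ₗ[ℝ] ℝ} (h : ∀ i, l (X.p (f i)) = 1) :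
    l = f.sf := f.lin_ext (fun j => by rw [h, f.sf_self])

theorem OF.sf_sup (f : X.OF) : X.Sup f.sf := by
  obtain ⟨l, h1, h2⟩ := f.face
  rw [← f.eq_sf (fun i => h2 _ (mem_image_of_mem _ (mem_univ i)))]
  exact h1

theorem OF.sf_eq_one (f : X.OF) {i : ι} : f.sf (X.p i) = 1 ↔ i ∈ Set.range f := by
  constructor
  · intro h
    by_contra hn
    have hF : X.Face (insert i (univ.image f)) := ⟨f.sf, f.sf_sup, fun k hk => by
      rcases mem_insert.1 hk with rfl | hk
      · exact h
      · obtain ⟨j, -, rfl⟩ := mem_image.1 hk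
        exact f.sf_self j⟩
    have hc := hF.card_le
    rw [card_insert_of_notMem (by simpa using hn), card_image_of_injective _ f.inj] at hc
    simp at hc
  · rintro ⟨j, rfl⟩; exact f.sf_self j

theorem OF.sf_lt (f : X.OF) {i : ι} (h : i ∉ Set.range f) : f.sf (X.p i) < 1 :=
  lt_of_le_of_ne (f.sf_sup i) (fun h1 => h (f.sf_eq_one.1 h1))

theorem exists_OF {F : Finset ι} (h : X.Face F) (hc : F.card = d) :
    ∃ f : X.OF, univ.image f = F := by
  let e := F.equivFinOfCardEq hc
  have him : univ.image (fun j => ((e.symm j : F) : ι)) = F := by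
    ext i; simp only [mem_image, mem_univ, true_and]
    constructor
    · rintro ⟨j, rfl⟩; exact (e.symm j).2
    · intro hi; exact ⟨e ⟨i, hi⟩, by simp⟩
  exact ⟨⟨fun j => (e.symm j : F), fun a b hab => e.symm.injective (Subtype.ext hab),
    by rw [him]; exact h⟩, him⟩

theorem Face.exists_OF {s : Finset ι} (h : X.Face s) : ∃ f : X.OF, s ⊆ univ.image f := by
  obtain ⟨F, h1, h2, h3⟩ := h.exists_facet
  obtain ⟨f, rfl⟩ := CSP.exists_OF h2 h3
  exact ⟨f, h1⟩

/-- facts about any adjacent facet -/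
theorem OF.adj (f : X.OF) (j : Fin d) (q : ι) (hq : q ≠ f j)
    (f' : X.OF) (hf' : f'.1 = Function.update f.1 j q) :
    ∃ a : ℝ, a < 0 ∧ f'.sf = f.sf + a • f.co j ∧ f.co j (X.p q) < 0 := by
  have hfj : f' j = q := by simp [hf']
  have hfi : ∀ i, i ≠ j → f' i = f i := fun i hi => by simp [hf', hi]
  have hj : f j ∉ Set.range f' := by
    rintro ⟨i, hi⟩
    by_cases h : i = j
    · subst h; exact hq (hfj.symm.trans hi)
    · rw [hfi i h] at hi; exact h (f.inj hi)
  have hq2 : q ∉ Set.range f := by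
    rintro ⟨i, hi⟩
    by_cases h : i = j
    · subst h; exact hq hi.symm
    · apply h; apply f'.inj; rw [hfi i h, hfj, hi]
  have h1 := f'.sf_lt hj
  have h2 := f.sf_lt hq2
  have heq : f'.sf = f.sf + (f'.sf (X.p (f j)) - 1) • f.co j := by
    apply f.lin_ext
    intro i
    by_cases h : i = j
    · subst h; simp [f.sf_self, f.co_self]
    · simp only [LinearMap.add_apply, LinearMap.smul_apply, f.sf_self, f.co_self, h, if_false]
      rw [← hfi i h, f'.sf_self]; simp
  refine ⟨f'.sf (X.p (f j)) - 1, by linarith, heq, ?_⟩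
  have h3 : f'.sf (X.p q) = 1 := by rw [← hfj, f'.sf_self]
  rw [heq] at h3
  simp only [LinearMap.add_apply, LinearMap.smul_apply, smul_eq_mul] at h3
  by_contra! h4
  have : (f'.sf (X.p (f j)) - 1) * f.co j (X.p q) ≤ 0 :=
    mul_nonpos_of_nonpos_of_nonneg (by linarith) h4
  linarith

theorem OF.exists_adj (f : X.OF) (j : Fin d) :
    ∃ q, q ≠ f j ∧ X.IsOF (Function.update f.1 j q) := by
  have hn : -f.co j ≠ 0 := by
    intro h
    have h1 : (-f.co j) (X.p (f j)) = 0 := by rw [h]; simp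
    simp [f.co_self] at h1
  obtain ⟨t, ht, hS, w, hw, hw1⟩ := pivot f.sf_sup (n := -f.co j) (fun i hi => by
    obtain ⟨k, rfl⟩ := f.sf_eq_one.1 hi
    simp [f.co_self]; split_ifs <;> norm_num) hn
  simp only [LinearMap.neg_apply] at hw
  have hwf : ∀ i, w ≠ f i := by
    rintro i rfl
    rw [f.co_self] at hw
    split_ifs at hw <;> linarith
  refine ⟨w, hwf j, ?_, _, hS, ?_⟩
  · intro a b hab
    by_cases ha : a = j <;> by_cases hb : b = j
    · rw [ha, hb]
    · subst ha; simp [hb] at hab; exact absurd hab (hwf b)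
    · subst hb; simp [ha] at hab; exact absurd hab.symm (hwf a)
    · simp [ha, hb] at hab; exact f.inj hab
  · intro i hi
    obtain ⟨k, -, rfl⟩ := mem_image.1 hi
    by_cases hk : k = j
    · subst hk; simpa using hw1
    · simp only [Function.update_of_ne hk, LinearMap.add_apply, LinearMap.smul_apply,
        LinearMap.neg_apply, f.co_self, hk, if_false, f.sf_self]
      simp

theorem OF.adj_unique (f : X.OF) (j : Fin d) (q r : ι) (hq : q ≠ f j) (hr : r ≠ f j)
    (h1 : X.IsOF (Function.update f.1 j q)) (h2 : X.IsOF (Function.update f.1 j r)) : q = r := by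
  have key : ∀ q r : ι, ∀ (f1 f2 : X.OF), f1.1 = Function.update f.1 j q →
      f2.1 = Function.update f.1 j r → ∀ a b : ℝ, f1.sf = f.sf + a • f.co j →
      f2.sf = f.sf + b • f.co j → f.co j (X.p r) < 0 → a ≤ b → r = q := by
    intro q r f1 f2 e1 e2 a b ha hb hneg hab
    have h3 : f2.sf (X.p r) = 1 := f2.sf_eq_one.2 ⟨j, by simp [e2]⟩
    have h4 : f1.sf (X.p r) = 1 := by
      apply le_antisymm (f1.sf_sup r)
      rw [hb] at h3; rw [ha]
      simp only [LinearMap.add_apply, LinearMap.smul_apply, smul_eq_mul] at h3 ⊢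
      nlinarith
    obtain ⟨i, hi⟩ := f1.sf_eq_one.1 h4
    by_cases hij : i = j
    · subst hij; rw [← hi, e1]; simp
    · exfalso
      rw [e1, Function.update_of_ne hij] at hi
      rw [← hi, f.co_self, if_neg hij] at hneg
      exact lt_irrefl _ hneg
  obtain ⟨a, ha, ha2, ha3⟩ := f.adj j q hq ⟨_, h1⟩ rfl
  obtain ⟨b, hb, hb2, hb3⟩ := f.adj j r hr ⟨_, h2⟩ rfl
  rcases le_total a b with h | h
  · exact (key q r ⟨_, h1⟩ ⟨_, h2⟩ rfl rfl a b ha2 hb2 hb3 h).symm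
  · exact key r q ⟨_, h2⟩ ⟨_, h1⟩ rfl rfl b a hb2 ha2 ha3 h

theorem connected (τ : Finset ι) (Pr : X.OF → Prop) (f0 : X.OF) (h0 : τ ⊆ univ.image f0)
    (hP : Pr f0)
    (step : ∀ (f f' : X.OF) (j : Fin d) (q : ι), Pr f → τ ⊆ univ.image f → f j ∉ τ → q ≠ f j →
      f'.1 = Function.update f.1 j q → Pr f')
    {F : Finset ι} (hF : X.Face F) (hc : F.card = d) (hτ : τ ⊆ F) :
    ∃ f : X.OF, Pr f ∧ univ.image f = F := by
  let y : Fin d → ℝ := ∑ v ∈ F \ τ, X.p v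
  let N : ℝ := 1 + ∑ f : X.OF, ∑ j, |f.co j y|
  have hN : ∀ (f : X.OF) j, 0 < N + f.co j y := by
    intro f j
    have h1 : |f.co j y| ≤ ∑ j, |f.co j y| :=
      single_le_sum (f := fun j => |f.co j y|) (fun i _ => abs_nonneg _) (mem_univ j)
    have h2 : ∑ j, |f.co j y| ≤ ∑ f : X.OF, ∑ j, |f.co j y| :=
      single_le_sum (f := fun f : X.OF => ∑ j, |f.co j y|)
        (fun i _ => sum_nonneg (fun _ _ => abs_nonneg _)) (mem_univ f)
    have h3 := neg_abs_le (f.co j y)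
    simp only [N]; linarith
  let t : Fin d → ℝ := N • ∑ v ∈ τ, X.p v + y
  have hne : (univ.filter (fun f : X.OF => Pr f ∧ τ ⊆ univ.image f)).Nonempty :=
    ⟨f0, by simp only [mem_filter, mem_univ, true_and]; exact ⟨hP, h0⟩⟩
  obtain ⟨f, hf, hmax⟩ := exists_max_image _ (fun f : X.OF => f.sf t) hne
  simp only [mem_filter, mem_univ, true_and] at hf hmax
  obtain ⟨hPf, hτf⟩ := hf
  have hco : ∀ j, 0 ≤ f.co j t := by
    intro j
    by_cases hj : f j ∈ τ
    · have : f.co j t = N + f.co j y := by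
        simp only [t, map_add, map_smul, map_sum]
        rw [sum_eq_single (f j)]
        · simp [f.co_self]
        · intro b hb hbj
          obtain ⟨k, -, rfl⟩ := mem_image.1 (hτf hb)
          rw [f.co_self, if_neg]; rintro rfl; exact hbj rfl
        · intro h; exact absurd hj h
      rw [this]; exact (hN f j).le
    · by_contra! hneg
      obtain ⟨q, hq, hOF⟩ := f.exists_adj j
      obtain ⟨a, ha, ha2, -⟩ := f.adj j q hq ⟨_, hOF⟩ rfl
      have h1 := step f ⟨_, hOF⟩ j q hPf hτf hj hq rfl
      have h2 : τ ⊆ univ.image (Function.update f.1 j q) := by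
        intro v hv
        obtain ⟨k, -, rfl⟩ := mem_image.1 (hτf hv)
        refine mem_image.2 ⟨k, mem_univ _, ?_⟩
        rw [Function.update_of_ne]; rintro rfl; exact hj hv
      have h3 := hmax ⟨_, hOF⟩ ⟨h1, h2⟩
      rw [ha2] at h3
      simp only [LinearMap.add_apply, LinearMap.smul_apply, smul_eq_mul] at h3
      nlinarith
  refine ⟨f, hPf, ?_⟩
  obtain ⟨l, hl, hl1⟩ := hF
  have e1 : l t ≤ f.sf t := by
    rw [f.lin_eq l t, f.sf_apply]
    apply sum_le_sum
    intro j _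
    nlinarith [hco j, hl (f j)]
  have e2 : ∀ m : (Fin d → ℝ) →ₗ[ℝ] ℝ, m t = N * ∑ v ∈ τ, m (X.p v) + ∑ v ∈ F \ τ, m (X.p v) := by
    intro m; simp [t, y]
  have hlt : ∑ v ∈ τ, l (X.p v) = ∑ v ∈ τ, f.sf (X.p v) := by
    apply sum_congr rfl
    intro v hv
    rw [hl1 v (hτ hv)]
    obtain ⟨k, -, rfl⟩ := mem_image.1 (hτf hv)
    rw [f.sf_self]
  rw [e2, e2, hlt] at e1
  have e3 : ∀ v ∈ F \ τ, f.sf (X.p v) ≤ l (X.p v) := by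
    intro v hv
    rw [hl1 v (mem_sdiff.1 hv).1]; exact f.sf_sup v
  have e4 := (sum_eq_sum_iff_of_le e3).1 (le_antisymm (sum_le_sum e3) (by linarith))
  symm
  apply eq_of_subset_of_card_le
  · intro v hv
    by_cases hvτ : v ∈ τ
    · exact hτf hvτ
    · have := e4 v (mem_sdiff.2 ⟨hv, hvτ⟩)
      rw [hl1 v hv] at this
      obtain ⟨k, rfl⟩ := f.sf_eq_one.1 this
      exact mem_image_of_mem _ (mem_univ _)
  · rw [card_image_of_injective _ f.inj, hc]; simp

/-- star version: extends to all vertices in the star. -/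
theorem connected_star (τ : Finset ι) (Pr : X.OF → Prop) (f0 : X.OF) (h0 : τ ⊆ univ.image f0)
    (hP : Pr f0)
    (step : ∀ (f f' : X.OF) (j : Fin d) (q : ι), Pr f → τ ⊆ univ.image f → f j ∉ τ → q ≠ f j →
      f'.1 = Function.update f.1 j q → Pr f')
    {v : ι} (hv : X.Face (insert v τ)) : ∃ f : X.OF, Pr f ∧ τ ⊆ univ.image f ∧ ∃ j, f j = v := by
  obtain ⟨F, h1, h2, h3⟩ := hv.exists_facet
  obtain ⟨f, hf, rfl⟩ := connected τ Pr f0 h0 hP step h2 h3 ((subset_insert _ _).trans h1)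
  refine ⟨f, hf, (subset_insert _ _).trans h1, ?_⟩
  obtain ⟨j, -, hj⟩ := mem_image.1 (h1 (mem_insert_self _ _))
  exact ⟨j, hj⟩

theorem skew_lemma {τ : Finset ι} (hτ : X.Face τ) (κ : ι → ((Fin d → ℝ) →ₗ[ℝ] ℝ))
    (hκ : ∀ v w, X.Face (insert v (insert w τ)) → κ v (X.p w) + κ w (X.p v) = 0) :
    ∃ A : (Fin d → ℝ) →ₗ[ℝ] (Fin d → ℝ) →ₗ[ℝ] ℝ, (∀ x y, A x y = - A y x) ∧
      ∀ v, X.Face (insert v τ) → κ v = A (X.p v) := by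
  obtain ⟨f0, h0⟩ := hτ.exists_OF
  have hmem : ∀ (f : X.OF), τ ⊆ univ.image f → ∀ i j, X.Face (insert (f i) (insert (f j) τ)) := by
    intro f hf i j
    apply f.face.mono
    intro v hv
    rcases mem_insert.1 hv with rfl | hv
    · simp
    · rcases mem_insert.1 hv with rfl | hv
      · simp
      · exact hf hv
  let A := f0.basis.constr ℝ (fun j => κ (f0 j))
  have hA : ∀ j, A (X.p (f0 j)) = κ (f0 j) := by
    intro j; rw [← f0.basis_apply]; exact f0.basis.constr_basis _ _ _
  have hskew : ∀ x y, A x y = - A y x := by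
    have : A = - A.flip := by
      apply f0.lin_ext
      intro i
      apply f0.lin_ext
      intro j
      simp only [LinearMap.neg_apply, LinearMap.flip_apply, hA]
      linarith [hκ _ _ (hmem f0 h0 i j)]
    intro x y
    conv_lhs => rw [this]
    simp
  refine ⟨A, hskew, fun v hv => ?_⟩
  obtain ⟨f, hf, -, j, rfl⟩ := connected_star τ
    (fun f => τ ⊆ univ.image f ∧ ∀ j, κ (f j) = A (X.p (f j))) f0 h0
    ⟨h0, fun j => (hA j).symm⟩ (by
      rintro f f' j q ⟨-, hf⟩ hτf hj hq hf'
      have hτf' : τ ⊆ univ.image f' := by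
        intro v hv
        obtain ⟨k, -, rfl⟩ := mem_image.1 (hτf hv)
        refine mem_image.2 ⟨k, mem_univ _, ?_⟩
        rw [hf', Function.update_of_ne]; rintro rfl; exact hj hv
      refine ⟨hτf', fun i => ?_⟩
      by_cases hi : i = j
      · subst hi
        apply f'.lin_ext
        intro k
        by_cases hk : k = i
        · subst hk
          have := hκ _ _ (hmem f' hτf' k k)
          have h2 := hskew (X.p (f' k)) (X.p (f' k))
          linarith
        · have h1 := hκ _ _ (hmem f' hτf' i k)
          have h2 : f' k = f k := by rw [hf', Function.update_of_ne hk]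
          rw [hskew, h2, ← hf k, ← h2]; linarith
      · rw [hf', Function.update_of_ne hi]; exact hf i) hv
  exact hf.2 j

end geom

end CSP

namespace CSP

section ring

variable {d : ℕ} {ι : Type} [Fintype ι] (X : CSP d ι)

theorem exists_gen : ∃ g : Fin d → ℝ, (∀ (f : X.OF) j, f.co j g ≠ 0) ∧ ∀ f : X.OF, f.sf g ≠ 0 := by
  have hd := X.hd
  obtain ⟨g, hg⟩ := Module.Dual.exists_forall_ne_zero_of_forall_exists (K := ℝ)
    (M := Fin d → ℝ) (ι := (X.OF × Fin d) ⊕ X.OF)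
    (fun s => Sum.elim (fun x => x.1.co x.2) (fun f => f.sf) s) (by
      rintro (⟨f, j⟩ | f)
      · exact ⟨X.p (f j), by simp [f.co_self]⟩
      · exact ⟨X.p (f ⟨0, by omega⟩), by simp [f.sf_self]⟩)
  exact ⟨g, fun f j => hg (Sum.inl (f, j)), fun f => hg (Sum.inr f)⟩

def g : Fin d → ℝ := X.exists_gen.choose

variable {X}

theorem OF.co_g (f : X.OF) (j : Fin d) : f.co j X.g ≠ 0 := X.exists_gen.choose_spec.1 f j

theorem OF.sf_g (f : X.OF) : f.sf X.g ≠ 0 := X.exists_gen.choose_spec.2 f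

variable (X)

/-- linear forms in the ring -/
def br : (ι → ℝ) →ₗ[ℝ] (X.OF → ℝ) where
  toFun b f := (∑ j, b (f j) * f.co j X.g) / f.sf X.g
  map_add' a b := by
    ext f; simp [add_mul, sum_add_distrib, add_div]
  map_smul' c b := by
    ext f; simp [mul_assoc, ← mul_sum, mul_div_assoc]

theorem br_apply (b : ι → ℝ) (f : X.OF) : X.br b f = (∑ j, b (f j) * f.co j X.g) / f.sf X.g := rfl

theorem br_one : X.br 1 = 1 := by
  ext f
  simp only [br_apply, Pi.one_apply, one_mul, ← f.sf_apply]
  exact div_self f.sf_g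

def xv (v : ι) : X.OF → ℝ := X.br (Pi.single v 1)

def xm (T : Finset ι) : X.OF → ℝ := ∏ v ∈ T, X.xv v

theorem br_eq (b : ι → ℝ) : X.br b = ∑ v, b v • X.xv v := by
  have : b = ∑ v, b v • (Pi.single v 1 : ι → ℝ) := by
    ext i; simp [Finset.sum_apply, Pi.single_apply]
  conv_lhs => rw [this]
  simp [xv]

theorem sum_xv : ∑ v, X.xv v = 1 := by
  rw [← X.br_one, X.br_eq]; simp

variable {X}

theorem xv_apply (f : X.OF) (j : Fin d) : X.xv (f j) f = f.co j X.g / f.sf X.g := by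
  rw [xv, br_apply, sum_eq_single j]
  · simp
  · intro i _ hi
    rw [Pi.single_eq_of_ne]; simp; intro h; exact hi (f.inj h)
  · simp

theorem xv_apply_of_notMem {f : X.OF} {v : ι} (h : v ∉ univ.image f) : X.xv v f = 0 := by
  rw [xv, br_apply, sum_eq_zero]; simp
  intro j _
  rw [Pi.single_eq_of_ne]; simp
  rintro rfl; exact h (by simp)

theorem xm_apply (f : X.OF) (J : Finset (Fin d)) :
    X.xm (J.image f) f = (∏ j ∈ J, f.co j X.g) / f.sf X.g ^ J.card := by
  rw [xm, prod_apply, prod_image (fun a _ b _ h => f.inj h)]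
  simp only [xv_apply, prod_div_distrib, prod_const]

theorem xm_apply_of_not_subset {f : X.OF} {T : Finset ι} (h : ¬ T ⊆ univ.image f) :
    X.xm T f = 0 := by
  obtain ⟨v, hv, hn⟩ := not_subset.1 h
  rw [xm, prod_apply]
  exact prod_eq_zero hv (xv_apply_of_notMem hn)

theorem xm_eq_zero {T : Finset ι} (h : ¬ X.Face T) : X.xm T = 0 := by
  ext f
  exact xm_apply_of_not_subset (fun h1 => h (f.face.mono h1))

theorem xm_insert {T : Finset ι} {v : ι} (h : v ∉ T) : X.xm (insert v T) = X.xv v * X.xm T := by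
  rw [xm, prod_insert h, xm]

theorem xm_empty : X.xm ∅ = 1 := by simp [xm]

theorem xm_single (v : ι) : X.xm {v} = X.xv v := by simp [xm]

theorem xv_mul_eq_zero {v w : ι} (h : ¬ X.Face {v, w}) : X.xv v * X.xv w = 0 := by
  have hvw : v ≠ w := by rintro rfl; simp at h; exact h (face_single v)
  rw [← xm_single w, ← xm_insert (by simpa using hvw), xm_eq_zero h]

theorem xm_mul_xv_eq_zero {v : ι} {T : Finset ι} (h : ¬ X.Face (insert v T)) :
    X.xm T * X.xv v = 0 := by
  by_cases hv : v ∈ T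
  · rw [insert_eq_of_mem hv] at h; rw [xm_eq_zero h, zero_mul]
  · rw [mul_comm, ← xm_insert hv, xm_eq_zero h]

theorem xm_mul_xv_xv_eq_zero {v w : ι} {T : Finset ι} (h : ¬ X.Face (insert v (insert w T))) :
    X.xm T * X.xv v * X.xv w = 0 := by
  by_cases hw : w ∈ T
  · rw [insert_eq_of_mem hw] at h; rw [xm_mul_xv_eq_zero h, zero_mul]
  · rw [mul_right_comm, mul_comm _ (X.xv w), ← xm_insert hw, xm_mul_xv_eq_zero h]

/-- normalised volume factor -/
def OF.kap (f : X.OF) : ℝ := |Matrix.det (Matrix.of (fun j => X.p (f j)))|⁻¹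

theorem OF.det_ne (f : X.OF) : Matrix.det (Matrix.of (fun j => X.p (f j))) ≠ 0 := by
  have h := f.indep
  have := (Matrix.linearIndependent_rows_iff_isUnit (A := Matrix.of (fun j => X.p (f j)))).1 h
  exact ((Matrix.isUnit_iff_isUnit_det _).1 this).ne_zero

theorem OF.kap_pos (f : X.OF) : 0 < f.kap := by
  have := abs_pos.2 f.det_ne
  unfold OF.kap; positivity

def OF.wt (f : X.OF) : ℝ := f.kap * f.sf X.g ^ (d - 1) / ∏ j, f.co j X.g

variable (X)

def deg0 : (X.OF → ℝ) →ₗ[ℝ] ℝ := ∑ f : X.OF, f.wt • LinearMap.proj f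

def deg : (X.OF → ℝ) →ₗ[ℝ] ℝ := ∑ f : X.OF, (f.wt * f.sf X.g) • LinearMap.proj f

theorem deg0_apply (r : X.OF → ℝ) : X.deg0 r = ∑ f, f.wt * r f := by
  simp [deg0]

theorem deg_apply (r : X.OF → ℝ) : X.deg r = ∑ f, f.wt * f.sf X.g * r f := by
  simp [deg]

/-- restriction of a linear functional to the vertices -/
def lin : ((Fin d → ℝ) →ₗ[ℝ] ℝ) →ₗ[ℝ] (ι → ℝ) where
  toFun l i := l (X.p i)
  map_add' a b := by ext; simp
  map_smul' a b := by ext; simp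

theorem lin_apply (l : (Fin d → ℝ) →ₗ[ℝ] ℝ) (i : ι) : X.lin l i = l (X.p i) := rfl

theorem br_lin (l : (Fin d → ℝ) →ₗ[ℝ] ℝ) (f : X.OF) : X.br (X.lin l) f = l X.g / f.sf X.g := by
  rw [br_apply, f.lin_eq l X.g]; congr 1; apply sum_congr rfl; intro j _; rw [lin_apply, mul_comm]

theorem deg_br_lin (l : (Fin d → ℝ) →ₗ[ℝ] ℝ) (q : X.OF → ℝ) :
    X.deg (X.br (X.lin l) * q) = l X.g * X.deg0 q := by
  rw [deg_apply, deg0_apply, mul_sum]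
  apply sum_congr rfl
  intro f _
  rw [Pi.mul_apply, br_lin]
  have := f.sf_g
  field_simp

def PP (n : ℕ) : Submodule ℝ (X.OF → ℝ) := (LinearMap.range X.br) ^ n

variable {X}

theorem br_mem (b : ι → ℝ) : X.br b ∈ X.PP 1 := by
  rw [PP, pow_one]; exact ⟨b, rfl⟩

theorem xv_mem (v : ι) : X.xv v ∈ X.PP 1 := br_mem _

theorem PP.mul {m n : ℕ} {q r : X.OF → ℝ} (hq : q ∈ X.PP m) (hr : r ∈ X.PP n) :
    q * r ∈ X.PP (m + n) := by
  rw [PP, pow_add]; exact Submodule.mul_mem_mul hq hr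

theorem PP.br_mul {n : ℕ} {r : X.OF → ℝ} (b : ι → ℝ) (hr : r ∈ X.PP n) :
    X.br b * r ∈ X.PP (n + 1) := by
  rw [add_comm]; exact PP.mul (br_mem b) hr

theorem PP.xv_mul {n : ℕ} {r : X.OF → ℝ} (v : ι) (hr : r ∈ X.PP n) :
    X.xv v * r ∈ X.PP (n + 1) := PP.br_mul _ hr

theorem PP.one : (1 : X.OF → ℝ) ∈ X.PP 0 := by
  rw [PP, pow_zero]; exact Submodule.one_le.1 le_rfl

theorem PP.succ {n : ℕ} {q : X.OF → ℝ} (hq : q ∈ X.PP n) : q ∈ X.PP (n + 1) := by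
  have := PP.br_mul 1 hq; rwa [br_one, one_mul] at this

theorem PP.le {m n : ℕ} (h : m ≤ n) {q : X.OF → ℝ} (hq : q ∈ X.PP m) : q ∈ X.PP n := by
  induction h with
  | refl => exact hq
  | step _ ih => exact PP.succ ih

theorem PP.induct {n : ℕ} {C : (X.OF → ℝ) → Prop}
    (h : ∀ v, ∀ q ∈ X.PP n, C (X.xv v * q)) (h0 : C 0) (ha : ∀ x y, C x → C y → C (x + y))
    {q : X.OF → ℝ} (hq : q ∈ X.PP (n + 1)) : C q := by
  rw [PP, pow_succ'] at hq
  refine Submodule.mul_induction_on hq ?_ ha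
  rintro _ ⟨b, rfl⟩ q hq
  rw [br_eq, sum_mul]
  have hsum : ∀ s : Finset ι, C (∑ i ∈ s, b i • X.xv i * q) := by
    intro s
    induction s using Finset.induction_on with
    | empty => simpa using h0
    | insert a s ha2 ih =>
      rw [sum_insert ha2]
      apply ha _ _ _ ih
      rw [smul_mul_assoc, ← mul_smul_comm]
      exact h a _ (Submodule.smul_mem _ _ hq)
  exact hsum _

theorem PP.zero_cases {q : X.OF → ℝ} (hq : q ∈ X.PP 0) : ∃ c : ℝ, q = c • 1 := by
  rw [PP, pow_zero, Submodule.mem_one] at hq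
  obtain ⟨c, rfl⟩ := hq
  exact ⟨c, by rw [Algebra.algebraMap_eq_smul_one]⟩

theorem xm_mem (T : Finset ι) : X.xm T ∈ X.PP T.card := by
  induction T using Finset.induction_on with
  | empty => rw [xm_empty]; exact PP.one
  | insert a s ha ih => rw [xm_insert ha, card_insert_of_notMem ha]; exact PP.xv_mul a ih

/-- the adjacent ordered facet -/
def OF.flip (f : X.OF) (j : Fin d) : X.OF :=
  ⟨Function.update f.1 j (f.exists_adj j).choose, (f.exists_adj j).choose_spec.2⟩

theorem OF.flip_ne (f : X.OF) (j : Fin d) : f.flip j j ≠ f j := by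
  have := (f.exists_adj j).choose_spec.1
  simpa [OF.flip] using this

theorem OF.flip_of_ne (f : X.OF) {i j : Fin d} (h : i ≠ j) : f.flip j i = f i := by
  simp [OF.flip, h]

theorem OF.flip_val (f : X.OF) (j : Fin d) : (f.flip j).1 = Function.update f.1 j (f.flip j j) := by
  simp [OF.flip]

theorem OF.flip_flip (f : X.OF) (j : Fin d) : (f.flip j).flip j = f := by
  have h1 : (f.flip j).flip j j = f j := by
    apply (f.flip j).adj_unique j _ _ ((f.flip j).flip_ne j) (f.flip_ne j).symm
    · rw [← OF.flip_val]; exact ((f.flip j).flip j).2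
    · rw [f.flip_val]; simp; exact f.2
  apply Subtype.ext
  rw [OF.flip_val, h1, f.flip_val]; simp

theorem OF.flip_neg (f : X.OF) (j : Fin d) : f.co j (X.p (f.flip j j)) < 0 := by
  obtain ⟨a, -, -, h⟩ := f.adj j _ (f.flip_ne j) (f.flip j) (f.flip_val j)
  exact h

theorem OF.flip_co (f : X.OF) (j : Fin d) (x : Fin d → ℝ) :
    (f.flip j).co j x = f.co j x / f.co j (X.p (f.flip j j)) := by
  have h := (f.flip_neg j).ne
  have : f.co j = f.co j (X.p (f.flip j j)) • (f.flip j).co j := by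
    apply (f.flip j).lin_ext
    intro i
    by_cases hi : i = j
    · subst hi; simp [OF.co_self]
    · rw [LinearMap.smul_apply, OF.co_self, if_neg hi, f.flip_of_ne hi, f.co_self, if_neg hi]; simp
  have h2 := congrArg (fun l => l x) this
  simp only [LinearMap.smul_apply, smul_eq_mul] at h2
  rw [h2]; field_simp

theorem OF.flip_kap (f : X.OF) (j : Fin d) :
    (f.flip j).kap = - f.kap / f.co j (X.p (f.flip j j)) := by
  have h := f.flip_neg j
  have hdet : Matrix.det (Matrix.of (fun i => X.p (f.flip j i))) =
      f.co j (X.p (f.flip j j)) * Matrix.det (Matrix.of (fun i => X.p (f i))) := by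
    have := Matrix.det_updateRow_sum (Matrix.of (fun i => X.p (f i))) j
      (fun i => f.co i (X.p (f.flip j j)))
    rw [smul_eq_mul] at this
    rw [← this]
    congr 1
    ext i k
    by_cases hi : i = j
    · subst hi
      simp only [Matrix.of_apply, Matrix.updateRow_self]
      conv_lhs => rw [← f.sum_co (X.p (f.flip i i))]
      rfl
    · simp only [Matrix.of_apply, Matrix.updateRow_ne hi, f.flip_of_ne hi]
  rw [OF.kap, hdet, abs_mul, mul_inv, abs_of_neg h, OF.kap]
  field_simp

theorem ridge_eq (f : X.OF) (T : Finset ι) (hT : T.card + 1 = d) :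
    f.wt * X.xm T f = ∑ j, if T = (univ.erase j).image f then f.kap / f.co j X.g else 0 := by
  by_cases hsub : T ⊆ univ.image f
  · obtain ⟨J, -, rfl⟩ := subset_image_iff.1 hsub
    have hJ : J.card + 1 = d := by rwa [card_image_of_injective _ f.inj] at hT
    have hJc : Jᶜ.card = 1 := by rw [card_compl]; simp; omega
    obtain ⟨j, hj⟩ := card_eq_one.1 hJc
    have hJ2 : J = univ.erase j := by
      rw [← compl_compl J, hj]; ext; simp
    rw [sum_eq_single j]
    · rw [if_pos (by rw [hJ2]), xm_apply, OF.wt]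
      have h1 := f.sf_g
      have h3 : ∏ j, f.co j X.g = f.co j X.g * ∏ j ∈ J, f.co j X.g := by
        rw [hJ2, mul_prod_erase univ (fun j => f.co j X.g) (mem_univ j)]
      have h4 : ∏ j ∈ J, f.co j X.g ≠ 0 := prod_ne_zero_iff.2 (fun j _ => f.co_g j)
      have h5 := f.co_g j
      rw [h3, show d - 1 = J.card by omega]
      field_simp
    · intro i _ hi
      rw [if_neg]
      rw [hJ2]
      intro h
      have := (image_injective f.inj) h
      have h2 : j ∈ univ.erase j := by rw [this]; simp [hi.symm]
      simp at h2
    · simp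
  · rw [xm_apply_of_not_subset hsub, mul_zero, sum_eq_zero]
    intro j _
    rw [if_neg]; rintro rfl; exact hsub (image_subset_image (subset_univ _))

theorem ridge_cancel (T : Finset ι) (hT : T.card + 1 = d) : X.deg0 (X.xm T) = 0 := by
  rw [deg0_apply]
  simp only [ridge_eq _ T hT]
  rw [sum_comm]
  apply sum_eq_zero
  intro j _
  have him : ∀ f : X.OF, (univ.erase j).image (f.flip j) = (univ.erase j).image f := by
    intro f; apply image_congr; intro i hi
    exact f.flip_of_ne (by simpa using hi)
  apply sum_involution (fun f _ => f.flip j)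
  · intro f _
    rw [him]
    split_ifs
    · rw [f.flip_kap, f.flip_co]
      have h1 := f.co_g j
      have h2 := (f.flip_neg j).ne
      field_simp; ring
    · simp
  · intro f _ _ h
    exact f.flip_ne j (by rw [h])
  · intro f _; exact f.flip_flip j
  · intro f _; exact mem_univ _

theorem deg0_key (n : ℕ) : ∀ T : Finset ι, T.card + n + 1 = d → ∀ q ∈ X.PP n,
    X.deg0 (X.xm T * q) = 0 := by
  induction n with
  | zero =>
    intro T hT q hq
    obtain ⟨c, rfl⟩ := PP.zero_cases hq
    rw [mul_smul_comm, mul_one, map_smul, ridge_cancel T (by omega), smul_zero]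
  | succ n ih =>
    intro T hT q hq
    refine PP.induct (C := fun q => X.deg0 (X.xm T * q) = 0) ?_ (by simp)
      (fun x y hx hy => by rw [mul_add, map_add, hx, hy, add_zero]) hq
    intro v q hq
    have h1 : ∀ v, v ∉ T → X.deg0 (X.xm T * (X.xv v * q)) = 0 := by
      intro v hv
      have := ih (insert v T) (by rw [card_insert_of_notMem hv]; omega) q hq
      rwa [xm_insert hv, mul_comm (X.xv v), mul_assoc] at this
    by_cases hv : v ∈ T
    swap
    · exact h1 v hv
    by_cases hF : X.Face T
    swap
    · rw [xm_eq_zero hF, zero_mul, map_zero]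
    obtain ⟨f, hf⟩ := hF.exists_OF
    obtain ⟨j, -, rfl⟩ := mem_image.1 (hf hv)
    have : ∃ k, f k ∉ T := by
      by_contra! h
      have : univ.image f ⊆ T := by intro i hi; obtain ⟨k, -, rfl⟩ := mem_image.1 hi; exact h k
      have := card_le_card this
      rw [card_image_of_injective _ f.inj] at this; simp at this; omega
    obtain ⟨k, hk⟩ := this
    have hjk : j ≠ k := by rintro rfl; exact hk hv
    let l := f.co j - (f.co j X.g / f.co k X.g) • f.co k
    have hl : X.br (X.lin l) = 0 := by
      ext f'
      rw [br_lin]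
      have := f.co_g k
      simp only [l, LinearMap.sub_apply, LinearMap.smul_apply, smul_eq_mul, Pi.zero_apply]
      field_simp; simp
    have h2 : X.deg0 (X.xm T * (X.br (X.lin l) * q)) = 0 := by rw [hl]; simp
    rw [br_eq, sum_mul, mul_sum, map_sum, sum_eq_single (f j)] at h2
    · simp only [lin_apply, smul_mul_assoc, mul_smul_comm, map_smul, l, LinearMap.sub_apply,
        LinearMap.smul_apply, f.co_self, hjk, if_false, if_true] at h2
      simpa using h2
    · intro w _ hw
      rw [smul_mul_assoc, mul_smul_comm, map_smul]
      by_cases hwT : w ∈ T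
      · obtain ⟨i, -, rfl⟩ := mem_image.1 (hf hwT)
        have h3 : i ≠ j := by rintro rfl; exact hw rfl
        have h4 : i ≠ k := by rintro rfl; exact hk hwT
        simp [lin_apply, l, f.co_self, h3, h4]
      · rw [h1 w hwT, smul_zero]
    · simp

theorem deg_lin_mul {q : X.OF → ℝ} (l : (Fin d → ℝ) →ₗ[ℝ] ℝ) (hq : q ∈ X.PP (d - 1)) :
    X.deg (X.br (X.lin l) * q) = 0 := by
  have hd := X.hd
  have := deg0_key (d - 1) ∅ (by simp; omega) q hq
  rw [xm_empty, one_mul] at this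
  rw [deg_br_lin, this, mul_zero]

theorem deg_facet {F : Finset ι} (hF : X.Face F) (hc : F.card = d) : 0 < X.deg (X.xm F) := by
  have hd := X.hd
  rw [deg_apply]
  have h1 : ∀ f : X.OF, f.wt * f.sf X.g * X.xm F f = if univ.image f = F then f.kap else 0 := by
    intro f
    split_ifs with h
    · subst h
      rw [xm_apply, OF.wt]
      have h1 := f.sf_g
      have h4 : ∏ j, f.co j X.g ≠ 0 := prod_ne_zero_iff.2 (fun j _ => f.co_g j)
      rw [card_univ, Fintype.card_fin]
      have : f.sf X.g ^ d = f.sf X.g ^ (d-1) * f.sf X.g := by rw [← pow_succ]; congr 1; omega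
      rw [this]
      field_simp
    · rw [xm_apply_of_not_subset, mul_zero]
      intro h2; apply h; symm
      apply eq_of_subset_of_card_le h2
      rw [card_image_of_injective _ f.inj, hc]; simp
  simp only [h1]
  obtain ⟨f, hf⟩ := exists_OF hF hc
  apply sum_pos'
  · intro f _; split_ifs; exacts [f.kap_pos.le, le_rfl]
  · exact ⟨f, mem_univ _, by rw [if_pos hf]; exact f.kap_pos⟩

/-- the antipodal ordered facet -/
def OF.ng (f : X.OF) : X.OF := ⟨fun j => X.neg (f j), fun a b h => f.inj (X.neg_inj h), by
  have := f.face.neg; rwa [image_image] at this⟩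

theorem OF.ng_apply (f : X.OF) (j : Fin d) : f.ng j = X.neg (f j) := rfl

theorem OF.ng_ng (f : X.OF) : f.ng.ng = f := by
  apply Subtype.ext; funext j; exact X.neg_neg _

theorem OF.ng_co (f : X.OF) (j : Fin d) : f.ng.co j = - f.co j := by
  apply f.lin_ext
  intro i
  have h1 : X.p (f i) = - X.p (f.ng i) := by rw [f.ng_apply, X.p_neg, _root_.neg_neg]
  rw [LinearMap.neg_apply, f.co_self]
  rw [h1, map_neg, OF.co_self]

theorem OF.ng_sf (f : X.OF) : f.ng.sf = - f.sf := by
  ext; simp [OF.sf_apply, OF.ng_co]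

theorem OF.ng_kap (f : X.OF) : f.ng.kap = f.kap := by
  have : Matrix.of (fun j => X.p (f.ng j)) = - Matrix.of (fun j => X.p (f j)) := by
    ext i k; simp [f.ng_apply, X.p_neg]
  rw [OF.kap, this, Matrix.det_neg, abs_mul, abs_pow]; simp [OF.kap]

variable (X)

def S : (X.OF → ℝ) →ₐ[ℝ] (X.OF → ℝ) where
  toFun r f := r f.ng
  map_one' := rfl
  map_mul' _ _ := rfl
  map_zero' := rfl
  map_add' _ _ := rfl
  commutes' _ := rfl

variable {X}

theorem S_apply (r : X.OF → ℝ) (f : X.OF) : X.S r f = r f.ng := rfl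

theorem S_S (r : X.OF → ℝ) : X.S (X.S r) = r := by ext f; rw [S_apply, S_apply, f.ng_ng]

theorem S_br (b : ι → ℝ) : X.S (X.br b) = X.br (fun i => b (X.neg i)) := by
  ext f
  rw [S_apply, br_apply, br_apply, f.ng_sf]
  simp [f.ng_co, f.ng_apply, neg_div_neg_eq]

theorem S_xv (v : ι) : X.S (X.xv v) = X.xv (X.neg v) := by
  rw [xv, S_br, xv]; congr 1; ext i
  simp only [Pi.single_apply, X.neg_eq_iff]

theorem S_mem {n : ℕ} {q : X.OF → ℝ} (hq : q ∈ X.PP n) : X.S q ∈ X.PP n := by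
  induction n generalizing q with
  | zero =>
    obtain ⟨c, rfl⟩ := PP.zero_cases hq
    rw [map_smul, map_one]; exact hq
  | succ n ih =>
    refine PP.induct (C := fun q => X.S q ∈ X.PP (n+1)) ?_ (by simp)
      (fun x y hx hy => by rw [map_add]; exact Submodule.add_mem _ hx hy) hq
    intro v q hq
    rw [map_mul, S_xv]; exact PP.xv_mul _ (ih hq)

theorem deg_S (r : X.OF → ℝ) : X.deg (X.S r) = X.deg r := by
  have hd := X.hd
  rw [deg_apply, deg_apply]
  let e : X.OF ≃ X.OF := ⟨OF.ng, OF.ng, OF.ng_ng, OF.ng_ng⟩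
  rw [← Equiv.sum_comp e]
  apply sum_congr rfl
  intro f _
  have : X.S r (e f) = r f := by rw [S_apply]; congr 1; exact f.ng_ng
  rw [this]
  congr 1
  have h0 : e f = f.ng := rfl
  have h4 : ∏ j, f.co j X.g ≠ 0 := prod_ne_zero_iff.2 (fun j _ => f.co_g j)
  rw [h0, OF.wt, OF.wt, f.ng_sf, f.ng_kap]
  simp only [f.ng_co, LinearMap.neg_apply, prod_neg]
  have h5 : (-f.sf X.g) ^ (d-1) * (-f.sf X.g) = (-1) ^ d * (f.sf X.g ^ (d-1) * f.sf X.g) := by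
    rw [← pow_succ, ← pow_succ, show d - 1 + 1 = d by omega, neg_pow]
  have h6 : ((-1:ℝ)^d) ≠ 0 := by positivity
  rw [div_mul_eq_mul_div, div_mul_eq_mul_div, mul_assoc, h5, mul_assoc, card_univ, Fintype.card_fin]
  field_simp

end ring

end CSP

theorem spectral_vec {Λ : Type*} [Fintype Λ] (N : Matrix Λ Λ ℝ) (hN : ∀ i j, N i j = N j i) :
    ∃ (u : Λ → Λ → ℝ) (lam : Λ → ℝ), (∀ i, N.mulVec (u i) = lam i • u i) ∧
      (∀ i j, u i ⬝ᵥ u j = if i = j then 1 else 0) ∧ ∀ z : Λ → ℝ, z = ∑ i, (u i ⬝ᵥ z) • u i := by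
  have h : N.IsHermitian := by ext i j; simp [Matrix.conjTranspose_apply, hN i j]
  refine ⟨fun i => (h.eigenvectorBasis i).ofLp, h.eigenvalues, fun i => ?_, fun i j => ?_, fun z => ?_⟩
  · exact h.mulVec_eigenvectorBasis i
  · have := (orthonormal_iff_ite.1 h.eigenvectorBasis.orthonormal) i j
    rw [← this, EuclideanSpace.inner_eq_star_dotProduct]
    simp [dotProduct_comm]
  · have := h.eigenvectorBasis.sum_repr' (WithLp.toLp 2 z)
    have h2 := congrArg WithLp.ofLp this
    conv_lhs => rw [show z = (WithLp.toLp 2 z : EuclideanSpace ℝ Λ).ofLp from rfl, ← h2]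
    rw [WithLp.ofLp_sum]
    apply sum_congr rfl
    intro i _
    rw [WithLp.ofLp_smul, EuclideanSpace.inner_eq_star_dotProduct]
    simp [dotProduct_comm]

theorem ground_state {Λ : Type*} [Fintype Λ] (M : Λ → Λ → ℝ) (hM : ∀ i j, M i j = M j i)
    (h c : Λ → ℝ) (hh : ∀ v, h v ≠ 0) :
    ∑ v, (∑ w, M v w * h w) * (c v ^ 2 / h v) - ∑ v, ∑ w, M v w * (c v * c w) =
      (1 / 2) * ∑ v, ∑ w, M v w * (h v * h w * (c v / h v - c w / h w) ^ 2) := by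
  have e1 : ∀ v w, M v w * (h v * h w * (c v / h v - c w / h w) ^ 2) =
      M v w * h w * (c v ^ 2 / h v) + M v w * h v * (c w ^ 2 / h w) - 2 * (M v w * (c v * c w)) := by
    intro v w
    have h1 := hh v
    have h2 := hh w
    field_simp; ring
  simp only [e1, sum_sub_distrib, sum_add_distrib, ← mul_sum]
  rw [sum_comm (f := fun v w => M v w * h v * (c w ^ 2 / h w))]
  have e2 : ∀ w v, M v w * h v * (c w ^ 2 / h w) = M w v * h v * (c w ^ 2 / h w) := by
    intro w v; rw [hM]
  simp only [e2, sum_mul]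
  ring

theorem matrix_lemma {Λ : Type*} [Fintype Λ] (M : Λ → Λ → ℝ) (hM : ∀ i j, M i j = M j i)
    (h : Λ → ℝ) (hh : ∀ v, 0 < h v) (hw : ∀ v, 0 < ∑ w, M v w * h w)
    (hoff : ∀ v w, v ≠ w → 0 ≤ M v w)
    (hconn : ∀ c : Λ → ℝ, (∀ v w, v ≠ w → 0 < M v w → c v / h v = c w / h w) →
      ∃ t, ∀ v, c v = t * h v)
    (hsq : ∀ c : Λ → ℝ, ∑ v, ∑ w, M v w * (c v * c w) ≤
      ∑ v, h v * (∑ w, M v w * c w) ^ 2 / (∑ w, M v w * h w))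
    (c : Λ → ℝ) (hc : ∑ v, (∑ w, M v w * h w) * c v = 0) :
    ∑ v, ∑ w, M v w * (c v * c w) ≤ 0 ∧ (∑ v, ∑ w, M v w * (c v * c w) = 0 →
      ∀ v, ∑ w, M v w * c w = 0) := by
  set W : Λ → ℝ := fun v => ∑ w, M v w * h w with hWdef
  have hW : ∀ v, 0 < W v := hw
  let s : Λ → ℝ := fun v => Real.sqrt (W v / h v)
  have hs : ∀ v, 0 < s v := fun v => Real.sqrt_pos.2 (div_pos (hW v) (hh v))
  have hs2 : ∀ v, s v ^ 2 = W v / h v := fun v => Real.sq_sqrt (div_pos (hW v) (hh v)).le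
  let N : Matrix Λ Λ ℝ := fun v w => M v w / (s v * s w)
  obtain ⟨u, lam, hu, horth, hexp⟩ := spectral_vec N (fun i j => by simp only [N]; rw [hM, mul_comm])
  -- conversion
  have conv1 : ∀ z : Λ → ℝ, ∀ v, N.mulVec z v = (∑ w, M v w * (z w / s w)) / s v := by
    intro z v
    simp only [Matrix.mulVec, dotProduct, N, sum_div]
    apply sum_congr rfl; intro w _
    have := (hs v).ne'; have := (hs w).ne'
    field_simp
  have conv2 : ∀ z : Λ → ℝ, z ⬝ᵥ N.mulVec z = ∑ v, ∑ w, M v w * ((z v / s v) * (z w / s w)) := by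
    intro z
    simp only [dotProduct, conv1]
    apply sum_congr rfl; intro v _
    rw [mul_div_assoc', div_eq_mul_inv, mul_sum, sum_mul]
    apply sum_congr rfl; intro w _
    ring
  have hlam : ∀ i, lam i ≤ 0 ∨ ∃ t, ∀ v, u i v = t * (s v * h v) := by
    intro i
    have n1 : u i ⬝ᵥ u i = 1 := by rw [horth]; simp
    have q1 : u i ⬝ᵥ N.mulVec (u i) = lam i := by rw [hu, dotProduct_smul, n1]; simp
    have q2 : ∑ v, h v * (∑ w, M v w * (u i w / s w)) ^ 2 / W v = lam i ^ 2 := by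
      have : ∀ v, h v * (∑ w, M v w * (u i w / s w)) ^ 2 / W v = (N.mulVec (u i) v) ^ 2 := by
        intro v
        rw [conv1, div_pow, hs2]
        have := (hW v).ne'; have := (hh v).ne'
        field_simp
      simp only [this, hu, Pi.smul_apply, smul_eq_mul, mul_pow, ← mul_sum]
      have : ∑ v, u i v ^ 2 = u i ⬝ᵥ u i := by simp [dotProduct, sq]
      rw [this, n1, mul_one]
    have q3 := hsq (fun v => u i v / s v)
    rw [q2] at q3
    rw [← conv2, q1] at q3
    have q4 := ground_state M hM h (fun v => u i v / s v) (fun v => (hh v).ne')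
    rw [← conv2, q1] at q4
    have q5 : ∑ v, (∑ w, M v w * h w) * ((u i v / s v) ^ 2 / h v) = 1 := by
      rw [← n1, dotProduct]
      apply sum_congr rfl; intro v _
      rw [div_pow, hs2]
      change W v * _ = _
      have := (hW v).ne'; have := (hh v).ne'
      field_simp
    rw [q5] at q4
    have hterm : ∀ v w, 0 ≤ M v w * (h v * h w * ((u i v / s v) / h v - (u i w / s w) / h w) ^ 2) := by
      intro v w
      by_cases hvw : v = w
      · subst hvw; simp
      · have := hoff v w hvw
        have := hh v; have := hh w
        positivity
    have q6 : 0 ≤ ∑ v, ∑ w, M v w * (h v * h w * ((u i v / s v) / h v - (u i w / s w) / h w) ^ 2) :=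
      sum_nonneg (fun v _ => sum_nonneg (fun w _ => hterm v w))
    by_cases hl0 : lam i ≤ 0
    · exact Or.inl hl0
    right
    push Not at hl0
    have hl1 : 1 ≤ lam i := by nlinarith
    have q7 : ∑ v, ∑ w, M v w * (h v * h w * ((u i v / s v) / h v - (u i w / s w) / h w) ^ 2) = 0 := by
      linarith
    rw [sum_eq_zero_iff_of_nonneg (fun v _ => sum_nonneg (fun w _ => hterm v w))] at q7
    obtain ⟨t, ht⟩ := hconn (fun v => u i v / s v) (by
      intro v w hvw hpos
      have q8 := q7 v (mem_univ v)
      rw [sum_eq_zero_iff_of_nonneg (fun w _ => hterm v w)] at q8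
      have q9 := q8 w (mem_univ w)
      have := hh v; have := hh w
      have h3 : M v w * (h v * h w) ≠ 0 := by positivity
      rw [← mul_assoc] at q9
      have := (mul_eq_zero.1 q9).resolve_left h3
      have := pow_eq_zero_iff (two_ne_zero) |>.1 this
      linarith)
    refine ⟨t, fun v => ?_⟩
    have := ht v
    have := (hs v).ne'
    rw [show u i v = (u i v / s v) * s v by field_simp, ht v]; ring
  set z : Λ → ℝ := fun v => s v * c v with hz
  have hzs : ∀ v, z v / s v = c v := fun v => by
    have := (hs v).ne'
    simp only [hz]; field_simp
  have ha : ∀ i, lam i * (u i ⬝ᵥ z) ^ 2 ≤ 0 ∧ (lam i * (u i ⬝ᵥ z) ^ 2 = 0 → lam i * (u i ⬝ᵥ z) = 0) := by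
    intro i
    rcases hlam i with h1 | ⟨t, ht⟩
    · refine ⟨mul_nonpos_of_nonpos_of_nonneg h1 (sq_nonneg _), fun h2 => ?_⟩
      rcases mul_eq_zero.1 h2 with h3 | h3
      · rw [h3, zero_mul]
      · rw [pow_eq_zero_iff two_ne_zero] at h3; rw [h3, mul_zero]
    · have : u i ⬝ᵥ z = 0 := by
        have : u i ⬝ᵥ z = t * ∑ v, W v * c v := by
          rw [dotProduct, mul_sum]
          apply sum_congr rfl; intro v _
          rw [ht, hz]
          have h3 := hs2 v
          have := (hh v).ne'
          have h4 : s v * s v * h v = W v := by rw [← sq, h3]; field_simp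
          rw [← h4]; ring
        rw [this]
        have : ∑ v, W v * c v = 0 := hc
        rw [this, mul_zero]
      rw [this]; simp
  have hNz : N.mulVec z = ∑ i, (lam i * (u i ⬝ᵥ z)) • u i := by
    conv_lhs => rw [hexp z]
    rw [Matrix.mulVec_sum]
    apply sum_congr rfl; intro i _
    rw [Matrix.mulVec_smul, hu, smul_smul, mul_comm]
  have hq : ∑ v, ∑ w, M v w * (c v * c w) = ∑ i, lam i * (u i ⬝ᵥ z) ^ 2 := by
    have := conv2 z
    simp only [hzs] at this
    rw [← this, hNz, dotProduct_sum]
    apply sum_congr rfl; intro i _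
    rw [dotProduct_smul, smul_eq_mul, dotProduct_comm z]; ring
  rw [hq]
  refine ⟨sum_nonpos (fun i _ => (ha i).1), fun h0 v => ?_⟩
  have h1 : ∀ i, lam i * (u i ⬝ᵥ z) ^ 2 = 0 := by
    have := (sum_eq_zero_iff_of_nonpos (fun i _ => (ha i).1)).1 h0
    exact fun i => this i (mem_univ i)
  have h2 : N.mulVec z = 0 := by
    rw [hNz]; apply sum_eq_zero; intro i _; rw [(ha i).2 (h1 i), zero_smul]
  have h3 := conv1 z v
  rw [h2] at h3
  simp only [hzs, Pi.zero_apply] at h3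
  have := (hs v).ne'
  rcases div_eq_zero_iff.1 h3.symm with h4 | h4
  · exact h4
  · exact absurd h4 this

namespace CSP

section hr

variable {d : ℕ} {ι : Type} [Fintype ι] {X : CSP d ι}

theorem deg_pos {σ : Finset ι} (h : X.Face σ) : 0 < X.deg (X.xm σ) := by
  induction hk : d - σ.card using Nat.strong_induction_on generalizing σ with
  | _ k ih =>
    rcases h.card_le.eq_or_lt with h1 | h1
    · exact deg_facet h h1
    · obtain ⟨l, hl, hl2⟩ := h.exact
      have e1 : X.deg (X.xm σ) = X.deg (X.br (1 - X.lin l) * X.xm σ) := by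
        rw [map_sub, sub_mul, map_sub, br_one, one_mul,
          deg_lin_mul l (PP.le (by omega) (xm_mem σ)), sub_zero]
      rw [e1, br_eq, sum_mul, map_sum]
      have hterm : ∀ v, v ∉ σ → X.Face (insert v σ) →
          0 < X.deg (((1 : ι → ℝ) - X.lin l) v • X.xv v * X.xm σ) := by
        intro v hv hF
        rw [smul_mul_assoc, ← xm_insert hv, map_smul, smul_eq_mul]
        apply mul_pos
        · have h2 := hl v
          have h3 : l (X.p v) ≠ 1 := fun h => hv ((hl2 v).1 h)
          simp only [Pi.sub_apply, Pi.one_apply, lin_apply, sub_pos]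
          exact lt_of_le_of_ne h2 h3
        · have hc := card_insert_of_notMem hv
          exact ih (d - (insert v σ).card) (by omega) hF rfl
      apply sum_pos'
      · intro v _
        by_cases hv : v ∈ σ
        · simp [lin_apply, (hl2 v).2 hv]
        · by_cases hF : X.Face (insert v σ)
          · exact (hterm v hv hF).le
          · rw [smul_mul_assoc, ← xm_insert hv, xm_eq_zero hF]; simp
      · obtain ⟨F, hF1, hF2, hF3⟩ := h.exists_facet
        obtain ⟨v, hv, hvn⟩ := exists_of_ssubset (Finset.ssubset_iff_subset_ne.2 ⟨hF1, by
          rintro rfl; omega⟩)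
        exact ⟨v, mem_univ v, hterm v hvn (hF2.mono (insert_subset hv hF1))⟩

theorem update_subset {τ : Finset ι} {f f' : X.OF} {j : Fin d} {q : ι} (hτ : τ ⊆ univ.image f)
    (hj : f j ∉ τ) (hf' : f'.1 = Function.update f.1 j q) : τ ⊆ univ.image f' := by
  intro v hv
  obtain ⟨k, -, rfl⟩ := mem_image.1 (hτ hv)
  refine mem_image.2 ⟨k, mem_univ _, ?_⟩
  rw [hf', Function.update_of_ne]; rintro rfl; exact hj hv

theorem OF.face_insert {τ : Finset ι} {f : X.OF} (hτ : τ ⊆ univ.image f) (i : Fin d) :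
    X.Face (insert (f i) τ) :=
  f.face.mono (insert_subset (by simp) hτ)

theorem OF.face_insert2 {τ : Finset ι} {f : X.OF} (hτ : τ ⊆ univ.image f) (i j : Fin d) :
    X.Face (insert (f i) (insert (f j) τ)) :=
  f.face.mono (insert_subset (by simp) (insert_subset (by simp) hτ))

theorem exists_other {τ : Finset ι} (hc : τ.card + 2 ≤ d) (f : X.OF) (j : Fin d) :
    ∃ i, i ≠ j ∧ f i ∉ τ := by
  by_contra! h
  have : (univ.erase j).image f ⊆ τ := by
    intro v hv
    obtain ⟨i, hi, rfl⟩ := mem_image.1 hv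
    exact h i (ne_of_mem_erase hi)
  have := card_le_card this
  rw [card_image_of_injective _ f.inj, card_erase_of_mem (mem_univ _)] at this
  simp at this; omega

theorem update_notMem {τ : Finset ι} {f f' : X.OF} {j : Fin d} {q : ι} (hτ : τ ⊆ univ.image f)
    (hj : f j ∉ τ) (hf' : f'.1 = Function.update f.1 j q) : q ∉ τ := by
  intro hq
  obtain ⟨k, -, hk⟩ := mem_image.1 (hτ hq)
  have hkj : k ≠ j := by rintro rfl; rw [hk] at hj; exact hj hq
  apply hkj; apply f'.inj
  rw [hf', Function.update_of_ne hkj, Function.update_self, hk]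

theorem link_const {τ : Finset ι} (hτ : X.Face τ) (hc : τ.card + 2 ≤ d) (c : ι → ℝ)
    (h : ∀ v w, v ∉ τ → w ∉ τ → v ≠ w → X.Face (insert v (insert w τ)) → c v = c w) :
    ∃ t, ∀ v, v ∉ τ → X.Face (insert v τ) → c v = t := by
  obtain ⟨f0, h0⟩ := hτ.exists_OF
  have hd := X.hd
  obtain ⟨i0, -, hi0⟩ := exists_other hc f0 ⟨0, by omega⟩
  refine ⟨c (f0 i0), fun v hvτ hv => ?_⟩
  obtain ⟨f, hf, hτf, j, rfl⟩ := connected_star τ (fun f => ∀ j, f j ∉ τ → c (f j) = c (f0 i0)) f0 h0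
    (by
      intro j hj
      by_cases hji : j = i0
      · rw [hji]
      · exact h _ _ hj hi0 (fun h => hji (f0.inj h)) (OF.face_insert2 h0 _ _))
    (by
      intro f f' j q hf hτf hj hq hf' i hi
      by_cases hij : i = j
      · subst hij
        obtain ⟨k, hk, hkτ⟩ := exists_other hc f i
        have hk2 : f' k = f k := by rw [hf', Function.update_of_ne hk]
        rw [← hf k hkτ, ← hk2]
        exact h _ _ hi (by rw [hk2]; exact hkτ) (fun h => hk (f'.inj h).symm)
          (OF.face_insert2 (update_subset hτf hj hf') _ _)
      · have hk2 : f' i = f i := by rw [hf', Function.update_of_ne hij]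
        rw [hk2] at hi ⊢
        exact hf i hi) hv
  exact hf j hvτ

theorem lin_glue {τ : Finset ι} (hτ : X.Face τ) (hc : τ.card + 2 ≤ d) (c : ι → ℝ)
    (h : ∀ v, v ∉ τ → X.Face (insert v τ) → ∃ l : (Fin d → ℝ) →ₗ[ℝ] ℝ,
      ∀ i, X.Face (insert i (insert v τ)) → c i = l (X.p i)) :
    ∃ l : (Fin d → ℝ) →ₗ[ℝ] ℝ, ∀ i, X.Face (insert i τ) → c i = l (X.p i) := by
  obtain ⟨f0, h0⟩ := hτ.exists_OF
  obtain ⟨l, hl⟩ := exists_dual_of_indep f0.indep (fun j => c (f0 j))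
  refine ⟨l, fun v hv => ?_⟩
  obtain ⟨f, hf, hτf, j, rfl⟩ := connected_star τ (fun f => ∀ j, c (f j) = l (X.p (f j))) f0 h0
    (fun j => (hl j).symm)
    (by
      intro f f' j q hf hτf hj hq hf' i
      by_cases hij : i = j
      · subst hij
        obtain ⟨k, hk, hkτ⟩ := exists_other hc f i
        have hk2 : f' k = f k := by rw [hf', Function.update_of_ne hk]
        obtain ⟨m, hm⟩ := h (f k) hkτ (OF.face_insert hτf k)
        have hml : m = l := by
          apply f.lin_ext; intro a
          rw [← hf a, hm]; exact OF.face_insert2 hτf a k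
        rw [← hml, hm]
        rw [← hk2]
        exact OF.face_insert2 (update_subset hτf hj hf') _ _
      · have hk2 : f' i = f i := by rw [hf', Function.update_of_ne hij]
        rw [hk2]
        exact hf i) hv
  exact hf j

/-- the hypotheses and conclusion of the Hodge-Riemann property for a face -/
def HR (X : CSP d ι) (τ : Finset ι) : Prop :=
  ∀ b : ι → ℝ, X.deg (X.xm τ * X.br b) = 0 → X.deg (X.xm τ * (X.br b * X.br b)) ≤ 0 ∧
    (X.deg (X.xm τ * (X.br b * X.br b)) = 0 → ∃ l : (Fin d → ℝ) →ₗ[ℝ] ℝ,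
      ∀ i, X.Face (insert i τ) → b i = l (X.p i))

theorem xm_mul_mem {τ : Finset ι} {k n : ℕ} {q : X.OF → ℝ} (hq : q ∈ X.PP n)
    (h : τ.card + n ≤ k) : X.xm τ * q ∈ X.PP k := PP.le h (PP.mul (xm_mem τ) hq)

theorem deg_xm_lin {τ : Finset ι} {n : ℕ} {q : X.OF → ℝ} (hq : q ∈ X.PP n)
    (h : τ.card + n + 1 ≤ d) (l : (Fin d → ℝ) →ₗ[ℝ] ℝ) :
    X.deg (X.xm τ * (X.br (X.lin l) * q)) = 0 := by
  rw [mul_left_comm]; exact deg_lin_mul l (xm_mul_mem hq (by omega))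

theorem Face.exists_lin {τ : Finset ι} (hτ : X.Face τ) (b : ι → ℝ) :
    ∃ l : (Fin d → ℝ) →ₗ[ℝ] ℝ, ∀ i ∈ τ, l (X.p i) = b i := by
  obtain ⟨l, hl⟩ := exists_dual_of_indep hτ.indep (fun i => b i)
  exact ⟨l, fun i hi => hl ⟨i, hi⟩⟩

/-- it suffices to treat `b` vanishing on `τ`. -/
theorem HR_of_zero {τ : Finset ι} (hτ : X.Face τ) (hc : τ.card + 2 ≤ d)
    (H : ∀ b : ι → ℝ, (∀ i ∈ τ, b i = 0) → X.deg (X.xm τ * X.br b) = 0 →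
      X.deg (X.xm τ * (X.br b * X.br b)) ≤ 0 ∧
      (X.deg (X.xm τ * (X.br b * X.br b)) = 0 → ∃ l : (Fin d → ℝ) →ₗ[ℝ] ℝ,
      ∀ i, X.Face (insert i τ) → b i = l (X.p i))) : X.HR τ := by
  intro b hb
  obtain ⟨l, hl⟩ := hτ.exists_lin b
  have e1 : X.deg (X.xm τ * X.br (b - X.lin l)) = 0 := by
    have := deg_xm_lin (τ := τ) (X := X) PP.one (by omega) l
    rw [mul_one] at this
    rw [map_sub, mul_sub, map_sub, hb, this, sub_zero]
  have e2 : X.deg (X.xm τ * (X.br (b - X.lin l) * X.br (b - X.lin l))) =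
      X.deg (X.xm τ * (X.br b * X.br b)) := by
    have h1 := deg_xm_lin (τ := τ) (X := X) (br_mem b) (by omega) l
    have h2 := deg_xm_lin (τ := τ) (X := X) (br_mem (X.lin l)) (by omega) l
    have : X.xm τ * (X.br (b - X.lin l) * X.br (b - X.lin l)) = X.xm τ * (X.br b * X.br b)
      - (2:ℝ) • (X.xm τ * (X.br (X.lin l) * X.br b)) + X.xm τ * (X.br (X.lin l) * X.br (X.lin l)) := by
      rw [map_sub, two_smul]; ring
    rw [this, map_add, map_sub, map_smul, h1, h2]; simp
  obtain ⟨h1, h2⟩ := H (b - X.lin l) (fun i hi => by simp [lin_apply, hl i hi]) e1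
  rw [e2] at h1 h2
  refine ⟨h1, fun h0 => ?_⟩
  obtain ⟨m, hm⟩ := h2 h0
  refine ⟨m + l, fun i hi => ?_⟩
  have := hm i hi
  simp only [Pi.sub_apply, lin_apply] at this
  rw [LinearMap.add_apply]; linarith

theorem deg_br_sum (q r : X.OF → ℝ) (b : ι → ℝ) :
    X.deg (q * (X.br b * r)) = ∑ v, b v * X.deg (q * (X.xv v * r)) := by
  rw [br_eq, sum_mul, mul_sum, map_sum]
  apply sum_congr rfl; intro v _
  rw [smul_mul_assoc, mul_smul_comm, map_smul, smul_eq_mul]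

theorem deg_br_sum' (q : X.OF → ℝ) (b : ι → ℝ) :
    X.deg (q * X.br b) = ∑ v, b v * X.deg (q * X.xv v) := by
  have := deg_br_sum q 1 b; simpa using this

theorem sum_link {P : ι → Prop} (F : ι → ℝ) (h : ∀ v, ¬ P v → F v = 0) :
    ∑ v : {v // P v}, F v = ∑ v, F v := by
  rw [← Finset.sum_subtype (univ.filter P) (by simp) F]
  apply sum_subset (subset_univ _)
  intro v _ hv; exact h v (by simpa using hv)

/-- vertices of the link -/
def LinkV (X : CSP d ι) (τ : Finset ι) (v : ι) : Prop := v ∉ τ ∧ X.Face (insert v τ)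

theorem HR_step {τ : Finset ι} (hτ : X.Face τ) (hc : τ.card + 3 ≤ d)
    (H : ∀ v, v ∉ τ → X.Face (insert v τ) → X.HR (insert v τ)) : X.HR τ := by
  apply HR_of_zero hτ (by omega)
  intro b hb hb1
  obtain ⟨l, hl, hl2⟩ := hτ.exact
  let hh : ι → ℝ := 1 - X.lin l
  have hh0 : ∀ v ∈ τ, hh v = 0 := fun v hv => by simp [hh, lin_apply, (hl2 v).2 hv]
  have hh1 : ∀ v, v ∉ τ → 0 < hh v := fun v hv => by
    have h2 := hl v
    have h3 : l (X.p v) ≠ 1 := fun h => hv ((hl2 v).1 h)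
    simp only [hh, Pi.sub_apply, Pi.one_apply, lin_apply, sub_pos]
    exact lt_of_le_of_ne h2 h3
  obtain ⟨P, hPdef⟩ : ∃ P : ι → Prop, P = X.LinkV τ := ⟨_, rfl⟩
  have hP : ∀ v, P v ↔ v ∉ τ ∧ X.Face (insert v τ) := fun v => by rw [hPdef]; rfl
  have hz : ∀ v, ¬ P v → v ∉ τ → X.xm τ * X.xv v = 0 := by
    intro v hv hvτ
    apply xm_mul_xv_eq_zero
    intro h; exact hv ((hP v).2 ⟨hvτ, h⟩)
  let M : ι → ι → ℝ := fun v w => X.deg (X.xm τ * (X.xv v * X.xv w))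
  have hM0 : ∀ v w, ¬ P w → w ∉ τ → M v w = 0 := by
    intro v w hw hwτ
    simp only [M]
    rw [mul_left_comm, hz w hw hwτ, mul_zero, map_zero]
  have hrow : ∀ c : ι → ℝ, (∀ v ∈ τ, c v = 0) → ∀ v,
      ∑ w : {v // P v}, M v w * c w = X.deg (X.xm τ * (X.xv v * X.br c)) := by
    intro c hc0 v
    rw [sum_link (P := P) (fun w => M v w * c w)]
    · rw [← mul_assoc, deg_br_sum']
      apply sum_congr rfl; intro w _
      simp only [M]; rw [mul_assoc, mul_comm]
    · intro w hw
      by_cases hwτ : w ∈ τ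
      · rw [hc0 w hwτ, mul_zero]
      · rw [hM0 v w hw hwτ, zero_mul]
  have hquad : ∀ c : ι → ℝ, (∀ v ∈ τ, c v = 0) → ∑ v : {v // P v}, ∑ w : {v // P v},
      M v w * (c v * c w) = X.deg (X.xm τ * (X.br c * X.br c)) := by
    intro c hc0
    have : ∀ v : {v // P v}, ∑ w : {v // P v}, M v w * (c v * c w) =
        c v * X.deg (X.xm τ * (X.xv v * X.br c)) := by
      intro v
      rw [← hrow c hc0, mul_sum]
      apply sum_congr rfl; intro w _; ring
    simp only [this]
    rw [sum_link (P := P) (fun v => c v * X.deg (X.xm τ * (X.xv v * X.br c))), deg_br_sum]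
    intro v hv
    by_cases hvτ : v ∈ τ
    · rw [hc0 v hvτ, zero_mul]
    · rw [← mul_assoc, hz v hv hvτ]; simp
  have hw : ∀ v, v ∉ τ → X.deg (X.xm τ * (X.xv v * X.br hh)) = X.deg (X.xm (insert v τ)) := by
    intro v hv
    have := deg_xm_lin (τ := τ) (X := X) (xv_mem v) (by omega) l
    simp only [hh, map_sub, br_one, mul_sub, mul_one]
    rw [mul_comm (X.xv v), this, sub_zero, xm_insert hv, mul_comm]
  have hhq : ∀ q ∈ X.PP 2, X.deg (X.xm τ * (X.br hh * q)) = X.deg (X.xm τ * q) := by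
    intro q hq
    have := deg_xm_lin (τ := τ) hq (by omega) l
    simp only [hh, map_sub, br_one, sub_mul, mul_sub, one_mul, this, sub_zero]
  have hHR : ∀ v, P v → ∀ c : ι → ℝ, X.deg (X.xm τ * (X.xv v * (X.br c * X.br c))) ≤
      (X.deg (X.xm τ * (X.xv v * X.br c))) ^ 2 / X.deg (X.xm (insert v τ)) := by
    intro v hv' c
    have hv := (hP v).1 hv'
    have hpos := deg_pos hv.2
    have e0 : ∀ q, X.deg (X.xm (insert v τ) * q) = X.deg (X.xm τ * (X.xv v * q)) := by
      intro q; rw [xm_insert hv.1]; congr 1; ring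
    set t := X.deg (X.xm τ * (X.xv v * X.br c)) / X.deg (X.xm (insert v τ)) with ht
    have e1 : X.deg (X.xm (insert v τ) * X.br (c - t • 1)) = 0 := by
      rw [map_sub, map_smul, br_one, mul_sub, map_sub, e0, mul_smul_comm, mul_one, map_smul,
        smul_eq_mul, ht]
      field_simp; ring
    have e2 := (H v hv.1 hv.2 _ e1).1
    have e3 : X.xm (insert v τ) * (X.br (c - t • 1) * X.br (c - t • 1)) =
        X.xm (insert v τ) * (X.br c * X.br c) - (2 * t) • (X.xm (insert v τ) * X.br c) +
        (t ^ 2) • X.xm (insert v τ) := by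
      rw [map_sub, map_smul, br_one]
      ext f
      simp only [Pi.mul_apply, Pi.sub_apply, Pi.add_apply, Pi.smul_apply, smul_eq_mul, Pi.one_apply]
      ring
    rw [e3, map_add, map_sub, map_smul, map_smul, e0, e0, smul_eq_mul, smul_eq_mul] at e2
    have e4 : X.deg (X.xm τ * (X.xv v * X.br c)) = t * X.deg (X.xm (insert v τ)) := by
      rw [ht]; field_simp
    rw [e4] at e2 ⊢
    have : (t * X.deg (X.xm (insert v τ))) ^ 2 / X.deg (X.xm (insert v τ)) =
      t ^ 2 * X.deg (X.xm (insert v τ)) := by field_simp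
    rw [this]; linarith
  have hML := matrix_lemma (Λ := {v // P v}) (fun v w => M v w)
    (fun v w => by simp only [M]; rw [mul_comm (X.xv v)]) (fun v => hh v) (fun v => hh1 v ((hP v).1 v.2).1)
    (fun v => by rw [hrow hh hh0, hw v ((hP v).1 v.2).1]; exact deg_pos ((hP v).1 v.2).2)
    (fun v w hvw => by
      by_cases hF : X.Face (insert (v:ι) (insert (w:ι) τ))
      · have hvn : (v:ι) ∉ insert (w:ι) τ := by
          simp only [mem_insert, not_or]; exact ⟨fun h => hvw (Subtype.ext h), ((hP v).1 v.2).1⟩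
        have := (deg_pos hF).le
        rw [xm_insert hvn, xm_insert ((hP w).1 w.2).1] at this
        have e : X.xm τ * (X.xv v * X.xv w) = X.xv v * (X.xv w * X.xm τ) := by ring
        simp only [M]; rwa [e]
      · simp only [M]; rw [← mul_assoc, xm_mul_xv_xv_eq_zero hF, map_zero])
    (fun c hcc => by
      let c' : ι → ℝ := fun v => if h : P v then c ⟨v, h⟩ / hh v else 0
      obtain ⟨t, ht⟩ := link_const hτ (by omega) c' (by
        intro v w hv hw hvw hF
        have hPv : P v := (hP v).2 ⟨hv, hF.mono (insert_subset_insert _ (subset_insert _ _))⟩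
        have hPw : P w := (hP w).2 ⟨hw, hF.mono (subset_insert _ _)⟩
        simp only [c', dif_pos hPv, dif_pos hPw]
        apply hcc ⟨v, hPv⟩ ⟨w, hPw⟩ (fun h => hvw (congrArg Subtype.val h))
        have hvn : v ∉ insert w τ := by
          simp only [mem_insert, not_or]; exact ⟨hvw, hv⟩
        have := deg_pos hF
        rw [xm_insert hvn, xm_insert hw] at this
        have e : X.xm τ * (X.xv v * X.xv w) = X.xv v * (X.xv w * X.xm τ) := by ring
        simp only [M]; rwa [e])
      refine ⟨t, fun v => ?_⟩
      have := ht v ((hP v).1 v.2).1 ((hP v).1 v.2).2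
      simp only [c', dif_pos v.2] at this
      have h3 := (hh1 v ((hP v).1 v.2).1).ne'
      rw [← this]; field_simp)
    (fun c => by
      let c' : ι → ℝ := fun v => if h : P v then c ⟨v, h⟩ else 0
      have hc' : ∀ v : {v // P v}, c v = c' v := fun v => by simp only [c', dif_pos v.2]
      have hc0 : ∀ v ∈ τ, c' v = 0 := fun v hv => by
        simp only [c']; rw [dif_neg]; intro h; exact ((hP v).1 h).1 hv
      simp only [hc', hrow c' hc0, hrow hh hh0]
      rw [hquad c' hc0, ← hhq _ (PP.mul (br_mem c') (br_mem c')), deg_br_sum,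
        ← sum_link (P := P)]
      · apply sum_le_sum
        intro v _
        rw [hw v ((hP v).1 v.2).1, mul_div_assoc]
        exact mul_le_mul_of_nonneg_left (hHR v v.2 c') (hh1 v ((hP v).1 v.2).1).le
      · intro v hv
        by_cases hvτ : v ∈ τ
        · rw [hh0 v hvτ, zero_mul]
        · rw [← mul_assoc, hz v hv hvτ]; simp)
    (fun v => b v)
    (by
      simp only [hrow hh hh0]
      rw [sum_link (P := P) (fun v => X.deg (X.xm τ * (X.xv v * X.br hh)) * b v)]
      · have := hb1
        rw [deg_br_sum'] at this
        rw [← this]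
        apply sum_congr rfl; intro v _
        by_cases hvτ : v ∈ τ
        · rw [hb v hvτ]; ring
        · rw [hw v hvτ, xm_insert hvτ, mul_comm, mul_comm (X.xv v)]
      · intro v hv
        by_cases hvτ : v ∈ τ
        · rw [hb v hvτ, mul_zero]
        · rw [← mul_assoc, hz v hv hvτ]; simp)
  rw [hquad b hb] at hML
  refine ⟨hML.1, fun h0 => ?_⟩
  have hMc := hML.2 h0
  simp only [hrow b hb] at hMc
  have e0 : ∀ v, v ∉ τ → ∀ q, X.deg (X.xm (insert v τ) * q) = X.deg (X.xm τ * (X.xv v * q)) := by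
    intro v hv q; rw [xm_insert hv]; congr 1; ring
  have hle : ∀ v, P v → X.deg (X.xm τ * (X.xv v * (X.br b * X.br b))) ≤ 0 := by
    intro v hv
    have := hHR v hv b
    rw [hMc ⟨v, hv⟩] at this
    simpa using this
  have hsum := hhq _ (PP.mul (br_mem b) (br_mem b))
  rw [h0, deg_br_sum, sum_eq_zero_iff_of_nonpos] at hsum
  · apply lin_glue hτ (by omega)
    intro v hv hF
    apply (H v hv hF b _).2
    · rw [e0 v hv]
      have := hsum v (mem_univ v)
      exact (mul_eq_zero.1 this).resolve_left (hh1 v hv).ne'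
    · rw [e0 v hv]; exact hMc ⟨v, (hP v).2 ⟨hv, hF⟩⟩
  · intro v _
    by_cases hv : P v
    · exact mul_nonpos_of_nonneg_of_nonpos (hh1 v ((hP v).1 hv).1).le (hle v hv)
    · by_cases hvτ : v ∈ τ
      · rw [hh0 v hvτ, zero_mul]
      · rw [← mul_assoc, hz v hv hvτ]; simp

end hr

end CSP

namespace CSP

section hrbase

variable {d : ℕ} {ι : Type} [Fintype ι] {X : CSP d ι}

theorem base_func {τ : Finset ι} (hτ : X.Face τ) (hc : τ.card + 2 = d) :
    ∃ l l' : (Fin d → ℝ) →ₗ[ℝ] ℝ, (∀ i ∈ τ, l (X.p i) = 0) ∧ (∀ i ∈ τ, l' (X.p i) = 0) ∧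
      (∀ v, X.LinkV τ v → l (X.p v) ≠ 0) ∧
      ∀ n : (Fin d → ℝ) →ₗ[ℝ] ℝ, (∀ i ∈ τ, n (X.p i) = 0) → ∀ x, l x = 0 → l' x = 0 → n x = 0 := by
  obtain ⟨f, hf⟩ := hτ.exists_OF
  have hN : (univ.filter (fun i => f i ∉ τ)).card = 2 := by
    have h1 : (univ.filter (fun i => f i ∈ τ)).card = τ.card := by
      rw [← card_image_of_injective _ f.inj]
      congr 1; ext v; simp only [mem_image, mem_filter, mem_univ, true_and]
      constructor
      · rintro ⟨i, hi, rfl⟩; exact hi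
      · intro hv; obtain ⟨i, -, rfl⟩ := mem_image.1 (hf hv); exact ⟨i, hv, rfl⟩
    have h2 := card_filter_add_card_filter_not (s := (univ : Finset (Fin d))) (fun i => f i ∈ τ)
    simp at h2; omega
  obtain ⟨j, k, hjk, hN⟩ := card_eq_two.1 hN
  have hmem : ∀ i, f i ∉ τ ↔ i = j ∨ i = k := by
    intro i
    have : i ∈ (univ.filter (fun i => f i ∉ τ)) ↔ i ∈ ({j, k} : Finset (Fin d)) := by rw [hN]
    simpa using this
  have hn : ∀ n : (Fin d → ℝ) →ₗ[ℝ] ℝ, (∀ i ∈ τ, n (X.p i) = 0) → ∀ x,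
      n x = f.co j x * n (X.p (f j)) + f.co k x * n (X.p (f k)) := by
    intro n h0 x
    rw [f.lin_eq n x, ← sum_subset (subset_univ {j, k}), sum_pair hjk]
    intro i _ hi
    rw [h0, mul_zero]
    by_contra h; exact hi (by simpa using (hmem i).1 h)
  have hco : ∀ i, i = j ∨ i = k → ∀ v ∈ τ, f.co i (X.p v) = 0 := by
    intro i hi v hv
    obtain ⟨m, -, rfl⟩ := mem_image.1 (hf hv)
    rw [f.co_self, if_neg]; rintro rfl; exact (hmem m).2 hi hv
  obtain ⟨⟨a, b⟩, hab⟩ := Module.Dual.exists_forall_ne_zero_of_forall_exists (K := ℝ)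
    (M := ℝ × ℝ) (ι := {v // X.LinkV τ v})
    (fun v => f.co j (X.p v) • LinearMap.fst ℝ ℝ ℝ + f.co k (X.p v) • LinearMap.snd ℝ ℝ ℝ) (by
      rintro ⟨v, hv, hF⟩
      by_contra! h
      have h1 := h (1, 0)
      have h2 := h (0, 1)
      simp at h1 h2
      obtain ⟨n, hn0⟩ := hF.exists_lin (fun i => if i = v then 1 else 0)
      have h3 := hn n (fun i hi => by
        rw [hn0 i (mem_insert_of_mem hi), if_neg]; rintro rfl; exact hv hi) (X.p v)
      rw [hn0 v (mem_insert_self _ _), h1, h2] at h3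
      simp at h3)
  have hj : X.LinkV τ (f j) := ⟨(hmem j).2 (Or.inl rfl), f.face_insert hf j⟩
  have ha := hab ⟨_, hj⟩
  simp [f.co_self, hjk] at ha
  refine ⟨a • f.co j + b • f.co k, -b • f.co j + a • f.co k, ?_, ?_, ?_, ?_⟩
  · intro i hi; simp [hco j (Or.inl rfl) i hi, hco k (Or.inr rfl) i hi]
  · intro i hi; simp [hco j (Or.inl rfl) i hi, hco k (Or.inr rfl) i hi]
  · intro v hv
    have := hab ⟨v, hv⟩
    simp at this ⊢
    intro h; apply this; linarith
  · intro n h0 x h1 h2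
    simp at h1 h2
    have hpos : 0 < a ^ 2 + b ^ 2 := by positivity
    have e1 : (a ^ 2 + b ^ 2) * f.co j x = 0 := by linear_combination a * h1 - b * h2
    have e2 : (a ^ 2 + b ^ 2) * f.co k x = 0 := by linear_combination b * h1 + a * h2
    rw [hn n h0, (mul_eq_zero.1 e1).resolve_left hpos.ne', (mul_eq_zero.1 e2).resolve_left hpos.ne']
    ring

theorem base_unique {τ : Finset ι} {l l' : (Fin d → ℝ) →ₗ[ℝ] ℝ}
    (hker : ∀ n : (Fin d → ℝ) →ₗ[ℝ] ℝ, (∀ i ∈ τ, n (X.p i) = 0) → ∀ x, l x = 0 → l' x = 0 → n x = 0)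
    {v w v' w' : ι} (hF : X.Face (insert v (insert w τ))) (hF' : X.Face (insert v' (insert w' τ)))
    (hv : v ∉ τ) (hw : w ∉ τ)
    (h1 : 0 < l (X.p v)) (h2 : l (X.p w) < 0) (h1' : 0 < l (X.p v')) (h2' : l (X.p w') < 0)
    (hx : 0 < l' (- l (X.p w) • X.p v + l (X.p v) • X.p w))
    (hx' : 0 < l' (- l (X.p w') • X.p v' + l (X.p v') • X.p w')) : v = v' ∧ w = w' := by
  obtain ⟨m, hm, hm2⟩ := hF.exact
  obtain ⟨m', hm', hm2'⟩ := hF'.exact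
  set x := - l (X.p w) • X.p v + l (X.p v) • X.p w with hxd
  set x' := - l (X.p w') • X.p v' + l (X.p v') • X.p w' with hxd'
  have hlx : l x = 0 := by simp [hxd]; ring
  have hlx' : l x' = 0 := by simp [hxd']; ring
  have key := hker (m - m') (fun i hi => by
    rw [LinearMap.sub_apply, (hm2 i).2 (by simp [hi]), (hm2' i).2 (by simp [hi]), sub_self])
    (l' x' • x - l' x • x') (by simp [hlx, hlx']) (by simp; ring)
  rw [map_sub, map_smul, map_smul, smul_eq_mul, smul_eq_mul] at key
  have a1 : (m - m') x = - l (X.p w) * (1 - m' (X.p v)) + l (X.p v) * (1 - m' (X.p w)) := by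
    have e1 := (hm2 v).2 (by simp)
    have e2 := (hm2 w).2 (by simp)
    simp only [hxd, map_add, map_smul, LinearMap.sub_apply, e1, e2, smul_eq_mul]
  have a2 : (m - m') x' = - l (X.p w') * (m (X.p v') - 1) + l (X.p v') * (m (X.p w') - 1) := by
    have e1 := (hm2' v').2 (by simp)
    have e2 := (hm2' w').2 (by simp)
    simp only [hxd', map_add, map_smul, LinearMap.sub_apply, e1, e2, smul_eq_mul]
  have b1 := hm' v
  have b2 := hm' w
  have b3 := hm v'
  have b4 := hm w'
  have c1 : 0 ≤ - l (X.p w) * (1 - m' (X.p v)) := mul_nonneg (by linarith) (by linarith)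
  have c2 : 0 ≤ l (X.p v) * (1 - m' (X.p w)) := mul_nonneg (by linarith) (by linarith)
  have c3 : (m - m') x' ≤ 0 := by rw [a2]; nlinarith
  have c4 : (m - m') x ≤ 0 := by
    by_contra! h
    have := mul_pos hx' h
    nlinarith
  have d1 : m' (X.p v) = 1 := by nlinarith
  have d2 : m' (X.p w) = 1 := by nlinarith
  have f1 := (hm2' v).1 d1
  have f2 := (hm2' w).1 d2
  simp only [mem_insert, hv, hw, or_false] at f1 f2
  have g1 : v ≠ w' := by rintro rfl; linarith
  have g2 : w ≠ v' := by rintro rfl; linarith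
  tauto

/-- The quadratic form is nonpositive when nothing bad happens. -/
theorem base_nonpos {τ : Finset ι} (hc : τ.card + 2 = d) {l : (Fin d → ℝ) →ₗ[ℝ] ℝ}
    (hl0 : ∀ i ∈ τ, l (X.p i) = 0) (hl : ∀ v, X.LinkV τ v → l (X.p v) ≠ 0)
    {c : ι → ℝ} (hc0 : ∀ i ∈ τ, c i = 0)
    (hbad : ∀ v w, v ∉ τ → w ∉ τ → X.Face (insert v (insert w τ)) → 0 < l (X.p v) →
      l (X.p w) < 0 → c v / l (X.p v) = c w / l (X.p w)) :
    X.deg (X.xm τ * (X.br c * X.br c)) ≤ 0 := by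
  obtain ⟨M, hMd⟩ : ∃ M : ι → ι → ℝ, M = fun v w => X.deg (X.xm τ * (X.xv v * X.xv w)) := ⟨_, rfl⟩
  have hsym : ∀ v w, M v w = M w v := fun v w => by simp only [hMd]; rw [mul_comm (X.xv v)]
  have hM0 : ∀ v w, ¬ X.LinkV τ v → v ∉ τ → M v w = 0 := by
    intro v w hv hvτ
    simp only [hMd]
    rw [← mul_assoc, xm_mul_xv_eq_zero, zero_mul, map_zero]
    intro h; exact hv ⟨hvτ, h⟩
  have hrow : ∀ v, ∑ w, M v w * l (X.p w) = 0 := by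
    intro v
    have := deg_xm_lin (τ := τ) (X := X) (xv_mem v) (by omega) l
    rw [deg_br_sum] at this
    rw [← this]
    apply sum_congr rfl; intro w _
    rw [hsym, lin_apply, mul_comm]; simp only [hMd]
  have hQ : X.deg (X.xm τ * (X.br c * X.br c)) = ∑ v, ∑ w, M v w * (c v * c w) := by
    rw [deg_br_sum]
    apply sum_congr rfl; intro v _
    rw [← mul_assoc, deg_br_sum', mul_sum]
    apply sum_congr rfl; intro w _
    simp only [hMd]; rw [mul_assoc]; ring
  obtain ⟨e, he⟩ : ∃ e : ι → ℝ, e = fun v => c v / l (X.p v) := ⟨_, rfl⟩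
  have hterm : ∀ v w, M v w * (c v * c w) =
      M v w * (l (X.p v) * l (X.p w) * (e v * e w)) := by
    intro v w
    by_cases hvτ : v ∈ τ
    · rw [hl0 v hvτ, hc0 v hvτ]; ring
    by_cases hwτ : w ∈ τ
    · rw [hl0 w hwτ, hc0 w hwτ]; ring
    by_cases hv : X.LinkV τ v
    · by_cases hw : X.LinkV τ w
      · have := hl v hv; have := hl w hw
        simp only [he]; field_simp
      · rw [hsym, hM0 w v hw hwτ]; ring
    · rw [hM0 v w hv hvτ]; ring
  have hid : ∑ v, ∑ w, M v w * (l (X.p v) * l (X.p w)) * (e v - e w) ^ 2 =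
      -2 * X.deg (X.xm τ * (X.br c * X.br c)) := by
    rw [hQ]
    simp only [hterm]
    have s1 : ∑ v, ∑ w, M v w * (l (X.p v) * l (X.p w)) * (e v) ^ 2 = 0 := by
      apply sum_eq_zero; intro v _
      have := hrow v
      calc _ = (l (X.p v) * e v ^ 2) * ∑ w, M v w * l (X.p w) := by
            rw [mul_sum]; apply sum_congr rfl; intro w _; ring
        _ = 0 := by rw [this, mul_zero]
    have s2 : ∑ v, ∑ w, M v w * (l (X.p v) * l (X.p w)) * (e w) ^ 2 = 0 := by
      rw [sum_comm, ← s1]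
      apply sum_congr rfl; intro v _; apply sum_congr rfl; intro w _
      rw [hsym]; ring
    rw [mul_sum]
    have : ∀ v, ∑ w, M v w * (l (X.p v) * l (X.p w)) * (e v - e w) ^ 2 =
      ∑ w, M v w * (l (X.p v) * l (X.p w)) * (e v) ^ 2 + ∑ w, M v w * (l (X.p v) * l (X.p w)) * (e w) ^ 2
      + -2 * ∑ w, M v w * (l (X.p v) * l (X.p w) * (e v * e w)) := by
      intro v
      rw [mul_sum, ← sum_add_distrib, ← sum_add_distrib]
      apply sum_congr rfl; intro w _; ring
    simp only [this, sum_add_distrib, s1, s2, zero_add]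
  have hnn : 0 ≤ ∑ v, ∑ w, M v w * (l (X.p v) * l (X.p w)) * (e v - e w) ^ 2 := by
    apply sum_nonneg; intro v _; apply sum_nonneg; intro w _
    by_cases hvτ : v ∈ τ
    · rw [hl0 v hvτ]; simp
    by_cases hwτ : w ∈ τ
    · rw [hl0 w hwτ]; simp
    by_cases hvw : v = w
    · subst hvw; simp
    by_cases hF : X.Face (insert v (insert w τ))
    · have hM : 0 ≤ M v w := by
        have hvn : v ∉ insert w τ := by simp [hvw, hvτ]
        have := deg_pos hF
        rw [xm_insert hvn, xm_insert hwτ] at this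
        have e : X.xm τ * (X.xv v * X.xv w) = X.xv v * (X.xv w * X.xm τ) := by ring
        simp only [hMd]; rw [e]; exact this.le
      have hLv : X.LinkV τ v := ⟨hvτ, hF.mono (insert_subset_insert _ (subset_insert _ _))⟩
      have hLw : X.LinkV τ w := ⟨hwτ, hF.mono (subset_insert _ _)⟩
      rcases (hl v hLv).lt_or_gt with h1 | h1 <;> rcases (hl w hLw).lt_or_gt with h2 | h2
      · exact mul_nonneg (mul_nonneg hM (mul_pos_of_neg_of_neg h1 h2).le) (sq_nonneg _)
      · have := hbad w v hwτ hvτ (by rwa [Finset.insert_comm]) h2 h1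
        simp only [he, this]; simp
      · have := hbad v w hvτ hwτ hF h1 h2
        simp only [he, this]; simp
      · exact mul_nonneg (mul_nonneg hM (mul_pos h1 h2).le) (sq_nonneg _)
    · have : M v w = 0 := by simp only [hMd]; rw [← mul_assoc, xm_mul_xv_xv_eq_zero hF, map_zero]
      rw [this]; simp
  linarith

theorem exists_ker3 (F G : ℝ × ℝ × ℝ →ₗ[ℝ] ℝ) : ∃ x, x ≠ 0 ∧ F x = 0 ∧ G x = 0 := by
  have := LinearMap.ker_ne_bot_of_finrank_lt (f := F.prod G) (by simp)
  obtain ⟨x, hx, h⟩ := Submodule.exists_mem_ne_zero_of_ne_bot this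
  simp at hx
  exact ⟨x, h, hx.1, hx.2⟩

theorem HR_base_le0 {τ : Finset ι} (hτ : X.Face τ) (hc : τ.card + 2 = d) (b : ι → ℝ)
    (hb : ∀ i ∈ τ, b i = 0) (hb1 : X.deg (X.xm τ * X.br b) = 0) :
    X.deg (X.xm τ * (X.br b * X.br b)) ≤ 0 := by
  obtain ⟨l, l', hl0, hl0', hl, hker⟩ := base_func hτ hc
  obtain ⟨m, hm, hm2⟩ := hτ.exact
  obtain ⟨hh, hhd⟩ : ∃ h : ι → ℝ, h = 1 - X.lin m := ⟨_, rfl⟩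
  have hh0 : ∀ v ∈ τ, hh v = 0 := fun v hv => by simp [hhd, lin_apply, (hm2 v).2 hv]
  let x : ι → ι → (Fin d → ℝ) := fun v w => - l (X.p w) • X.p v + l (X.p v) • X.p w
  let Bad : ι → ι → Prop := fun v w => v ∉ τ ∧ w ∉ τ ∧ X.Face (insert v (insert w τ)) ∧
    0 < l (X.p v) ∧ l (X.p w) < 0
  have hx0 : ∀ v w, Bad v w → l' (x v w) ≠ 0 := by
    rintro v w ⟨hv, hw, hF, h1, h2⟩ h
    obtain ⟨n, hn⟩ := hF.exists_lin (fun i => if i = v then 1 else 0)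
    have hvw : w ≠ v := by rintro rfl; linarith
    have := hker n (fun i hi => by
      rw [hn i (by simp [hi]), if_neg]; rintro rfl; exact hv hi) (x v w)
      (by simp [x]; ring) h
    simp only [x, map_add, map_smul, hn v (by simp), hn w (by simp), if_neg hvw] at this
    simp at this; linarith
  have hex : ∀ l'' : (Fin d → ℝ) →ₗ[ℝ] ℝ, (l'' = l' ∨ l'' = - l') →
      ∃ F : (ι → ℝ) →ₗ[ℝ] ℝ, ∀ v w, Bad v w → 0 < l'' (x v w) →
        ∀ c, F c = c v / l (X.p v) - c w / l (X.p w) := by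
    intro l'' hl''
    by_cases h : ∃ v w, Bad v w ∧ 0 < l'' (x v w)
    · obtain ⟨v, w, hB, h0⟩ := h
      refine ⟨(l (X.p v))⁻¹ • LinearMap.proj v - (l (X.p w))⁻¹ • LinearMap.proj w, ?_⟩
      intro v' w' hB' h0' c
      have := base_unique (l := l) (l' := l'') (by
        intro n hn y h1 h2
        apply hker n hn y h1
        rcases hl'' with rfl | rfl
        · exact h2
        · simpa using h2) hB.2.2.1 hB'.2.2.1 hB.1 hB.2.1 hB.2.2.2.1 hB.2.2.2.2
          hB'.2.2.2.1 hB'.2.2.2.2 h0 h0'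
      obtain ⟨rfl, rfl⟩ := this
      simp; ring
    · push Not at h
      exact ⟨0, fun v w hB h0 => absurd h0 (not_lt.2 (h v w hB))⟩
  obtain ⟨F, hF⟩ := hex l' (Or.inl rfl)
  obtain ⟨G, hG⟩ := hex (-l') (Or.inr rfl)
  by_cases hBad : ∃ v w, Bad v w
  swap
  · push Not at hBad
    apply base_nonpos hc hl0 hl hb
    intro v w hv hw hF h1 h2
    exact absurd ⟨hv, hw, hF, h1, h2⟩ (hBad v w)
  let C : ℝ × ℝ × ℝ →ₗ[ℝ] (ι → ℝ) := (LinearMap.toSpanSingleton ℝ _ hh).coprod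
    ((LinearMap.toSpanSingleton ℝ _ b).coprod (LinearMap.toSpanSingleton ℝ _ (X.lin l')))
  obtain ⟨⟨α, β, γ⟩, hne, h1, h2⟩ := exists_ker3 (F ∘ₗ C) (G ∘ₗ C)
  have hC : C (α, β, γ) = α • hh + (β • b + γ • X.lin l') := by simp [C]
  rw [LinearMap.comp_apply, hC] at h1 h2
  obtain ⟨c, hcd⟩ : ∃ c, c = α • hh + (β • b + γ • X.lin l') := ⟨_, rfl⟩
  rw [← hcd] at h1 h2
  have hbadc : ∀ v w, Bad v w → c v / l (X.p v) = c w / l (X.p w) := by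
    intro v w hB
    rcases (hx0 v w hB).lt_or_gt with h | h
    · have := hG v w hB (by simpa using h) c
      rw [h2] at this; linarith
    · have := hF v w hB h c
      rw [h1] at this; linarith
  have hneg : X.deg (X.xm τ * (X.br c * X.br c)) ≤ 0 := by
    apply base_nonpos hc hl0 hl
    · intro i hi; simp [hcd, hh0 i hi, hb i hi, hl0' i hi, lin_apply]
    · intro v w hv hw hF h1 h2; exact hbadc v w ⟨hv, hw, hF, h1, h2⟩
  have hcexp : X.deg (X.xm τ * (X.br c * X.br c)) = α ^ 2 * X.deg (X.xm τ) +
      β ^ 2 * X.deg (X.xm τ * (X.br b * X.br b)) := by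
    have hL : ∀ l q, q ∈ X.PP 1 → X.deg (X.xm τ * (X.br (X.lin l) * q)) = 0 :=
      fun l q hq => deg_xm_lin (τ := τ) (X := X) hq (by omega) l
    have e1 := hL (γ • l' - α • m) (α • 1 + β • X.br b)
      (Submodule.add_mem _ (Submodule.smul_mem _ _ (PP.succ PP.one)) (Submodule.smul_mem _ _ (br_mem b)))
    have e2 := hL (γ • l' - α • m) _ (br_mem (X.lin (γ • l' - α • m)))
    have e3 : c = α • 1 + β • b + X.lin (γ • l' - α • m) := by
      rw [hcd, hhd, map_sub, map_smul, map_smul]; module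
    have e4 : X.br c = α • 1 + β • X.br b + X.br (X.lin (γ • l' - α • m)) := by
      rw [e3, map_add, map_add, map_smul, map_smul, br_one]
    set q := X.br (X.lin (γ • l' - α • m))
    have e5 : X.xm τ * (X.br c * X.br c) = (α ^ 2) • X.xm τ + (β ^ 2) • (X.xm τ * (X.br b * X.br b))
      + (2 * α * β) • (X.xm τ * X.br b) + (2:ℝ) • (X.xm τ * (q * (α • 1 + β • X.br b))) +
      X.xm τ * (q * q) := by
      rw [e4]; ext f
      simp only [Pi.mul_apply, Pi.add_apply, Pi.smul_apply, smul_eq_mul, Pi.one_apply]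
      ring
    rw [e5]; simp only [map_add, map_smul, e1, e2, hb1, smul_eq_mul]; ring
  by_contra! hpos
  have hp := deg_pos hτ
  rw [hcexp] at hneg
  have hα : α = 0 := by
    by_contra h
    have : 0 < α ^ 2 := by positivity
    nlinarith [sq_nonneg β, mul_pos this hp, mul_nonneg (sq_nonneg β) hpos.le]
  have hβ : β = 0 := by
    by_contra h
    have : 0 < β ^ 2 := by positivity
    nlinarith [mul_pos this hpos, mul_nonneg (sq_nonneg α) hp.le]
  subst hα; subst hβ
  have hγ : γ ≠ 0 := by rintro rfl; exact hne rfl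
  obtain ⟨v, w, hB⟩ := hBad
  have h3 := hbadc v w hB
  have h4 := hB.2.2.2.1
  have h5 := hB.2.2.2.2
  simp only [hcd, zero_smul, zero_add, Pi.smul_apply, lin_apply, smul_eq_mul] at h3
  rw [div_eq_div_iff h4.ne' h5.ne] at h3
  apply hx0 v w hB
  simp only [x, map_add, map_smul, smul_eq_mul]
  apply mul_left_cancel₀ hγ
  linarith

theorem HR_base_le {τ : Finset ι} (hτ : X.Face τ) (hc : τ.card + 2 = d) (b : ι → ℝ)
    (hb1 : X.deg (X.xm τ * X.br b) = 0) :
    X.deg (X.xm τ * (X.br b * X.br b)) ≤ 0 := by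
  obtain ⟨l, hl⟩ := hτ.exists_lin b
  have e1 : X.deg (X.xm τ * X.br (b - X.lin l)) = 0 := by
    have := deg_xm_lin (τ := τ) (X := X) PP.one (by omega) l
    rw [mul_one] at this
    rw [map_sub, mul_sub, map_sub, hb1, this, sub_zero]
  have e2 : X.deg (X.xm τ * (X.br (b - X.lin l) * X.br (b - X.lin l))) =
      X.deg (X.xm τ * (X.br b * X.br b)) := by
    have h1 := deg_xm_lin (τ := τ) (X := X) (br_mem b) (by omega) l
    have h2 := deg_xm_lin (τ := τ) (X := X) (br_mem (X.lin l)) (by omega) l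
    have : X.xm τ * (X.br (b - X.lin l) * X.br (b - X.lin l)) = X.xm τ * (X.br b * X.br b)
      - (2:ℝ) • (X.xm τ * (X.br (X.lin l) * X.br b)) + X.xm τ * (X.br (X.lin l) * X.br (X.lin l)) := by
      rw [map_sub, two_smul]; ring
    rw [this, map_add, map_sub, map_smul, h1, h2]; simp
  rw [← e2]
  exact HR_base_le0 hτ hc _ (fun i hi => by simp [lin_apply, hl i hi]) e1

theorem ridge_lin {τ : Finset ι} (hτ : X.Face τ) (hc : τ.card + 1 = d) (b : ι → ℝ)
    (hb : X.deg (X.xm τ * X.br b) = 0) : ∃ l : (Fin d → ℝ) →ₗ[ℝ] ℝ,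
      ∀ i, X.Face (insert i τ) → b i = l (X.p i) := by
  obtain ⟨f, hf⟩ := hτ.exists_OF
  obtain ⟨l, hl⟩ := exists_dual_of_indep f.indep (fun j => b (f j))
  obtain ⟨j, hj⟩ : ∃ j, f j ∉ τ := by
    by_contra! h
    have : univ.image f ⊆ τ := by
      intro v hv; obtain ⟨i, -, rfl⟩ := mem_image.1 hv; exact h i
    have := card_le_card this
    rw [card_image_of_injective _ f.inj] at this
    simp at this; omega
  have hτe : τ = (univ.erase j).image f := by
    symm
    apply (eq_of_subset_of_card_le ?_ ?_).symm
    · intro v hv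
      obtain ⟨i, -, rfl⟩ := mem_image.1 (hf hv)
      exact mem_image.2 ⟨i, mem_erase.2 ⟨by rintro rfl; exact hj hv, mem_univ _⟩, rfl⟩
    · rw [card_image_of_injective _ f.inj, card_erase_of_mem (mem_univ _)]; simp; omega
  have hupd : ∀ q, q ∉ τ → X.Face (insert q τ) → X.IsOF (Function.update f.1 j q) := by
    intro q hq hF
    refine ⟨?_, ?_⟩
    · intro a c hac
      by_cases ha : a = j <;> by_cases hc' : c = j
      · rw [ha, hc']
      · exfalso; apply hq; rw [ha, Function.update_self, Function.update_of_ne hc'] at hac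
        rw [hac, hτe]; exact mem_image.2 ⟨c, by simp [hc'], rfl⟩
      · exfalso; apply hq; rw [hc', Function.update_self, Function.update_of_ne ha] at hac
        rw [← hac, hτe]; exact mem_image.2 ⟨a, by simp [ha], rfl⟩
      · rw [Function.update_of_ne ha, Function.update_of_ne hc'] at hac; exact f.inj hac
    · apply hF.mono
      intro v hv
      obtain ⟨i, -, rfl⟩ := mem_image.1 hv
      by_cases hi : i = j
      · subst hi; simp
      · rw [Function.update_of_ne hi]; apply mem_insert_of_mem; rw [hτe]
        exact mem_image.2 ⟨i, by simp [hi], rfl⟩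
  refine ⟨l, fun q hq => ?_⟩
  have hfl : ∀ i, b (f i) - l (X.p (f i)) = 0 := fun i => by rw [hl]; ring
  by_cases hqf : q ∈ univ.image f
  · obtain ⟨i, -, rfl⟩ := mem_image.1 hqf; linarith [hfl i]
  have hqτ : q ∉ τ := fun h => hqf (hf h)
  have e1 : X.deg (X.xm τ * X.br (b - X.lin l)) = 0 := by
    have := deg_xm_lin (τ := τ) (X := X) PP.one (by omega) l
    rw [mul_one] at this
    rw [map_sub, mul_sub, map_sub, hb, this, sub_zero]
  rw [deg_br_sum', sum_eq_single q] at e1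
  · have hp := deg_pos hq
    rw [xm_insert hqτ, mul_comm] at hp
    have := (mul_eq_zero.1 e1).resolve_right hp.ne'
    simp only [Pi.sub_apply, lin_apply] at this; linarith
  · intro r _ hr
    by_cases hrf : r ∈ univ.image f
    · obtain ⟨i, -, rfl⟩ := mem_image.1 hrf
      simp only [Pi.sub_apply, lin_apply, hfl i, zero_mul]
    · by_cases hF : X.Face (insert r τ)
      · exact absurd (f.adj_unique j r q (fun h => hrf (by simp [h]))
          (fun h => hqf (by simp [h])) (hupd r (fun h => hrf (hf h)) hF) (hupd q hqτ hq)) hr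
      · rw [xm_mul_xv_eq_zero hF]; simp
  · simp

theorem HR_base {τ : Finset ι} (hτ : X.Face τ) (hc : τ.card + 2 = d) : X.HR τ := by
  intro b hb
  refine ⟨HR_base_le hτ hc b hb, fun h0 => ?_⟩
  have hp := deg_pos hτ
  have key : ∀ c : ι → ℝ, X.deg (X.xm τ * X.br c) = 0 → X.deg (X.xm τ * (X.br b * X.br c)) = 0 := by
    intro c hc1
    have hq : ∀ s : ℝ, 2 * s * X.deg (X.xm τ * (X.br b * X.br c)) +
        s ^ 2 * X.deg (X.xm τ * (X.br c * X.br c)) ≤ 0 := by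
      intro s
      have := HR_base_le hτ hc (b + s • c) (by
        rw [map_add, map_smul, mul_add, map_add, mul_smul_comm, map_smul, hb, hc1]; simp)
      have e : X.xm τ * (X.br (b + s • c) * X.br (b + s • c)) = X.xm τ * (X.br b * X.br b) +
        (2 * s) • (X.xm τ * (X.br b * X.br c)) + (s ^ 2) • (X.xm τ * (X.br c * X.br c)) := by
        rw [map_add, map_smul]; ext f
        simp only [Pi.mul_apply, Pi.add_apply, Pi.smul_apply, smul_eq_mul]
        ring
      rw [e, map_add, map_add, map_smul, map_smul, h0, smul_eq_mul, smul_eq_mul, zero_add] at this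
      exact this
    set A := X.deg (X.xm τ * (X.br b * X.br c))
    set B := X.deg (X.xm τ * (X.br c * X.br c))
    by_contra hA
    have hB := hq 1
    have h3 := hq (A / (|B| + 1))
    have hpos : 0 < |B| + 1 := by positivity
    have : 2 * (A / (|B| + 1)) * A + (A / (|B| + 1)) ^ 2 * B = (A / (|B| + 1)) ^ 2 * (2 * (|B| + 1) + B) := by
      field_simp
    rw [this] at h3
    have h4 : 0 < (A / (|B| + 1)) ^ 2 := by positivity
    have h5 : 0 < 2 * (|B| + 1) + B := by linarith [neg_abs_le B, abs_nonneg B]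
    linarith [mul_pos h4 h5]
  apply lin_glue hτ (by omega)
  intro v hv hF
  apply ridge_lin hF (by rw [card_insert_of_notMem hv]; omega)
  have h1 := key (Pi.single v 1 - (X.deg (X.xm τ * X.xv v) / X.deg (X.xm τ)) • 1) (by
    rw [map_sub, map_smul, br_one, mul_sub, map_sub, mul_smul_comm, mul_one, map_smul, smul_eq_mul]
    rw [div_mul_cancel₀ _ hp.ne']; exact sub_self _)
  rw [map_sub, map_smul, br_one, mul_sub, mul_sub, map_sub, mul_smul_comm, mul_one, mul_smul_comm,
    map_smul, hb, smul_zero, sub_zero] at h1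
  rw [xm_insert hv, ← h1]
  congr 1
  rw [xv]; ring

theorem HR_all {τ : Finset ι} (hτ : X.Face τ) (hc : τ.card + 2 ≤ d) : X.HR τ := by
  induction hk : d - τ.card using Nat.strong_induction_on generalizing τ with
  | _ k ih =>
    rcases hc.eq_or_lt with h | h
    · exact HR_base hτ h
    · apply HR_step hτ (by omega)
      intro v hv hF
      have := card_insert_of_notMem hv
      exact ih (d - (insert v τ).card) (by omega) hF (by omega) rfl

end hrbase

end CSP

namespace CSP

section stress

set_option linter.unusedSectionVars false

variable {d : ℕ} {ι : Type} [Fintype ι] (X : CSP d ι)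

/-- symmetric functions supported on a relation -/
def Sy (R : ι → ι → Prop) : Submodule ℝ (ι → ι → ℝ) where
  carrier := {Ω | (∀ v w, Ω v w = Ω w v) ∧ ∀ v w, ¬ R v w → Ω v w = 0}
  add_mem' := by
    rintro a b ⟨h1, h2⟩ ⟨h3, h4⟩
    exact ⟨fun v w => by simp [h1 v w, h3 v w], fun v w h => by simp [h2 v w h, h4 v w h]⟩
  zero_mem' := by simp
  smul_mem' := by
    rintro c a ⟨h1, h2⟩
    exact ⟨fun v w => by simp [h1 v w], fun v w h => by simp [h2 v w h]⟩

theorem mem_Sy {R : ι → ι → Prop} {Ω : ι → ι → ℝ} :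
    Ω ∈ Sy R ↔ (∀ v w, Ω v w = Ω w v) ∧ ∀ v w, ¬ R v w → Ω v w = 0 := Iff.rfl

def row : (ι → ι → ℝ) →ₗ[ℝ] (ι → (Fin d → ℝ)) where
  toFun Ω v := ∑ w, Ω v w • X.p w
  map_add' a b := by ext v; simp [add_smul, sum_add_distrib]
  map_smul' c a := by ext v; simp [mul_sum, mul_assoc]

theorem row_apply (Ω : ι → ι → ℝ) (v : ι) : X.row Ω v = ∑ w, Ω v w • X.p w := rfl

theorem row_lin (Ω : ι → ι → ℝ) (v : ι) (l : (Fin d → ℝ) →ₗ[ℝ] ℝ) :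
    l (X.row Ω v) = ∑ w, Ω v w * l (X.p w) := by
  simp [row_apply]

theorem eq_zero_of_lin {x : Fin d → ℝ} (h : ∀ l : (Fin d → ℝ) →ₗ[ℝ] ℝ, l x = 0) : x = 0 := by
  ext i; exact h (LinearMap.proj i)

theorem eq_of_lin {x y : Fin d → ℝ} (h : ∀ l : (Fin d → ℝ) →ₗ[ℝ] ℝ, l x = l y) : x = y := by
  ext i; exact h (LinearMap.proj i)

/-- elementary symmetric function -/
def el (a b : ι) : ι → ι → ℝ := fun v w => (if v = a ∧ w = b then 1 else 0) + if v = b ∧ w = a then 1 else 0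

theorem el_mem {R : ι → ι → Prop} (hR : ∀ v w, R v w → R w v) {a b : ι} (h : R a b) : el a b ∈ Sy R := by
  refine ⟨fun v w => ?_, fun v w hvw => ?_⟩
  · simp only [el]; rw [add_comm]; congr 1 <;> congr 1 <;> simp only [and_comm]
  · simp only [el]
    rw [if_neg, if_neg, add_zero]
    · rintro ⟨rfl, rfl⟩; exact hvw (hR _ _ h)
    · rintro ⟨rfl, rfl⟩; exact hvw h

theorem exists_row {R : ι → ι → Prop} (hR : ∀ v w, R v w → R w v) (r : ι → (Fin d → ℝ))
    (h : ∀ κ : ι → ((Fin d → ℝ) →ₗ[ℝ] ℝ), (∀ v w, R v w → κ v (X.p w) + κ w (X.p v) = 0) →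
      ∑ v, κ v (r v) = 0) : ∃ Ω ∈ Sy R, X.row Ω = r := by
  by_contra hcon
  have hn : r ∉ (Sy R).map X.row := by
    rintro ⟨Ω, h1, h2⟩; exact hcon ⟨Ω, h1, h2⟩
  obtain ⟨F, hF1, hF2⟩ := Submodule.exists_le_ker_of_notMem hn
  have hF : ∀ x : ι → (Fin d → ℝ), F x = ∑ v, (F ∘ₗ LinearMap.single ℝ (fun _ => Fin d → ℝ) v) (x v) := by
    intro x
    conv_lhs => rw [← Finset.univ_sum_single x]
    rw [map_sum]; rfl
  apply hF1
  rw [hF]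
  apply h
  intro a b hab
  have h1 := hF2 ⟨el a b, el_mem hR hab, rfl⟩
  rw [LinearMap.mem_ker, hF] at h1
  simp only [row_lin] at h1
  simp only [el, add_mul, sum_add_distrib] at h1
  simp only [ite_and, ite_mul, one_mul, zero_mul] at h1
  simpa using h1

variable {X}

theorem exists_phi (X : CSP d ι) : ∃ φ : (Fin d → ℝ) →ₗ[ℝ] ℝ, (∀ v, φ (X.p v) ≠ 0) ∧
    ∀ v w, X.Face {v, w} → φ (X.p v + X.p w) ≠ 0 := by
  have hnz : ∀ x : Fin d → ℝ, x ≠ 0 → ∃ l : (Fin d → ℝ) →ₗ[ℝ] ℝ, l x ≠ 0 := by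
    intro x hx; by_contra! h; exact hx (eq_zero_of_lin h)
  obtain ⟨φ, hφ⟩ := Module.Dual.exists_forall_ne_zero_of_forall_exists (K := ℝ)
    (M := (Fin d → ℝ) →ₗ[ℝ] ℝ) (ι := ι ⊕ {e : ι × ι // X.Face {e.1, e.2}})
    (fun s => LinearMap.applyₗ (Sum.elim (fun v => X.p v) (fun e => X.p e.1.1 + X.p e.1.2) s)) (by
      rintro (v | ⟨⟨v, w⟩, h⟩)
      · exact hnz _ (X.p_ne v)
      · apply hnz
        intro h0
        simp only [Sum.elim_inr] at h0
        have : X.p w = X.p (X.neg v) := by rw [X.p_neg]; exact (neg_eq_of_add_eq_zero_right h0).symm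
        have := X.p_inj this
        subst this
        exact h.not_neg (i := v) (by simp) (by simp))
  exact ⟨φ, fun v => hφ (Sum.inl v), fun v w h => hφ (Sum.inr ⟨(v, w), h⟩)⟩

def phi (X : CSP d ι) : (Fin d → ℝ) →ₗ[ℝ] ℝ := X.exists_phi.choose

theorem phi_ne (v : ι) : X.phi (X.p v) ≠ 0 := X.exists_phi.choose_spec.1 v

theorem phi_ne2 {v w : ι} (h : X.Face {v, w}) : X.phi (X.p v + X.p w) ≠ 0 :=
  X.exists_phi.choose_spec.2 v w h

theorem phi_neg (v : ι) : X.phi (X.p (X.neg v)) = - X.phi (X.p v) := by rw [X.p_neg, map_neg]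

/-- positive half of the vertices -/
def Hp (X : CSP d ι) : Finset ι := univ.filter (fun v => 0 < X.phi (X.p v))

theorem mem_Hp {v : ι} : v ∈ X.Hp ↔ 0 < X.phi (X.p v) := by simp [Hp]

theorem neg_mem_Hp {v : ι} : X.neg v ∈ X.Hp ↔ v ∉ X.Hp := by
  rw [mem_Hp, mem_Hp, phi_neg]
  have := X.phi_ne v
  constructor
  · intro h; linarith
  · intro h; have := lt_of_le_of_ne (not_lt.1 h) this; linarith

theorem half_card {α : Type*} (T : Finset α) (s : α → α) (hs : ∀ a ∈ T, s a ∈ T)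
    (hss : ∀ a ∈ T, s (s a) = a) (μ : α → ℝ) (hμ : ∀ a ∈ T, μ (s a) = - μ a) (h0 : ∀ a ∈ T, μ a ≠ 0) :
    2 * (T.filter (fun a => 0 < μ a)).card = T.card := by
  have h1 := card_filter_add_card_filter_not (s := T) (fun a => 0 < μ a)
  have h2 : (T.filter (fun a => 0 < μ a)).card = (T.filter (fun a => ¬ 0 < μ a)).card := by
    apply card_bij' (fun a _ => s a) (fun a _ => s a)
    · intro a ha
      simp only [mem_filter] at ha ⊢
      refine ⟨hs a ha.1, ?_⟩
      rw [hμ a ha.1]; linarith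
    · intro a ha
      simp only [mem_filter] at ha ⊢
      refine ⟨hs a ha.1, ?_⟩
      rw [hμ a ha.1]
      have := lt_of_le_of_ne (not_lt.1 ha.2) (h0 a ha.1); linarith
    · intro a ha; exact hss a (mem_filter.1 ha).1
    · intro a ha; exact hss a (mem_filter.1 ha).1
  omega

theorem card_Hp : 2 * X.Hp.card = Fintype.card ι :=
  half_card univ X.neg (by simp) (by simp [X.neg_neg]) (fun v => X.phi (X.p v))
    (fun v _ => phi_neg v) (fun v _ => phi_ne v)

/-- edge relation including loops -/
def Fc (X : CSP d ι) (v w : ι) : Prop := X.Face {v, w}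

theorem Fc.symm {v w : ι} (h : X.Fc v w) : X.Fc w v := by unfold Fc at *; rwa [pair_comm]

theorem face_pair_neg {v w : ι} : X.Face {X.neg v, X.neg w} ↔ X.Face {v, w} := by
  rw [← face_neg_iff]; simp [image_insert, X.neg_neg]

theorem Fc_neg {v w : ι} : X.Fc (X.neg v) (X.neg w) ↔ X.Fc v w := face_pair_neg

/-- odd functions -/
def Od (X : CSP d ι) : Submodule ℝ (ι → ι → ℝ) where
  carrier := {Ω | ∀ v w, Ω (X.neg v) (X.neg w) = - Ω v w}
  add_mem' := by
    intro a b h1 h2 v w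
    have := h1 v w; have := h2 v w
    simp only [Pi.add_apply]; linarith
  zero_mem' := by simp
  smul_mem' := by
    intro c a h v w
    have := h v w
    simp [this]

theorem mem_Od {Ω : ι → ι → ℝ} : Ω ∈ X.Od ↔ ∀ v w, Ω (X.neg v) (X.neg w) = - Ω v w := Iff.rfl

/-- odd functions on vertices -/
def OdV (X : CSP d ι) : Submodule ℝ (ι → ℝ) where
  carrier := {b | ∀ v, b (X.neg v) = - b v}
  add_mem' := by
    intro a b h1 h2 v
    have := h1 v; have := h2 v
    simp only [Pi.add_apply]; linarith
  zero_mem' := by simp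
  smul_mem' := by
    intro c a h v
    have := h v
    simp [this]

theorem mem_OdV {b : ι → ℝ} : b ∈ X.OdV ↔ ∀ v, b (X.neg v) = - b v := Iff.rfl

theorem exists_row_even (r : ι → (Fin d → ℝ)) (hr : ∀ v, r (X.neg v) = r v) :
    ∃ Ω ∈ Sy X.Fc ⊓ X.Od, X.row Ω = r := by
  obtain ⟨Ω, hΩ, hrow⟩ := X.exists_row (R := X.Fc) (fun v w h => h.symm) r (by
    intro κ hκ
    obtain ⟨A, hA, hAκ⟩ := skew_lemma (τ := ∅) X.face_empty κ (fun v w h => hκ v w h)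
    have h1 : ∀ v, κ v = A (X.p v) := fun v => hAκ v (X.face_single v)
    have h2 := X.sum_neg (fun v => κ v (r v))
    have h3 : ∑ v, κ (X.neg v) (r (X.neg v)) = - ∑ v, κ v (r v) := by
      rw [← sum_neg_distrib]; apply sum_congr rfl; intro v _
      rw [hr, h1, X.p_neg, map_neg, LinearMap.neg_apply, ← h1]
    linarith)
  refine ⟨(1/2 : ℝ) • (Ω - fun v w => Ω (X.neg v) (X.neg w)), ⟨⟨?_, ?_⟩, ?_⟩, ?_⟩
  · intro v w; simp only [Pi.smul_apply, Pi.sub_apply]; rw [hΩ.1 v w, hΩ.1 (X.neg v)]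
  · intro v w h; simp only [Pi.smul_apply, Pi.sub_apply]
    rw [hΩ.2 v w h, hΩ.2 _ _ (fun h' => h (Fc_neg.1 h'))]; simp
  · intro v w; simp only [Pi.smul_apply, Pi.sub_apply, X.neg_neg, smul_eq_mul]; ring
  · rw [map_smul, map_sub, hrow]
    have : X.row (fun v w => Ω (X.neg v) (X.neg w)) = - r := by
      ext1 v
      rw [row_apply, Pi.neg_apply, ← hr v, ← hrow, row_apply, ← X.sum_neg (fun w => Ω (X.neg v) w • X.p w),
        ← sum_neg_distrib]
      apply sum_congr rfl; intro w _; rw [X.p_neg, smul_neg, _root_.neg_neg]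
    rw [this]; module

/-- odd stresses -/
def O2 (X : CSP d ι) : Submodule ℝ (ι → ι → ℝ) := (Sy X.Fc ⊓ X.Od) ⊓ LinearMap.ker X.row

/-- low-dimensional faces -/
def T2 (X : CSP d ι) : Finset (Finset ι) := univ.filter (fun s => X.Face s ∧ (s.card = 1 ∨ s.card = 2))

def T2p (X : CSP d ι) : Finset (Finset ι) := X.T2.filter (fun s => 0 < ∑ v ∈ s, X.phi (X.p v))

theorem mem_T2 {s : Finset ι} : s ∈ X.T2 ↔ X.Face s ∧ (s.card = 1 ∨ s.card = 2) := by simp [T2]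

theorem pair_mem_T2 {v w : ι} (h : X.Face {v, w}) : ({v, w} : Finset ι) ∈ X.T2 := by
  rw [mem_T2]
  refine ⟨h, ?_⟩
  by_cases hvw : v = w
  · subst hvw; simp
  · right; exact card_pair hvw

theorem sum_pair_phi {v w : ι} (h : X.Face {v, w}) : ∃ c : ℝ, 0 < c ∧
    ∑ i ∈ ({v, w} : Finset ι), X.phi (X.p i) = c * X.phi (X.p v + X.p w) := by
  by_cases hvw : v = w
  · subst hvw; refine ⟨1/2, by norm_num, ?_⟩; simp; ring
  · refine ⟨1, by norm_num, ?_⟩; rw [sum_pair hvw, map_add, one_mul]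

theorem card_T2p : 2 * X.T2p.card = X.T2.card := by
  apply half_card X.T2 (fun s => s.image X.neg)
  · intro s hs
    rw [mem_T2] at hs ⊢
    rw [face_neg_iff, card_image_of_injective _ X.neg_inj]; exact hs
  · intro s _; exact X.image_neg_neg s
  · intro s _
    rw [sum_image (fun a _ b _ h => X.neg_inj h), ← sum_neg_distrib]
    apply sum_congr rfl; intro v _; exact phi_neg v
  · intro s hs
    rw [mem_T2] at hs
    rcases hs with ⟨hF, h | h⟩
    · obtain ⟨v, rfl⟩ := card_eq_one.1 h; simpa using phi_ne v
    · obtain ⟨v, w, hvw, rfl⟩ := card_eq_two.1 h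
      obtain ⟨c, hc, he⟩ := sum_pair_phi hF
      rw [he]; exact mul_ne_zero hc.ne' (phi_ne2 hF)

theorem card_T2 : X.T2.card = Fintype.card ι + (univ.filter (fun s => X.Face s ∧ s.card = 2)).card := by
  have : X.T2 = univ.image (fun v : ι => ({v} : Finset ι)) ∪ univ.filter (fun s => X.Face s ∧ s.card = 2) := by
    ext s
    simp only [mem_T2, mem_union, mem_image, mem_univ, true_and, mem_filter]
    constructor
    · rintro ⟨h, h1 | h1⟩
      · obtain ⟨v, rfl⟩ := card_eq_one.1 h1; exact Or.inl ⟨v, rfl⟩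
      · exact Or.inr ⟨h, h1⟩
    · rintro (⟨v, rfl⟩ | ⟨h, h1⟩)
      · exact ⟨X.face_single v, Or.inl (card_singleton v)⟩
      · exact ⟨h, Or.inr h1⟩
  rw [this, card_union_of_disjoint, card_image_of_injective _ (fun a b h => singleton_injective h)]
  · rfl
  · rw [disjoint_left]
    rintro s hs hs2
    obtain ⟨v, -, rfl⟩ := mem_image.1 hs
    simp at hs2

/-- evaluation on unordered pairs -/
def evT (T : Finset (Finset ι)) : (ι → ι → ℝ) →ₗ[ℝ] ({s // s ∈ T} → ℝ) where
  toFun Ω s := ∑ v, ∑ w, if ({v, w} : Finset ι) = s.1 then Ω v w else 0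
  map_add' a b := by
    ext s; simp only [Pi.add_apply, ← sum_add_distrib]
    apply sum_congr rfl; intro v _; apply sum_congr rfl; intro w _
    split_ifs <;> simp
  map_smul' c a := by
    ext s; simp only [Pi.smul_apply, smul_eq_mul, mul_sum, RingHom.id_apply]
    apply sum_congr rfl; intro v _; apply sum_congr rfl; intro w _
    split_ifs <;> simp

theorem evT_pair {T : Finset (Finset ι)} {Ω : ι → ι → ℝ} (hs : ∀ v w, Ω v w = Ω w v) {v w : ι}
    (h : ({v, w} : Finset ι) ∈ T) (h0 : evT T Ω ⟨_, h⟩ = 0) : Ω v w = 0 := by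
  have h1 : ∀ a b, (if ({a, b} : Finset ι) = {v, w} then Ω a b else 0) =
      Ω v w * (if ({a, b} : Finset ι) = {v, w} then 1 else 0) := by
    intro a b
    split_ifs with h
    · have ha : a ∈ ({v, w} : Finset ι) := by rw [← h]; simp
      have hb : b ∈ ({v, w} : Finset ι) := by rw [← h]; simp
      have hv : v ∈ ({a, b} : Finset ι) := by rw [h]; simp
      have hw : w ∈ ({a, b} : Finset ι) := by rw [h]; simp
      simp only [mem_insert, mem_singleton] at ha hb hv hw
      rcases ha with rfl | rfl <;> rcases hb with rfl | rfl
      · simp at hw; subst hw; simp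
      · simp
      · rw [hs]; simp
      · simp at hv; subst hv; simp
    · simp
  change ∑ a, ∑ b, (if ({a, b} : Finset ι) = {v, w} then Ω a b else 0) = 0 at h0
  simp only [h1, ← mul_sum] at h0
  refine (mul_eq_zero.1 h0).resolve_right (ne_of_gt ?_)
  apply sum_pos'
  · intro a _; apply sum_nonneg; intro b _; split_ifs <;> norm_num
  · refine ⟨v, mem_univ _, ?_⟩
    apply sum_pos'
    · intro b _; split_ifs <;> norm_num
    · exact ⟨w, mem_univ _, by simp⟩

theorem eq_zero_of_pos {Ω : ι → ι → ℝ} (hs : Ω ∈ Sy X.Fc) (ho : Ω ∈ X.Od)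
    (h : ∀ v w, X.Face {v, w} → 0 < X.phi (X.p v + X.p w) → Ω v w = 0) : Ω = 0 := by
  ext v w
  by_cases hF : X.Face {v, w}
  · rcases (phi_ne2 hF).lt_or_gt with h1 | h1
    · have := h (X.neg v) (X.neg w) (face_pair_neg.2 hF) (by
        rw [X.p_neg, X.p_neg, ← neg_add, map_neg]; linarith)
      have h2 := ho v w
      simp only [Pi.zero_apply]; linarith
    · exact h v w hF h1
  · exact hs.2 v w hF

theorem finrank_odd_le : Module.finrank ℝ (Sy X.Fc ⊓ X.Od : Submodule ℝ (ι → ι → ℝ)) ≤ X.T2p.card := by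
  let L : (Sy X.Fc ⊓ X.Od : Submodule ℝ (ι → ι → ℝ)) →ₗ[ℝ] ({s // s ∈ X.T2p} → ℝ) :=
    evT X.T2p ∘ₗ Submodule.subtype _
  have hL : Function.Injective L := by
    rw [← LinearMap.ker_eq_bot, LinearMap.ker_eq_bot']
    rintro ⟨Ω, hs, ho⟩ h
    apply Subtype.ext
    apply eq_zero_of_pos hs ho
    intro v w hF hp
    have hm : ({v, w} : Finset ι) ∈ X.T2p := by
      rw [T2p, mem_filter]
      obtain ⟨c, hc, he⟩ := sum_pair_phi hF
      exact ⟨pair_mem_T2 hF, by rw [he]; positivity⟩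
    exact evT_pair hs.1 hm (congrFun h _)
  have := LinearMap.finrank_le_finrank_of_injective hL
  simpa using this

/-- the smallness assumption -/
def Small (X : CSP d ι) : Prop :=
  (univ.filter (fun s => X.Face s ∧ s.card = 2)).card + 2 * d ≤ d * Fintype.card ι

theorem row_odd {Ω : ι → ι → ℝ} (ho : Ω ∈ X.Od) (v : ι) : X.row Ω (X.neg v) = X.row Ω v := by
  rw [row_apply, row_apply, ← X.sum_neg (fun w => Ω (X.neg v) w • X.p w)]
  apply sum_congr rfl; intro w _
  rw [ho v w, X.p_neg]; simp

theorem finrank_O2_le (hX : X.Small) : Module.finrank ℝ X.O2 + d ≤ X.Hp.card := by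
  let L : (Sy X.Fc ⊓ X.Od : Submodule ℝ (ι → ι → ℝ)) →ₗ[ℝ] ({v // v ∈ X.Hp} → (Fin d → ℝ)) :=
    LinearMap.funLeft ℝ (Fin d → ℝ) Subtype.val ∘ₗ X.row ∘ₗ Submodule.subtype _
  have hLa : ∀ Ω v, L Ω v = X.row Ω.1 v := fun Ω v => rfl
  have hsurj : LinearMap.range L = ⊤ := by
    rw [LinearMap.range_eq_top]
    intro r
    obtain ⟨Ω, hΩ, hr⟩ := exists_row_even (X := X)
      (fun v => if h : v ∈ X.Hp then r ⟨v, h⟩ else if h : X.neg v ∈ X.Hp then r ⟨X.neg v, h⟩ else 0) (by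
        intro v
        by_cases h : v ∈ X.Hp
        · have h2 : X.neg v ∉ X.Hp := fun h' => neg_mem_Hp.1 h' h
          simp only [X.neg_neg, dif_neg h2, dif_pos h]
        · have h2 : X.neg v ∈ X.Hp := neg_mem_Hp.2 h
          simp only [dif_pos h2, dif_neg h])
    refine ⟨⟨Ω, hΩ⟩, ?_⟩
    ext1 v
    rw [hLa, hr]; simp
  have hker : Module.finrank ℝ (LinearMap.ker L) = Module.finrank ℝ X.O2 := by
    have : LinearMap.ker L = Submodule.comap (Submodule.subtype _) (LinearMap.ker X.row) := by
      ext Ω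
      simp only [LinearMap.mem_ker, Submodule.mem_comap, Submodule.subtype_apply]
      constructor
      · intro h; ext1 v
        by_cases hv : v ∈ X.Hp
        · exact congrFun h ⟨v, hv⟩
        · have := congrFun h ⟨X.neg v, neg_mem_Hp.2 hv⟩
          rw [hLa, row_odd Ω.2.2] at this; exact this
      · intro h; ext1 v; rw [hLa, h]; rfl
    rw [this]
    rw [O2, ← Submodule.map_comap_subtype (Sy X.Fc ⊓ X.Od)]
    exact (Submodule.equivMapOfInjective (Submodule.subtype (Sy X.Fc ⊓ X.Od))
      (Submodule.injective_subtype (Sy X.Fc ⊓ X.Od))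
      (Submodule.comap (Submodule.subtype (Sy X.Fc ⊓ X.Od)) (LinearMap.ker X.row))).finrank_eq
  have h1 := LinearMap.finrank_range_add_finrank_ker L
  rw [hsurj, finrank_top, hker] at h1
  have h2 := finrank_odd_le (X := X)
  have h3 := card_T2p (X := X)
  have h4 := card_T2 (X := X)
  have h5 := card_Hp (X := X)
  rw [Module.finrank_pi_fintype] at h1
  simp at h1
  have h6 := hX
  unfold Small at h6
  rw [← h5] at h6 h4
  nlinarith


theorem deg_mul_S (q r : X.OF → ℝ) : X.deg (q * X.S r) = X.deg (X.S q * r) := by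
  rw [← deg_S, map_mul, S_S]

/-- the bilinear form attached to an element -/
def Om (X : CSP d ι) : (X.OF → ℝ) →ₗ[ℝ] (ι → ι → ℝ) where
  toFun q v w := X.deg (q * (X.xv v * X.xv w))
  map_add' a b := by ext v w; simp [add_mul]
  map_smul' c a := by ext v w; simp

theorem Om_apply (q : X.OF → ℝ) (v w : ι) : X.Om q v w = X.deg (q * (X.xv v * X.xv w)) := rfl

theorem Om_mem (q : X.OF → ℝ) : X.Om q ∈ Sy X.Fc := by
  refine ⟨fun v w => ?_, fun v w h => ?_⟩
  · rw [Om_apply, Om_apply, mul_comm (X.xv v)]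
  · rw [Om_apply, xv_mul_eq_zero h, mul_zero, map_zero]

theorem Om_row {q : X.OF → ℝ} (hq : q ∈ X.PP (d - 2)) : X.row (X.Om q) = 0 := by
  have hd := X.hd
  ext1 v
  apply eq_zero_of_lin
  intro l
  rw [row_lin]
  have h1 := deg_lin_mul (X := X) l (q := q * X.xv v) (by
    have := PP.mul hq (xv_mem (X := X) v)
    exact PP.le (by omega) this)
  rw [mul_comm, deg_br_sum'] at h1
  rw [← h1]
  apply sum_congr rfl; intro w _
  rw [Om_apply, lin_apply, mul_assoc, mul_comm]

theorem Om_sum (q : X.OF → ℝ) (v : ι) : ∑ w, X.Om q v w = X.deg (q * X.xv v) := by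
  simp only [Om_apply, ← mul_assoc]
  rw [← map_sum, ← mul_sum, sum_xv, mul_one]

theorem Om_neg (q : X.OF → ℝ) (v w : ι) : X.Om q (X.neg v) (X.neg w) = X.Om (X.S q) v w := by
  rw [Om_apply, Om_apply, ← S_xv, ← S_xv, ← map_mul, deg_mul_S]

theorem Om_odd {q : X.OF → ℝ} (hq : X.S q = - q) : X.Om q ∈ X.Od := by
  intro v w
  rw [Om_neg, hq, map_neg]; rfl

theorem S_br_odd {b : ι → ℝ} (hb : b ∈ X.OdV) : X.S (X.br b) = - X.br b := by
  rw [S_br, ← map_neg]; congr 1; ext v; exact hb v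

theorem Om_mem_O2 {q : X.OF → ℝ} (hq : q ∈ X.PP (d - 2)) (hS : X.S q = - q) : X.Om q ∈ X.O2 :=
  ⟨⟨Om_mem q, Om_odd hS⟩, Om_row hq⟩

theorem br_mem' (b : ι → ℝ) : X.br b ∈ X.PP (d - 2) := by
  have hd := X.hd
  exact PP.le (by omega) (br_mem b)

theorem lin_of_HR_empty {b : ι → ℝ} (h : ∀ v, X.deg (X.br b * X.xv v) = 0) : ∃ l, b = X.lin l := by
  have hd := X.hd
  have h0 : X.deg (X.br b) = 0 := by
    have := congrArg (fun q => X.deg (X.br b * q)) (X.sum_xv)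
    simp only [mul_one, mul_sum, map_sum, h] at this
    rw [← this]; simp
  have h1 : X.deg (X.br b * X.br b) = 0 := by
    rw [deg_br_sum']; simp [h]
  have := (HR_all (τ := ∅) X.face_empty (by simp; omega) b (by rw [xm_empty, one_mul, h0])).2
    (by rw [xm_empty, one_mul, h1])
  obtain ⟨l, hl⟩ := this
  exact ⟨l, funext fun i => hl i (X.face_single i)⟩

theorem finrank_OdV : X.Hp.card ≤ Module.finrank ℝ X.OdV := by
  let L : X.OdV →ₗ[ℝ] ({v // v ∈ X.Hp} → ℝ) := LinearMap.funLeft ℝ ℝ Subtype.val ∘ₗ Submodule.subtype _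
  have hL : Function.Surjective L := by
    intro r
    refine ⟨⟨fun v => if h : v ∈ X.Hp then r ⟨v, h⟩ else if h : X.neg v ∈ X.Hp then - r ⟨X.neg v, h⟩ else 0, ?_⟩, ?_⟩
    · intro v
      by_cases h : v ∈ X.Hp
      · have h2 : X.neg v ∉ X.Hp := fun h' => neg_mem_Hp.1 h' h
        simp only [X.neg_neg, dif_neg h2, dif_pos h]
      · have h2 : X.neg v ∈ X.Hp := neg_mem_Hp.2 h
        simp only [dif_pos h2, dif_neg h, _root_.neg_neg]
    · ext v
      change (if h : v.1 ∈ X.Hp then r ⟨v, h⟩ else _) = r v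
      rw [dif_pos v.2]
  have := LinearMap.finrank_le_finrank_of_surjective hL
  simpa using this

theorem O2_eq (hX : X.Small) {Ω : ι → ι → ℝ} (hΩ : Ω ∈ X.O2) : ∃ b ∈ X.OdV, Ω = X.Om (X.br b) := by
  let L : X.OdV →ₗ[ℝ] X.O2 := ((X.Om ∘ₗ X.br).domRestrict X.OdV).codRestrict X.O2
    (fun b => Om_mem_O2 (br_mem' b.1) (S_br_odd b.2))
  have hLa : ∀ b, (L b).1 = X.Om (X.br b.1) := fun b => rfl
  have hker : Module.finrank ℝ (LinearMap.ker L) ≤ d := by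
    have h1 : (LinearMap.ker L).map (Submodule.subtype _) ≤ LinearMap.range X.lin := by
      rintro _ ⟨b, hb, rfl⟩
      obtain ⟨l, hl⟩ := lin_of_HR_empty (X := X) (b := b.1) (by
        intro v
        rw [← Om_sum]
        have : X.Om (X.br b.1) = 0 := by rw [← hLa, LinearMap.mem_ker.1 hb]; rfl
        simp [this])
      exact ⟨l, hl.symm⟩
    have h2 := Submodule.finrank_mono h1
    rw [← (Submodule.equivMapOfInjective _ (Submodule.injective_subtype _) _).finrank_eq] at h2
    have h3 := LinearMap.finrank_range_le X.lin
    have h4 : Module.finrank ℝ ((Fin d → ℝ) →ₗ[ℝ] ℝ) = d := by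
      have := Subspace.dual_finrank_eq (K := ℝ) (V := Fin d → ℝ)
      rw [Module.finrank_fin_fun] at this; exact this
    omega
  have h1 := LinearMap.finrank_range_add_finrank_ker L
  have h2 := finrank_OdV (X := X)
  have h3 := finrank_O2_le hX
  have h4 : LinearMap.range L = ⊤ := by
    apply Submodule.eq_top_of_finrank_eq
    have := Submodule.finrank_le (LinearMap.range L)
    omega
  obtain ⟨b, hb⟩ := LinearMap.range_eq_top.1 h4 ⟨Ω, hΩ⟩
  exact ⟨b.1, b.2, by rw [← hLa, hb]⟩

theorem O2_zero (hX : X.Small) {Ω : ι → ι → ℝ} (hΩ : Ω ∈ X.O2) (h : ∀ v, ∑ w, Ω v w = 0) : Ω = 0 := by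
  have hd := X.hd
  obtain ⟨b, hb, rfl⟩ := O2_eq hX hΩ
  obtain ⟨l, rfl⟩ := lin_of_HR_empty (X := X) (b := b) (fun v => by rw [← Om_sum, h])
  ext v w
  rw [Om_apply]
  exact deg_lin_mul l (PP.le (by omega) (PP.mul (xv_mem v) (xv_mem w)))

end stress

end CSP

namespace CSP

section maina

variable {d : ℕ} {ι : Type} [Fintype ι] {X : CSP d ι} {u : ι}

def WV (X : CSP d ι) (u w : ι) : Prop := X.Face {u, w} ∧ X.Face {u, X.neg w}

theorem WV.neg {w : ι} (h : X.WV u w) : X.WV u (X.neg w) := ⟨h.2, by rw [X.neg_neg]; exact h.1⟩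

theorem WV_neg {w : ι} : X.WV u (X.neg w) ↔ X.WV u w :=
  ⟨fun h => by have := h.neg; rwa [X.neg_neg] at this, fun h => h.neg⟩

theorem WV_u : ¬ X.WV u u := fun h => h.2.not_neg (i := u) (by simp) (by simp)

theorem WV_nu : ¬ X.WV u (X.neg u) := fun h => WV_u (WV_neg.1 h)

theorem WV.ne {w : ι} (h : X.WV u w) : w ≠ u := by rintro rfl; exact WV_u h

theorem WV.ne2 {w : ι} (h : X.WV u w) : w ≠ X.neg u := by rintro rfl; exact WV_nu h

/-- extension of a function on the common link -/
def exT (u u' : ι) (Ω : ι → ι → ℝ) (a b : ι → ℝ) (t : ℝ) : ι → ι → ℝ := fun v w =>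
  Ω v w + (if v = u then a w else 0) + (if w = u then a v else 0) + (if v = u' then b w else 0) +
    (if w = u' then b v else 0) + (if w = u then if v = u then t else 0 else 0) -
    (if w = u' then if v = u' then t else 0 else 0)

theorem exT_sum {M : Type*} [AddCommGroup M] [Module ℝ M] (u u' : ι) (Ω : ι → ι → ℝ) (a b : ι → ℝ) (t : ℝ)
    (ψ : ι → M) (v : ι) : ∑ w, exT u u' Ω a b t v w • ψ w = ∑ w, Ω v w • ψ w +
      (if v = u then ∑ w, a w • ψ w else 0) + a v • ψ u + (if v = u' then ∑ w, b w • ψ w else 0) +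
      b v • ψ u' + (if v = u then t else 0) • ψ u - (if v = u' then t else 0) • ψ u' := by
  simp only [exT, add_smul, sub_smul, sum_add_distrib, sum_sub_distrib, ite_smul, zero_smul]
  congr 1; congr 1; congr 1; congr 1; congr 1; congr 1
  · split_ifs <;> simp
  · simp
  · split_ifs <;> simp
  · simp
  · simp
  · simp

theorem star_key (hX : X.Small) {Ω : ι → ι → ℝ} (hs : Ω ∈ Sy X.Fc) (ho : Ω ∈ X.Od)
    (hW : ∀ v w, ¬ X.WV u v → Ω v w = 0) (ρ : ι → ℝ) (hρ : ∀ v, X.row Ω v = ρ v • X.p u) : Ω = 0 := by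
  have hu := X.p_ne u
  have hun := X.neg_ne u
  obtain ⟨s, hsd⟩ : ∃ s : ι → ℝ, s = fun v => ∑ w, Ω v w := ⟨_, rfl⟩
  have hsn : ∀ v, s (X.neg v) = - s v := by
    intro v
    simp only [hsd]
    rw [← X.sum_neg (fun w => Ω (X.neg v) w), ← sum_neg_distrib]
    exact sum_congr rfl fun w _ => ho v w
  have hρn : ∀ v, ρ (X.neg v) = ρ v := by
    intro v
    have := row_odd ho v
    rw [hρ, hρ] at this
    exact smul_left_injective ℝ hu this
  have hs0 : ∀ v, ¬ X.WV u v → s v = 0 := by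
    intro v hv; simp only [hsd]; exact sum_eq_zero fun w _ => hW v w hv
  have hρ0 : ∀ v, ¬ X.WV u v → ρ v = 0 := by
    intro v hv
    have := hρ v
    rw [row_apply, sum_eq_zero (fun w _ => by rw [hW v w hv, zero_smul])] at this
    exact (smul_eq_zero.1 this.symm).resolve_right hu
  obtain ⟨a, ha⟩ : ∃ a : ι → ℝ, a = fun v => (1/2) * (- s v - ρ v) := ⟨_, rfl⟩
  obtain ⟨b, hb⟩ : ∃ b : ι → ℝ, b = fun v => (1/2) * (- s v + ρ v) := ⟨_, rfl⟩
  obtain ⟨t, ht⟩ : ∃ t : ℝ, t = (1/2) * ∑ v, ρ v := ⟨_, rfl⟩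
  have ha0 : ∀ v, ¬ X.WV u v → a v = 0 := fun v hv => by simp [ha, hs0 v hv, hρ0 v hv]
  have hb0 : ∀ v, ¬ X.WV u v → b v = 0 := fun v hv => by simp [hb, hs0 v hv, hρ0 v hv]
  have hab : ∀ v, a (X.neg v) = - b v := fun v => by simp only [ha, hb, hsn, hρn]; ring
  have hba : ∀ v, b (X.neg v) = - a v := fun v => by simp only [ha, hb, hsn, hρn]; ring
  have hsum_s : ∑ v, s v = 0 := by
    have := X.sum_neg s
    simp only [hsn, sum_neg_distrib] at this; linarith
  have hsum_ρp : ∑ v, ρ v • X.p v = 0 := by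
    have := X.sum_neg (fun v => ρ v • X.p v)
    simp only [hρn, X.p_neg, smul_neg, sum_neg_distrib] at this
    exact self_eq_neg.1 this.symm
  have hsum_sp : ∑ v, s v • X.p v = (2 * t) • X.p u := by
    have : ∑ v, X.row Ω v = (2 * t) • X.p u := by
      simp only [hρ, ← sum_smul]; rw [ht]; congr 1; ring
    rw [← this]
    simp only [row_apply, hsd, sum_smul]
    rw [sum_comm]
    refine sum_congr rfl fun v _ => sum_congr rfl fun w _ => ?_
    rw [hs.1]
  have hap : ∑ v, a v • X.p v = - t • X.p u := by
    have : ∀ v, a v • X.p v = (-1/2 : ℝ) • (s v • X.p v) + (-1/2 : ℝ) • (ρ v • X.p v) := by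
      intro v; simp only [ha]; module
    simp only [this, sum_add_distrib, ← smul_sum, hsum_sp, hsum_ρp]; module
  have hbp : ∑ v, b v • X.p v = - t • X.p u := by
    have : ∀ v, b v • X.p v = (-1/2 : ℝ) • (s v • X.p v) + (1/2 : ℝ) • (ρ v • X.p v) := by
      intro v; simp only [hb]; module
    simp only [this, sum_add_distrib, ← smul_sum, hsum_sp, hsum_ρp]; module
  have has : ∑ v, a v = - t := by
    simp only [ha, ← mul_sum, sum_sub_distrib, sum_neg_distrib, hsum_s, ht]; ring
  have hbs : ∑ v, b v = t := by
    simp only [hb, ← mul_sum, sum_add_distrib, sum_neg_distrib, hsum_s, ht]; ring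
  obtain ⟨Ω', hΩ'⟩ : ∃ Ω', Ω' = exT u (X.neg u) Ω a b t := ⟨_, rfl⟩
  have hWu := WV_u (X := X) (u := u)
  have hWn := WV_nu (X := X) (u := u)
  have hrow : X.row Ω' = 0 := by
    ext1 v
    rw [row_apply, hΩ', exT_sum, ← row_apply, hρ, hap, hbp, X.p_neg]
    by_cases h1 : v = u
    · subst h1
      rw [if_pos rfl, if_neg hun.symm, if_neg hun.symm, if_pos rfl, ha0 _ hWu, hb0 _ hWu, hρ0 _ hWu]
      simp
    by_cases h2 : v = X.neg u
    · subst h2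
      rw [if_neg hun, if_pos rfl, if_neg hun, if_pos rfl, ha0 _ hWn, hb0 _ hWn, hρ0 _ hWn]
      simp
    rw [if_neg h1, if_neg h1, if_neg h2, if_neg h2]
    simp only [ha, hb, Pi.zero_apply]; module
  have hsum : ∀ v, ∑ w, Ω' v w = 0 := by
    intro v
    have h := exT_sum u (X.neg u) Ω a b t (fun _ => (1:ℝ)) v
    simp only [smul_eq_mul, mul_one] at h
    rw [hΩ', h, has, hbs]
    by_cases h1 : v = u
    · have e := sum_eq_zero (fun w (_ : w ∈ (univ : Finset ι)) => hW _ w hWu)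
      subst h1
      simp [hun.symm, ha0 _ hWu, hb0 _ hWu, e]
    by_cases h2 : v = X.neg u
    · have e := sum_eq_zero (fun w (_ : w ∈ (univ : Finset ι)) => hW _ w hWn)
      subst h2
      simp [hun, ha0 _ hWn, hb0 _ hWn, e]
    simp only [if_neg h1, if_neg h2]
    simp only [ha, hb, hsd]; ring
  have hmem : Ω' ∈ X.O2 := by
    refine ⟨⟨⟨?_, ?_⟩, ?_⟩, hrow⟩
    · intro v w; rw [hΩ']; simp only [exT]; rw [hs.1 v w]
      by_cases h1 : v = u <;> by_cases h2 : w = u <;> by_cases h3 : v = X.neg u <;>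
        by_cases h4 : w = X.neg u <;> simp [h1, h2, h3, h4] <;> ring
    · intro v w h
      rw [hΩ']; simp only [exT]
      rw [hs.2 v w h]
      have e1 : (if v = u then a w else 0) = 0 := by
        split_ifs with h1
        · subst h1; apply ha0; intro hw; exact h hw.1
        · rfl
      have e2 : (if w = u then a v else 0) = 0 := by
        split_ifs with h1
        · subst h1; apply ha0; intro hw; exact h (Fc.symm hw.1)
        · rfl
      have e3 : (if v = X.neg u then b w else 0) = 0 := by
        split_ifs with h1
        · subst h1; apply hb0; intro hw; apply h
          have : X.Face {X.neg u, X.neg (X.neg w)} := face_pair_neg.2 hw.2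
          rwa [X.neg_neg] at this
        · rfl
      have e4 : (if w = X.neg u then b v else 0) = 0 := by
        split_ifs with h1
        · subst h1; apply hb0; intro hw; apply h
          have : X.Face {X.neg u, X.neg (X.neg v)} := face_pair_neg.2 hw.2
          rw [X.neg_neg] at this
          exact Fc.symm this
        · rfl
      have e5 : (if w = u then if v = u then t else 0 else 0) = 0 := by
        split_ifs with h1 h2
        · exfalso; apply h; rw [h1, h2]
          have := X.face_single u; unfold Fc; simpa using this
        · rfl
        · rfl
      have e6 : (if w = X.neg u then if v = X.neg u then t else 0 else 0) = 0 := by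
        split_ifs with h1 h2
        · exfalso; apply h; rw [h1, h2]
          have := X.face_single (X.neg u); unfold Fc; simpa using this
        · rfl
        · rfl
      rw [e1, e2, e3, e4, e5, e6]; simp
    · intro v w
      rw [hΩ']; simp only [exT]
      rw [ho v w]
      simp only [X.neg_inj.eq_iff, X.neg_eq_iff _ u, hab, hba]
      split_ifs <;> ring
  have h0 := O2_zero hX hmem hsum
  ext v w
  by_cases hv : X.WV u v
  · by_cases hw : X.WV u w
    · have := congrFun (congrFun h0 v) w
      rw [hΩ'] at this
      simpa [exT, hv.ne, hv.ne2, hw.ne, hw.ne2] using this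
    · rw [hs.1]; exact hW w v hw
  · exact hW v w hv

theorem solve_form {V W : Type*} [AddCommGroup V] [Module ℝ V] [AddCommGroup W] [Module ℝ W]
    [FiniteDimensional ℝ W] (B : V →ₗ[ℝ] W →ₗ[ℝ] ℝ) (F : W →ₗ[ℝ] ℝ)
    (h : ∀ z, (∀ y, B y z = 0) → F z = 0) : ∃ y, B y = F := by
  by_contra hcon
  have hn : F ∉ LinearMap.range B := fun ⟨y, hy⟩ => hcon ⟨y, hy⟩
  obtain ⟨Ψ, h1, h2⟩ := Submodule.exists_le_ker_of_notMem hn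
  obtain ⟨z, rfl⟩ := (Module.evalEquiv ℝ W).surjective Ψ
  apply h1
  rw [Module.evalEquiv_apply]
  apply h
  intro y
  have := h2 ⟨y, rfl⟩
  rw [LinearMap.mem_ker] at this
  exact this

/-- the functional `D_y` -/
def Dy (X : CSP d ι) (u : ι) (y : ι → ℝ) : (X.OF → ℝ) →ₗ[ℝ] ℝ where
  toFun q := X.deg (X.xv u * X.br y * q)
  map_add' a b := by rw [mul_add, map_add]
  map_smul' c a := by rw [mul_smul_comm, map_smul]; rfl

theorem Dy_apply (y : ι → ℝ) (q : X.OF → ℝ) : X.Dy u y q = X.deg (X.xv u * X.br y * q) := rfl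

theorem Dy_add (y z : ι → ℝ) (q : X.OF → ℝ) : X.Dy u (y + z) q = X.Dy u y q + X.Dy u z q := by
  simp only [Dy_apply, map_add, mul_add, add_mul]

theorem Dy_smul (c : ℝ) (y : ι → ℝ) (q : X.OF → ℝ) : X.Dy u (c • y) q = c * X.Dy u y q := by
  simp only [Dy_apply, map_smul, mul_smul_comm, smul_mul_assoc, smul_eq_mul]

theorem lin_of_HR_vert {z : ι → ℝ} (h : ∀ y, X.deg (X.xv u * X.br y * X.br z) = 0) :
    ∃ l : (Fin d → ℝ) →ₗ[ℝ] ℝ, ∀ i, X.Face {u, i} → z i = l (X.p i) := by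
  have hd := X.hd
  have h1 := h 1
  have h2 := h z
  rw [br_one, mul_one] at h1
  rw [mul_assoc] at h2
  obtain ⟨l, hl⟩ := (HR_all (τ := {u}) (X.face_single u) (by simp; omega) z
    (by rw [xm_single]; exact h1)).2 (by rw [xm_single]; exact h2)
  exact ⟨l, fun i hi => hl i (by rwa [pair_comm] at hi)⟩

/-- the space `Y` -/
def YY (X : CSP d ι) (u : ι) (y : ι → ℝ) : Prop := ∀ b ∈ X.OdV, X.Dy u y (X.br b) = 0

theorem exists_y {v : ι} (hv : X.WV u v) : ∃ y, X.YY u y ∧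
    ∀ z, X.Dy u y (X.br z) = z v + z (X.neg v) := by
  let B : (ι → ℝ) →ₗ[ℝ] (ι → ℝ) →ₗ[ℝ] ℝ := LinearMap.mk₂ ℝ (fun y z => X.Dy u y (X.br z))
    (fun y y' z => Dy_add _ _ _) (fun c y z => Dy_smul _ _ _) (fun y z z' => by rw [map_add, map_add])
    (fun c y z => by rw [map_smul, map_smul])
  obtain ⟨y, hy⟩ := solve_form B ((LinearMap.proj v : (ι → ℝ) →ₗ[ℝ] ℝ) + (LinearMap.proj (X.neg v) : (ι → ℝ) →ₗ[ℝ] ℝ)) (by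
    intro z hz
    obtain ⟨l, hl⟩ := lin_of_HR_vert (X := X) (u := u) (z := z) hz
    change z v + z (X.neg v) = 0
    rw [hl v hv.1, hl _ hv.2, X.p_neg, map_neg]; ring)
  have hy2 : ∀ z, X.Dy u y (X.br z) = z v + z (X.neg v) := fun z => LinearMap.congr_fun hy z
  refine ⟨y, ?_, hy2⟩
  intro b hb
  rw [hy2, hb v]; ring

theorem YY.add {y z : ι → ℝ} (hy : X.YY u y) (hz : X.YY u z) : X.YY u (y + z) := by
  intro b hb; rw [Dy_add, hy b hb, hz b hb, add_zero]

theorem YY.smul {y : ι → ℝ} (c : ℝ) (hy : X.YY u y) : X.YY u (c • y) := by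
  intro b hb; rw [Dy_smul, hy b hb, mul_zero]

variable {y : ι → ℝ}

theorem Dy_odd (hX : X.Small) (hy : X.YY u y) {q : X.OF → ℝ} (hq : q ∈ X.PP (d - 2))
    (hS : X.S q = - q) : X.Dy u y q = 0 := by
  obtain ⟨b, hb, he⟩ := O2_eq hX (Om_mem_O2 hq hS)
  have key : ∀ r, X.Dy u y r = ∑ w, y w * X.Om r u w := by
    intro r
    rw [Dy_apply, mul_right_comm, deg_br_sum']
    refine sum_congr rfl fun w _ => ?_
    rw [Om_apply]; congr 2; ring
  rw [key, he, ← key]; exact hy b hb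

theorem Dy_S (hX : X.Small) (hy : X.YY u y) {q : X.OF → ℝ} (hq : q ∈ X.PP (d - 2)) :
    X.Dy u y (X.S q) = X.Dy u y q := by
  have := Dy_odd hX hy (q := q - X.S q) (Submodule.sub_mem _ hq (S_mem hq))
    (by rw [map_sub, S_S]; abel)
  rw [map_sub] at this; linarith

theorem Dy_notW (hX : X.Small) (hy : X.YY u y) {w : ι} (hw : ¬ X.WV u w) {q : X.OF → ℝ}
    (hq : q ∈ X.PP (d - 3)) : X.Dy u y (X.xv w * q) = 0 := by
  have hd := X.hd
  have key : ∀ w q, ¬ X.Face {u, w} → X.Dy u y (X.xv w * q) = 0 := by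
    intro w q h
    have e : X.xv u * X.br y * (X.xv w * q) = (X.xv u * X.xv w) * (X.br y * q) := by ring
    rw [Dy_apply, e, xv_mul_eq_zero h, zero_mul, map_zero]
  by_cases h1 : X.Face {u, w}
  · have h2 : ¬ X.Face {u, X.neg w} := fun h => hw ⟨h1, h⟩
    rw [← Dy_S hX hy (PP.le (by omega) (PP.xv_mul w hq)), map_mul, S_xv]
    exact key _ _ h2
  · exact key _ _ h1

theorem xuy_mem {n : ℕ} {q : X.OF → ℝ} (hq : q ∈ X.PP n) (y : ι → ℝ) : X.xv u * X.br y * q ∈ X.PP (n + 2) :=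
  PP.le (by omega) (PP.mul (PP.mul (xv_mem u) (br_mem y)) hq)

theorem Om_Dy (q : X.OF → ℝ) (v w : ι) : X.Om (X.xv u * X.br y * q) v w = X.Dy u y (q * (X.xv v * X.xv w)) := by
  rw [Om_apply, Dy_apply, mul_assoc]

theorem Dy_odd2 (hX : X.Small) (hy : X.YY u y) {q : X.OF → ℝ} (hq : q ∈ X.PP (d - 4))
    (hS : X.S q = - q) (v w : ι) : X.Dy u y (q * (X.xv v * X.xv w)) = 0 := by
  have hd := X.hd
  have h := star_key (X := X) (u := u) hX (Ω := X.Om (X.xv u * X.br y * q)) (Om_mem _) (by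
    intro v w
    rw [Om_Dy, Om_Dy, ← S_xv, ← S_xv, ← map_mul, ← Dy_S hX hy, map_mul, hS, S_S, neg_mul, map_neg]
    exact PP.le (by omega) (PP.mul hq (S_mem (PP.mul (xv_mem v) (xv_mem w))))) (by
    intro v w hv
    rw [Om_Dy, mul_left_comm]
    exact Dy_notW hX hy hv (PP.le (by omega) (PP.mul hq (xv_mem w)))) 0 (by
    intro v
    rw [Om_row]
    · simp
    · exact PP.le (by omega) (xuy_mem hq y))
  rw [← Om_Dy, h]; rfl

/-- odd and even generators -/
def bv (X : CSP d ι) (v : ι) : X.OF → ℝ := X.xv v - X.xv (X.neg v)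
def sv (X : CSP d ι) (v : ι) : X.OF → ℝ := X.xv v + X.xv (X.neg v)

theorem bv_mem (v : ι) : X.bv v ∈ X.PP 1 := Submodule.sub_mem _ (xv_mem v) (xv_mem _)
theorem sv_mem (v : ι) : X.sv v ∈ X.PP 1 := Submodule.add_mem _ (xv_mem v) (xv_mem _)
theorem S_bv (v : ι) : X.S (X.bv v) = - X.bv v := by
  simp only [bv, map_sub, S_xv, X.neg_neg]; abel
theorem S_sv (v : ι) : X.S (X.sv v) = X.sv v := by
  simp only [sv, map_add, S_xv, X.neg_neg]; abel
theorem xv_eq (v : ι) : X.xv v = (1/2 : ℝ) • (X.sv v + X.bv v) := by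
  simp only [sv, bv]; module

theorem Dy_bs (hX : X.Small) (hy : X.YY u y) {q : X.OF → ℝ} (hq : q ∈ X.PP (d - 4)) (v w : ι) :
    X.Dy u y (X.bv v * X.sv w * q) = 0 := by
  have hd := X.hd
  have e : X.bv v * X.sv w * q = (1/2 : ℝ) • (X.bv v * X.sv w * (q + X.S q)) +
      (1/2 : ℝ) • (X.bv v * X.sv w * (q - X.S q)) := by
    rw [mul_add, mul_sub]; module
  have hm : ∀ r ∈ X.PP (d - 4), X.bv v * X.sv w * r ∈ X.PP (d - 2) := fun r hr =>
    PP.le (by omega) (PP.mul (PP.mul (bv_mem v) (sv_mem w)) hr)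
  rw [e, map_add, map_smul, map_smul]
  have h1 : X.Dy u y (X.bv v * X.sv w * (q + X.S q)) = 0 := by
    apply Dy_odd hX hy (hm _ (Submodule.add_mem _ hq (S_mem hq)))
    rw [map_mul, map_mul, S_bv, S_sv, map_add, S_S]; ring
  have h2 : X.Dy u y (X.bv v * X.sv w * (q - X.S q)) = 0 := by
    have h3 := Dy_odd2 hX hy (q := q - X.S q) (Submodule.sub_mem _ hq (S_mem hq))
      (by rw [map_sub, S_S]; abel)
    have e2 : X.bv v * X.sv w * (q - X.S q) = (q - X.S q) * (X.xv v * X.xv w) +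
       (q - X.S q) * (X.xv v * X.xv (X.neg w)) - (q - X.S q) * (X.xv (X.neg v) * X.xv w) -
       (q - X.S q) * (X.xv (X.neg v) * X.xv (X.neg w)) := by
      simp only [bv, sv]; ring
    rw [e2, map_sub, map_sub, map_add, h3, h3, h3, h3]; simp
  rw [h1, h2]; simp

end maina

end CSP

namespace CSP

section mainb

variable {d : ℕ} {ι : Type} [Fintype ι] {X : CSP d ι} {u : ι} {y : ι → ℝ}

theorem xv_xv_neg (v : ι) : X.xv v * X.xv (X.neg v) = 0 :=
  xv_mul_eq_zero (fun h => h.not_neg (i := v) (by simp) (by simp))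

theorem prod_bv_mem (L : List ι) : (L.map X.bv).prod ∈ X.PP L.length := by
  induction L with
  | nil => simpa using PP.one
  | cons a L ih =>
    rw [List.map_cons, List.prod_cons, List.length_cons, add_comm]
    exact PP.mul (bv_mem a) ih

theorem S_prod_bv (L : List ι) : X.S (L.map X.bv).prod = (-1 : ℝ) ^ L.length • (L.map X.bv).prod := by
  induction L with
  | nil => simp
  | cons a L ih =>
    rw [List.map_cons, List.prod_cons, map_mul, ih, S_bv, List.length_cons, pow_succ,
      neg_mul, mul_smul_comm, mul_neg_one, neg_smul]

theorem Om_even_zero (hX : X.Small) (hy : X.YY u y) {a : ι} {Q : X.OF → ℝ} {n : ℕ} (hn : n + 5 = d)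
    (hQ : Q ∈ X.PP n) (hS : X.S (X.bv a * Q) = X.bv a * Q) (v w : ι) :
    X.Dy u y (X.bv a * Q * (X.xv v * X.xv w)) = 0 := by
  obtain ⟨Ω, hΩ⟩ : ∃ Ω, Ω = X.Om (X.xv u * X.br y * (X.bv a * Q)) := ⟨_, rfl⟩
  have hQ1 : X.bv a * Q ∈ X.PP (d - 4) := PP.le (by omega) (PP.mul (bv_mem a) hQ)
  have hD : ∀ v w, Ω v w = X.Dy u y (X.bv a * Q * (X.xv v * X.xv w)) := by
    intro v w; rw [hΩ, Om_Dy]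
  have hsym : ∀ v w, Ω v w = Ω w v := by intro v w; rw [hD, hD, mul_comm (X.xv v)]
  have hneg : ∀ v w, Ω (X.neg v) w = - Ω v w := by
    intro v w
    have := Dy_bs hX hy (q := X.xv w * Q) (PP.le (by omega) (PP.xv_mul w hQ)) a v
    have e : X.bv a * X.sv v * (X.xv w * Q) = X.bv a * Q * (X.xv v * X.xv w) +
        X.bv a * Q * (X.xv (X.neg v) * X.xv w) := by rw [sv]; ring
    rw [e, map_add, ← hD, ← hD] at this
    linarith
  have hneg2 : ∀ v w, Ω v (X.neg w) = - Ω v w := by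
    intro v w; rw [hsym, hneg, hsym]
  have hmem : Ω ∈ Sy X.Fc := by rw [hΩ]; exact Om_mem _
  have hrow : ∀ v, ∑ w, Ω v w • X.p w = 0 := by
    intro v
    rw [← row_apply, hΩ, Om_row]
    · simp
    · exact PP.le (by omega) (xuy_mem hQ1 y)
  have hW : ∀ v w, ¬ X.WV u v → Ω v w = 0 := by
    intro v w hv
    rw [hD, mul_left_comm]
    exact Dy_notW hX hy hv (PP.le (by omega) (PP.mul hQ1 (xv_mem w)))
  have key : ∀ v0 v w, ((if v = v0 then (1:ℝ) else 0) - (if v = X.neg v0 then 1 else 0) +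
      ((if w = v0 then (1:ℝ) else 0) - (if w = X.neg v0 then 1 else 0))) * Ω v w = 0 := by
    intro v0
    have := star_key (X := X) (u := u) hX (Ω := fun v w => ((if v = v0 then (1:ℝ) else 0) - (if v = X.neg v0 then 1 else 0) +
      ((if w = v0 then (1:ℝ) else 0) - (if w = X.neg v0 then 1 else 0))) * Ω v w)
      ⟨fun v w => by beta_reduce; rw [hsym v w, add_comm], fun v w h => by beta_reduce; rw [hmem.2 v w h, mul_zero]⟩
      (by
        intro v w
        simp only [hneg, hneg2, X.neg_inj.eq_iff, X.neg_eq_iff _ v0]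
        ring)
      (by intro v w hv; beta_reduce; rw [hW v w hv, mul_zero]) 0 (by
        intro v
        rw [row_apply]
        simp only [add_mul, sub_mul, add_smul, sub_smul, sum_add_distrib, sum_sub_distrib, mul_smul,
          ← smul_sum, hrow, smul_zero, ite_mul, ite_smul, one_mul, zero_mul, zero_smul, one_smul]
        simp [hneg2, X.p_neg, hrow])
    intro v w
    exact congrFun (congrFun this v) w
  have hfin : Ω v w = 0 := by
    by_cases h1 : w = X.neg v
    · rw [hD, h1, xv_xv_neg, mul_zero, map_zero]
    have := key v v w
    rw [if_pos rfl, if_neg (X.neg_ne v).symm, if_neg h1] at this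
    split_ifs at this <;> linarith
  rw [← hD, hfin]

theorem Dy_prod_zero (hX : X.Small) (hd5 : 5 ≤ d) (hy : X.YY u y) (L : List ι) (hL : L.length = d - 2) :
    X.Dy u y (L.map X.bv).prod = 0 := by
  rcases Nat.even_or_odd L.length with he | ho
  · obtain ⟨v, w, a, L', rfl⟩ : ∃ v w a L', L = v :: w :: a :: L' := by
      match L, hL with
      | [], h => simp at h; omega
      | [_], h => simp at h; omega
      | [_, _], h => simp at h; omega
      | v :: w :: a :: L', _ => exact ⟨v, w, a, L', rfl⟩
    simp only [List.length_cons] at hL he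
    have h := Om_even_zero hX hy (a := a) (n := L'.length) (by omega) (prod_bv_mem L') (by
      have := S_prod_bv (X := X) (a :: L')
      rw [List.map_cons, List.prod_cons] at this
      rw [this, List.length_cons, Even.neg_one_pow, one_smul]
      rcases he with ⟨k, hk⟩
      exact ⟨k - 1, by omega⟩)
    simp only [List.map_cons, List.prod_cons]
    have e : X.bv v * (X.bv w * (X.bv a * (L'.map X.bv).prod)) =
      X.bv a * (L'.map X.bv).prod * (X.xv v * X.xv w)
      - X.bv a * (L'.map X.bv).prod * (X.xv v * X.xv (X.neg w))
      - X.bv a * (L'.map X.bv).prod * (X.xv (X.neg v) * X.xv w)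
      + X.bv a * (L'.map X.bv).prod * (X.xv (X.neg v) * X.xv (X.neg w)) := by
      rw [bv.eq_def X v, bv.eq_def X w]; ring
    rw [e]
    simp only [map_add, map_sub, h]; simp
  · apply Dy_odd hX hy
    · rw [← hL]; exact prod_bv_mem L
    · rw [S_prod_bv, Odd.neg_one_pow ho, neg_one_smul]

theorem Dy_prod_mul_zero (hX : X.Small) (hd5 : 5 ≤ d) (hy : X.YY u y) (n : ℕ) : ∀ (L : List ι), L ≠ [] →
    L.length + n = d - 2 → ∀ q ∈ X.PP n, X.Dy u y ((L.map X.bv).prod * q) = 0 := by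
  induction n with
  | zero =>
    intro L _ hl q hq
    obtain ⟨c, rfl⟩ := PP.zero_cases hq
    rw [mul_smul_comm, mul_one, map_smul, Dy_prod_zero hX hd5 hy L hl, smul_zero]
  | succ n ih =>
    intro L hL hl q hq
    refine PP.induct (C := fun q => X.Dy u y ((L.map X.bv).prod * q) = 0) ?_ (by simp) ?_ hq
    · intro w q hq
      have h1 := ih (w :: L) (by simp) (by simp; omega) q hq
      obtain ⟨v, L1, rfl⟩ := List.exists_cons_of_ne_nil hL
      have h2 := Dy_bs hX hy (q := (L1.map X.bv).prod * q) (PP.le (by simp at hl; omega)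
        (PP.mul (prod_bv_mem L1) hq)) v w
      simp only [List.map_cons, List.prod_cons] at h1 ⊢
      have e : X.bv v * (List.map X.bv L1).prod * (X.xv w * q) =
        (1/2 : ℝ) • (X.bv v * X.sv w * ((L1.map X.bv).prod * q)) +
        (1/2 : ℝ) • (X.bv w * (X.bv v * (L1.map X.bv).prod) * q) := by
        rw [xv_eq w]
        simp only [smul_mul_assoc, mul_smul_comm, ← smul_add]
        congr 1; ring
      rw [e, map_add, map_smul, map_smul, h1, h2]; simp
    · intro a b ha hb; beta_reduce; rw [mul_add, map_add, ha, hb, add_zero]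

theorem Dy_bv (hX : X.Small) (hd5 : 5 ≤ d) (hy : X.YY u y) (v : ι) {q : X.OF → ℝ} (hq : q ∈ X.PP (d - 3)) :
    X.Dy u y (X.bv v * q) = 0 := by
  have := Dy_prod_mul_zero hX hd5 hy (d - 3) [v] (by simp) (by simp; omega) q hq
  simpa using this

theorem Dy_flip (hX : X.Small) (hd5 : 5 ≤ d) (hy : X.YY u y) (v : ι) {q : X.OF → ℝ} (hq : q ∈ X.PP (d - 3)) :
    X.Dy u y (X.xv (X.neg v) * q) = X.Dy u y (X.xv v * q) := by
  have := Dy_bv hX hd5 hy v hq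
  rw [bv, sub_mul, map_sub] at this; linarith

theorem Dy_sq (hX : X.Small) (hd5 : 5 ≤ d) (hy : X.YY u y) (v : ι) {q : X.OF → ℝ} (hq : q ∈ X.PP (d - 4)) :
    X.Dy u y (X.xv v * (X.xv v * q)) = 0 := by
  have := Dy_bv hX hd5 hy v (q := X.xv v * q) (PP.le (by omega) (PP.xv_mul v hq))
  have e : X.bv v * (X.xv v * q) = X.xv v * (X.xv v * q) - X.xv v * X.xv (X.neg v) * q := by rw [bv]; ring
  rwa [e, xv_xv_neg, zero_mul, sub_zero] at this

theorem Dy_flips (hX : X.Small) (hd5 : 5 ≤ d) (hy : X.YY u y) (g : ι → ι) (hg : ∀ w, g w = w ∨ g w = X.neg w)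
    (A : Finset ι) : ∀ (n : ℕ) (q : X.OF → ℝ), q ∈ X.PP n → A.card + n = d - 2 →
    X.Dy u y ((∏ w ∈ A, X.xv (g w)) * q) = X.Dy u y (X.xm A * q) := by
  induction A using Finset.induction_on with
  | empty => intro n q _ _; simp [xm]
  | insert a s ha ih =>
    intro n q hq hc
    rw [card_insert_of_notMem ha] at hc
    rw [prod_insert ha, xm_insert ha]
    have e1 : X.xv (g a) * (∏ w ∈ s, X.xv (g w)) * q = (∏ w ∈ s, X.xv (g w)) * (X.xv (g a) * q) := by ring
    rw [e1, ih (n + 1) _ (PP.xv_mul _ hq) (by omega)]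
    have e2 : ∀ v, X.xm s * (X.xv v * q) = X.xv v * (X.xm s * q) := by intro v; ring
    rw [e2, mul_assoc]
    rcases hg a with h | h
    · rw [h]
    · rw [h, Dy_flip hX hd5 hy]
      exact PP.le (by omega) (PP.mul (xm_mem s) hq)

/-- half of the common link -/
def HW (X : CSP d ι) (u : ι) : Finset ι := X.Hp.filter (fun v => X.WV u v)

theorem mem_HW {v : ι} : v ∈ X.HW u ↔ v ∈ X.Hp ∧ X.WV u v := by simp [HW]

theorem extend_one (hX : X.Small) (hd5 : 5 ≤ d) (hy : X.YY u y) {T : Finset ι} (hT : T ⊆ X.HW u)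
    (hc : T.card < d - 2) (h : X.Dy u y (X.xm T) ≠ 0) :
    ∃ w ∈ X.HW u, w ∉ T ∧ X.Dy u y (X.xm (insert w T)) ≠ 0 := by
  have hm : X.xm T ∈ X.PP (d - 3) := PP.le (by omega) (xm_mem T)
  have key : ∃ v, X.Dy u y (X.xv v * X.xm T) ≠ 0 := by
    by_contra hcon
    push Not at hcon
    apply h
    rw [← one_mul (X.xm T), ← X.sum_xv, sum_mul, map_sum]
    exact sum_eq_zero fun v _ => hcon v
  obtain ⟨v, hv⟩ := key
  have hW : X.WV u v := by
    by_contra hW; exact hv (Dy_notW hX hy hW hm)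
  obtain ⟨w, hw, hwv⟩ : ∃ w ∈ X.HW u, X.Dy u y (X.xv w * X.xm T) ≠ 0 := by
    by_cases hp : v ∈ X.Hp
    · exact ⟨v, mem_HW.2 ⟨hp, hW⟩, hv⟩
    · exact ⟨X.neg v, mem_HW.2 ⟨neg_mem_Hp.2 hp, hW.neg⟩, by rwa [Dy_flip hX hd5 hy v hm]⟩
  have hwT : w ∉ T := by
    intro hwT
    apply hwv
    rw [← insert_erase hwT, xm_insert (notMem_erase w T)]
    apply Dy_sq hX hd5 hy
    refine PP.le ?_ (xm_mem _)
    rw [card_erase_of_mem hwT]; omega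
  exact ⟨w, hw, hwT, by rwa [xm_insert hwT]⟩

theorem extend_full (hX : X.Small) (hd5 : 5 ≤ d) (hy : X.YY u y) (n : ℕ) : ∀ {T : Finset ι}, T ⊆ X.HW u →
    T.card + n = d - 2 → X.Dy u y (X.xm T) ≠ 0 →
    ∃ S, T ⊆ S ∧ S ⊆ X.HW u ∧ S.card = d - 2 ∧ X.Dy u y (X.xm S) ≠ 0 := by
  induction n with
  | zero => intro T hT hc h; exact ⟨T, Subset.refl _, hT, hc, h⟩
  | succ n ih =>
    intro T hT hc h
    obtain ⟨w, hw, hwT, h2⟩ := extend_one hX hd5 hy hT (by omega) h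
    obtain ⟨S, h1, h3⟩ := ih (T := insert w T) (insert_subset hw hT)
      (by rw [card_insert_of_notMem hwT]; omega) h2
    exact ⟨S, (subset_insert _ _).trans h1, h3⟩

/-- the family `K` -/
def KK (X : CSP d ι) (u : ι) (S : Finset ι) : Prop :=
  S ⊆ X.HW u ∧ S.card = d - 2 ∧ ∃ y, X.YY u y ∧ X.Dy u y (X.xm S) ≠ 0

theorem KK.face (hX : X.Small) (hd5 : 5 ≤ d) {S : Finset ι} (h : X.KK u S) (g : ι → ι)
    (hg : ∀ w, g w = w ∨ g w = X.neg w) : X.Face (insert u (S.image g)) := by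
  obtain ⟨_, hc, y, hy, h⟩ := h
  have h1 := Dy_flips hX hd5 hy g hg S 0 1 PP.one (by omega)
  rw [mul_one, mul_one] at h1
  rw [← h1, Dy_apply] at h
  have h2 : X.xv u * X.br y * ∏ w ∈ S, X.xv (g w) ≠ 0 := by
    intro h0; rw [h0, map_zero] at h; exact h rfl
  obtain ⟨f, hf⟩ := Function.ne_iff.1 h2
  apply f.face.mono
  intro w hw
  by_contra hn
  apply hf
  have h0 := xv_apply_of_notMem (X := X) hn
  rw [Pi.mul_apply, Pi.mul_apply]
  rcases mem_insert.1 hw with rfl | hw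
  · rw [h0]; simp
  · obtain ⟨a, ha, rfl⟩ := mem_image.1 hw
    rw [prod_apply, prod_eq_zero ha h0]; simp

end mainb

end CSP

namespace CSP

section mainc

variable {d : ℕ} {ι : Type} [Fintype ι] {X : CSP d ι} {u : ι} {y : ι → ℝ}

theorem Sup.neg_le {l : (Fin d → ℝ) →ₗ[ℝ] ℝ} (h : X.Sup l) (i : ι) : - 1 ≤ l (X.p i) := by
  have := h (X.neg i); rw [X.p_neg, map_neg] at this; linarith

theorem Face.indep_sum {s : Finset ι} (h : X.Face s) (c : ι → ℝ) (hc : ∑ i ∈ s, c i • X.p i = 0) :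
    ∀ i ∈ s, c i = 0 := by
  have h1 := Fintype.linearIndependent_iff.1 h.indep (fun i => c i) (by
    rw [← sum_coe_sort s (fun i => c i • X.p i)] at hc; exact hc)
  exact fun i hi => h1 ⟨i, hi⟩

theorem u_notMem_HW : u ∉ X.HW u := fun h => WV_u (mem_HW.1 h).2

theorem KK_radon (hX : X.Small) (hd5 : 5 ≤ d) {S S' : Finset ι} (hS : X.KK u S) (hS' : X.KK u S')
    {a b : ι} (ha : a ∈ S') (hb : b ∈ S') (haS : a ∉ S) (hbS : b ∉ S) : a = b := by
  by_contra hab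
  have haH := hS'.1 ha
  have hbH := hS'.1 hb
  have huS : u ∉ S := fun h => u_notMem_HW (hS.1 h)
  have hua : u ≠ a := by rintro rfl; exact u_notMem_HW haH
  have hub : u ≠ b := by rintro rfl; exact u_notMem_HW hbH
  obtain ⟨T, hT⟩ : ∃ T : Finset ι, T = insert u (insert a (insert b S)) := ⟨_, rfl⟩
  have hcard : T.card = d + 1 := by
    rw [hT, card_insert_of_notMem (by simp [hua, hub, huS]), card_insert_of_notMem (by simp [hab, haS]),
      card_insert_of_notMem hbS, hS.2.1]; omega
  have hni : ¬ LinearIndependent ℝ (fun i : T => X.p i) := by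
    intro h
    have := h.fintype_card_le_finrank
    simp [hcard] at this
  rw [Fintype.not_linearIndependent_iff] at hni
  obtain ⟨c', hc0, i0, hi0⟩ := hni
  obtain ⟨c, hcdef⟩ : ∃ c : ι → ℝ, c = fun i => if h : i ∈ T then c' ⟨i, h⟩ else 0 := ⟨_, rfl⟩
  have hcc : ∀ i : T, c i = c' i := by intro i; rw [hcdef]; simp
  have hsum : ∑ i ∈ T, c i • X.p i = 0 := by
    rw [← sum_coe_sort T (fun i => c i • X.p i)]; simp only [hcc]; exact hc0
  have hsplit : c u • X.p u + (c a • X.p a + (c b • X.p b + ∑ i ∈ S, c i • X.p i)) = 0 := by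
    rw [← hsum, hT, sum_insert (by simp [hua, hub, huS]), sum_insert (by simp [hab, haS]), sum_insert hbS]
  have lin : ∀ m : (Fin d → ℝ) →ₗ[ℝ] ℝ, c u * m (X.p u) + (c a * m (X.p a) + (c b * m (X.p b) +
      ∑ i ∈ S, c i * m (X.p i))) = 0 := by
    intro m
    have := congrArg m hsplit
    simpa only [map_add, map_smul, map_sum, map_zero, smul_eq_mul] using this
  obtain ⟨g, hg⟩ : ∃ g : ι → ι, g = fun w => if 0 ≤ c w then w else X.neg w := ⟨_, rfl⟩
  obtain ⟨g', hg'⟩ : ∃ g : ι → ι, g = fun w => if 0 ≤ c w then X.neg w else w := ⟨_, rfl⟩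
  have hF := hS.face hX hd5 g (fun w => by rw [hg]; beta_reduce; split_ifs <;> simp)
  have hF' := hS'.face hX hd5 g' (fun w => by rw [hg']; beta_reduce; split_ifs <;> simp)
  obtain ⟨m, hm, hme⟩ := hF.exact
  obtain ⟨m', hm', hme'⟩ := hF'
  have hmu : m (X.p u) = 1 := (hme u).2 (by simp)
  have hmu' : m' (X.p u) = 1 := hme' u (by simp)
  have hmS : ∀ i ∈ S, c i * m (X.p i) = |c i| := by
    intro i hi
    have h1 : m (X.p (g i)) = 1 := (hme _).2 (mem_insert_of_mem (mem_image_of_mem g hi))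
    rw [hg] at h1; beta_reduce at h1
    split_ifs at h1 with h2
    · rw [h1, mul_one, abs_of_nonneg h2]
    · rw [X.p_neg, map_neg] at h1
      rw [abs_of_neg (not_le.1 h2)]; have : m (X.p i) = -1 := by linarith
      rw [this]; ring
  have hmS' : ∀ i ∈ S', c i * m' (X.p i) = - |c i| := by
    intro i hi
    have h1 : m' (X.p (g' i)) = 1 := hme' _ (mem_insert_of_mem (mem_image_of_mem g' hi))
    rw [hg'] at h1; beta_reduce at h1
    split_ifs at h1 with h2
    · rw [X.p_neg, map_neg] at h1
      rw [abs_of_nonneg h2]; have : m' (X.p i) = -1 := by linarith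
      rw [this]; ring
    · rw [h1, mul_one, abs_of_neg (not_le.1 h2)]; ring
  have habs : ∀ (l : (Fin d → ℝ) →ₗ[ℝ] ℝ), X.Sup l → ∀ i, |c i * l (X.p i)| ≤ |c i| := by
    intro l hl i
    rw [abs_mul]
    have : |l (X.p i)| ≤ 1 := abs_le.2 ⟨hl.neg_le i, hl i⟩
    nlinarith [abs_nonneg (c i)]
  have hstrict : ∀ i ∈ X.HW u, i ∉ S → c i * m (X.p i) + |c i| ≤ 0 → c i = 0 := by
    intro i hi hiS h
    have hHp := (mem_HW.1 hi).1
    have hnot : ∀ j, j = i ∨ j = X.neg i → j ∉ insert u (S.image g) := by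
      intro j hj hmem
      rcases mem_insert.1 hmem with h1 | h1
      · rcases hj with rfl | rfl
        · exact u_notMem_HW (h1 ▸ hi)
        · exact WV_u (u := u) (h1 ▸ (mem_HW.1 hi).2.neg)
      · obtain ⟨k, hk, hkj⟩ := mem_image.1 h1
        have hkH := (mem_HW.1 (hS.1 hk)).1
        have hgk : g k = k ∨ g k = X.neg k := by rw [hg]; beta_reduce; split_ifs <;> simp
        rcases hj with rfl | rfl <;> rcases hgk with h2 | h2 <;> rw [h2] at hkj
        · exact hiS (hkj ▸ hk)
        · rw [← hkj] at hHp; exact neg_mem_Hp.1 hHp hkH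
        · rw [hkj] at hkH; exact neg_mem_Hp.1 hkH hHp
        · exact hiS (X.neg_inj hkj ▸ hk)
    have h1 : m (X.p i) < 1 := lt_of_le_of_ne (hm i) fun h => hnot i (Or.inl rfl) ((hme i).1 h)
    have h2 : - 1 < m (X.p i) := by
      have := lt_of_le_of_ne (hm (X.neg i)) fun h => hnot _ (Or.inr rfl) ((hme _).1 h)
      rw [X.p_neg, map_neg] at this; linarith
    by_contra hne
    rcases lt_or_gt_of_ne hne with h3 | h3
    · rw [abs_of_neg h3] at h; nlinarith
    · rw [abs_of_pos h3] at h; nlinarith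
  have L1 := lin m
  have L2 := lin m'
  rw [hmu, sum_congr rfl hmS] at L1
  rw [hmu', hmS' a ha, hmS' b hb] at L2
  have hle : ∑ i ∈ S, c i * m' (X.p i) ≤ ∑ i ∈ S, |c i| :=
    sum_le_sum fun i _ => (le_abs_self _).trans (habs m' hm' i)
  have hA := neg_le_of_abs_le (habs m hm a)
  have hB := neg_le_of_abs_le (habs m hm b)
  have hca : c a = 0 := hstrict a haH haS (by linarith)
  have hcb : c b = 0 := hstrict b hbH hbS (by linarith)
  have hFS : X.Face (insert u S) := by
    have := hS.face hX hd5 id (fun w => Or.inl rfl)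
    rwa [image_id] at this
  have h0 := hFS.indep_sum c (by
    rw [sum_insert huS]
    rw [hca, hcb] at hsplit; simpa using hsplit)
  apply hi0
  rw [← hcc]
  obtain ⟨j, hj⟩ : ∃ j, j = (i0 : ι) := ⟨_, rfl⟩
  have hi : j ∈ T := hj ▸ i0.2
  rw [← hj]
  rw [hT, mem_insert, mem_insert, mem_insert] at hi
  rcases hi with h | h | h | h
  · rw [h]; exact h0 u (by simp)
  · rw [h]; exact hca
  · rw [h]; exact hcb
  · exact h0 _ (mem_insert_of_mem h)

theorem exists_KK (hX : X.Small) (hd5 : 5 ≤ d) (hy : X.YY u y) {v : ι} (hv : v ∈ X.HW u)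
    (h : X.Dy u y (X.xv v) ≠ 0) : ∃ S, v ∈ S ∧ X.KK u S ∧ X.Dy u y (X.xm S) ≠ 0 := by
  obtain ⟨S, h1, h2, h3, h4⟩ := extend_full hX hd5 hy (d - 3) (T := {v}) (by simpa using hv)
    (by simp; omega) (by rwa [xm_single])
  exact ⟨S, by simpa using h1, ⟨h2, h3, y, hy, h4⟩, h4⟩

theorem final_five (hX : X.Small) (hd5 : 5 ≤ d) (hk : d ≤ (X.HW u).card) : False := by
  have hYex : ∀ v : X.HW u, ∃ y, X.YY u y ∧ ∀ z, X.Dy u y (X.br z) = z v + z (X.neg v) :=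
    fun v => exists_y (mem_HW.1 v.2).2
  choose Y hY hYz using hYex
  have hself : ∀ v w : X.HW u, X.Dy u (Y v) (X.xv w) = if v = w then 1 else 0 := by
    intro v w
    rw [xv, hYz]
    have : X.neg v ≠ (w : ι) := by
      intro h
      have := (mem_HW.1 w.2).1
      rw [← h] at this
      exact neg_mem_Hp.1 this (mem_HW.1 v.2).1
    rw [Pi.single_eq_of_ne this, Pi.single_apply, add_zero]
    simp only [Subtype.ext_iff]
  have hcov : ∀ v ∈ X.HW u, ∃ S, v ∈ S ∧ X.KK u S := by
    intro v hv
    obtain ⟨S, h1, h2, _⟩ := exists_KK hX hd5 (hY ⟨v, hv⟩) hv (by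
      have := hself ⟨v, hv⟩ ⟨v, hv⟩; rw [if_pos rfl] at this; simp only at this; rw [this]; exact one_ne_zero)
    exact ⟨S, h1, h2⟩
  obtain ⟨v0, hv0⟩ : (X.HW u).Nonempty := card_pos.1 (by omega)
  obtain ⟨S, _, hS⟩ := hcov v0 hv0
  have hcS := hS.2.1
  obtain ⟨p, hp, q, hq, hpq⟩ : ∃ p ∈ X.HW u \ S, ∃ q ∈ X.HW u \ S, p ≠ q := by
    apply one_lt_card.1
    rw [card_sdiff_of_subset hS.1]; omega
  rw [mem_sdiff] at hp hq
  obtain ⟨Sp, hpSp, hSp⟩ := hcov p hp.1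
  obtain ⟨Sq, hqSq, hSq⟩ := hcov q hq.1
  have rad := fun {S S' : Finset ι} (h : X.KK u S) (h' : X.KK u S') {a b : ι} =>
    KK_radon hX hd5 h h' (a := a) (b := b)
  obtain ⟨a, haS, haSp⟩ : ∃ a ∈ S, a ∉ Sp := by
    by_contra hcon; push Not at hcon
    have : S = Sp := eq_of_subset_of_card_le hcon (by rw [hSp.2.1, hcS])
    exact hp.2 (this ▸ hpSp)
  have haSq : a ∉ Sq := by
    intro haSq
    have hqSp : q ∉ Sp := fun h => hpq (rad hS hSp hpSp h hp.2 hq.2)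
    have := rad hSp hSq haSq hqSq haSp hqSp
    exact hq.2 (this ▸ haS)
  have hC1 : ∀ c ∈ S, c ≠ a → c ∈ Sp := by
    intro c hc hca; by_contra h; exact hca (rad hSp hS hc haS h haSp)
  have hC2 : ∀ c ∈ S, c ≠ a → c ∈ Sq := by
    intro c hc hca; by_contra h; exact hca (rad hSq hS hc haS h haSq)
  have hall : ∀ S', X.KK u S' → S.erase a ⊆ S' := by
    intro S' hS' c hc
    rw [mem_erase] at hc
    by_contra hcn
    have hpS' : p ∈ S' := by
      by_contra h
      have := rad hS' hSp hpSp (hC1 c hc.2 hc.1) h hcn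
      exact hp.2 (this ▸ hc.2)
    have hqS' : q ∈ S' := by
      by_contra h
      have := rad hS' hSq hqSq (hC2 c hc.2 hc.1) h hcn
      exact hq.2 (this ▸ hc.2)
    exact hpq (rad hS hS' hpS' hqS' hp.2 hq.2)
  have hcC : (S.erase a).card = d - 3 := by rw [card_erase_of_mem haS]; omega
  have hform : ∀ S', X.KK u S' → ∃ b ∈ X.HW u \ S.erase a, S' = insert b (S.erase a) := by
    intro S' hS'
    obtain ⟨b, hb, hbn⟩ : ∃ b ∈ S', b ∉ S.erase a := by
      by_contra hcon; push Not at hcon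
      have := card_le_card (show S' ⊆ S.erase a from hcon)
      rw [hS'.2.1, hcC] at this; omega
    refine ⟨b, mem_sdiff.2 ⟨hS'.1 hb, hbn⟩, (eq_of_subset_of_card_le (insert_subset hb (hall S' hS')) ?_).symm⟩
    rw [card_insert_of_notMem hbn, hcC, hS'.2.1]; omega
  let yy : (X.HW u → ℝ) → (ι → ℝ) := fun lam => ∑ v, lam v • Y v
  have hDsum : ∀ lam q, X.Dy u (yy lam) q = ∑ v, lam v * X.Dy u (Y v) q := by
    intro lam q
    simp only [yy, Dy_apply, map_sum, map_smul, mul_sum, sum_mul, mul_smul_comm, smul_mul_assoc, smul_eq_mul]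
  let M : (X.HW u → ℝ) →ₗ[ℝ] ((X.HW u \ S.erase a : Finset ι) → ℝ) :=
    { toFun := fun lam b => X.Dy u (yy lam) (X.xm (insert b.1 (S.erase a)))
      map_add' := fun l l' => by
        ext b; simp only [hDsum, Pi.add_apply, add_mul, sum_add_distrib]
      map_smul' := fun c l => by
        ext b; simp only [hDsum, Pi.smul_apply, smul_eq_mul, mul_assoc, mul_sum, RingHom.id_apply] }
  have hker : LinearMap.ker M ≠ ⊥ := by
    apply LinearMap.ker_ne_bot_of_finrank_lt
    simp only [Module.finrank_fintype_fun_eq_card, Fintype.card_coe]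
    rw [card_sdiff_of_subset ((erase_subset _ _).trans hS.1), hcC]; omega
  obtain ⟨lam, hlam, hne⟩ := Submodule.exists_mem_ne_zero_of_ne_bot hker
  have hyy : X.YY u (yy lam) := by
    intro b hb
    rw [hDsum]; exact sum_eq_zero fun v _ => by rw [hY v b hb, mul_zero]
  apply hne
  ext v
  by_contra hv
  have hDv : X.Dy u (yy lam) (X.xv v) = lam v := by
    rw [hDsum]; simp [hself]
  obtain ⟨S', _, h2, h3⟩ := exists_KK hX hd5 hyy v.2 (by rw [hDv]; exact hv)
  obtain ⟨b, hb, rfl⟩ := hform S' h2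
  exact h3 (congrFun hlam ⟨b, hb⟩)

end mainc

end CSP

namespace CSP

section maind

variable {d : ℕ} {ι : Type} [Fintype ι] {X : CSP d ι} {u : ι} {y : ι → ℝ}

/-- even functions -/
def Ev (X : CSP d ι) : Submodule ℝ (ι → ι → ℝ) where
  carrier := {Ω | ∀ v w, Ω (X.neg v) (X.neg w) = Ω v w}
  add_mem' := by
    intro a b h1 h2 v w
    have := h1 v w; have := h2 v w
    simp only [Pi.add_apply]; linarith
  zero_mem' := by simp
  smul_mem' := by
    intro c a h1 v w
    have := h1 v w
    simp only [Pi.smul_apply, this]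

/-- edges of the common link -/
def Rw (X : CSP d ι) (u v w : ι) : Prop := X.Fc v w ∧ X.WV u v ∧ X.WV u w

theorem row_even {Ω : ι → ι → ℝ} (ho : Ω ∈ X.Ev) (v : ι) : X.row Ω (X.neg v) = - X.row Ω v := by
  rw [row_apply, row_apply, ← X.sum_neg (fun w => Ω (X.neg v) w • X.p w), ← sum_neg_distrib]
  apply sum_congr rfl; intro w _
  rw [ho v w, X.p_neg]; simp

theorem range_star (r : ι → (Fin d → ℝ)) (hr0 : ∀ v, ¬ X.WV u v → r v = 0)
    (hA : ∀ A : (Fin d → ℝ) →ₗ[ℝ] (Fin d → ℝ) →ₗ[ℝ] ℝ, (∀ x y, A x y = - A y x) →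
      ∑ v, A (X.p v) (r v) = 0) :
    ∃ Ω ∈ Sy (fun v w => X.Face (insert v (insert w {u}))), X.row Ω = r := by
  apply X.exists_row
  · intro v w h; rwa [insert_comm] at h
  · intro κ hκ
    obtain ⟨A, h1, h2⟩ := skew_lemma (X.face_single u) κ hκ
    rw [← hA A h1]
    refine sum_congr rfl fun v _ => ?_
    by_cases hv : X.WV u v
    · rw [h2 v (by have := hv.1; rwa [pair_comm] at this)]
    · rw [hr0 v hv, map_zero, map_zero]

theorem deg_odd_half {β : ι → ℝ} (hβ : β ∈ X.OdV) (v : ι) :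
    X.deg (X.br β * X.xv (X.neg v)) = - X.deg (X.br β * X.xv v) := by
  rw [← S_xv, deg_mul_S, S_br_odd hβ, neg_mul, map_neg]

theorem range_even (hX : X.Small) (r : ι → (Fin d → ℝ)) (hr0 : ∀ v, ¬ X.WV u v → r v = 0)
    (hodd : ∀ v, r (X.neg v) = - r v)
    (hA : ∀ A : (Fin d → ℝ) →ₗ[ℝ] (Fin d → ℝ) →ₗ[ℝ] ℝ, (∀ x y, A x y = - A y x) →
      ∑ v, A (X.p v) (r v) = 0) :
    ∃ Ω ∈ Sy (X.Rw u) ⊓ X.Ev, X.row Ω = r := by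
  have hd := X.hd
  obtain ⟨Ω, hΩ, hrow⟩ := range_star r hr0 hA
  have hΩF : Ω ∈ Sy X.Fc := ⟨hΩ.1, fun v w h => hΩ.2 v w fun h' => h (h'.mono (by
    intro x hx; simp only [mem_insert, mem_singleton] at hx ⊢; tauto))⟩
  have hΩ1 : ∀ v w, ¬ X.Face {u, v} → Ω v w = 0 := fun v w h => hΩ.2 v w fun h' => h (h'.mono (by
    intro x hx; simp only [mem_insert, mem_singleton] at hx ⊢; tauto))
  obtain ⟨Δ, hΔ⟩ : ∃ Δ : ι → ι → ℝ, Δ = fun v w => Ω v w - Ω (X.neg v) (X.neg w) := ⟨_, rfl⟩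
  have hΔO : Δ ∈ X.O2 := by
    refine ⟨⟨⟨?_, ?_⟩, ?_⟩, ?_⟩
    · intro v w; rw [hΔ]; beta_reduce; rw [hΩ.1 v w, hΩ.1 (X.neg v)]
    · intro v w h; rw [hΔ]; beta_reduce
      rw [hΩF.2 v w h, hΩF.2 _ _ (fun h' => h (Fc_neg.1 h')), sub_zero]
    · intro v w; rw [hΔ]; beta_reduce; rw [X.neg_neg, X.neg_neg]; ring
    · change X.row Δ = 0
      ext1 v
      have e : ∑ w, Ω (X.neg v) (X.neg w) • X.p w = r v := by
        rw [← X.sum_neg, ← _root_.neg_neg (r v), ← hodd, ← hrow, row_apply, ← sum_neg_distrib]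
        refine sum_congr rfl fun w _ => ?_
        rw [X.neg_neg, X.p_neg, smul_neg]
      rw [row_apply, hΔ]
      simp only [sub_smul, sum_sub_distrib, e]
      rw [← row_apply, hrow]; simp
  obtain ⟨β, hβ, hΔβ⟩ := O2_eq hX hΔO
  let B : (ι → ℝ) →ₗ[ℝ] X.OdV →ₗ[ℝ] ℝ := LinearMap.mk₂ ℝ
    (fun z b => 2 * X.deg (X.xv u * X.br z * X.br b.1))
    (fun z z' b => by rw [map_add, mul_add, add_mul, map_add, mul_add])
    (fun c z b => by rw [map_smul, mul_smul_comm, smul_mul_assoc, map_smul, smul_eq_mul, smul_eq_mul]; ring)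
    (fun z b b' => by rw [Submodule.coe_add, map_add, mul_add, map_add, mul_add])
    (fun c z b => by rw [Submodule.coe_smul, map_smul, mul_smul_comm, map_smul, smul_eq_mul, smul_eq_mul]; ring)
  let F : X.OdV →ₗ[ℝ] ℝ :=
    { toFun := fun b => X.deg (X.br β * X.br b.1)
      map_add' := fun b b' => by rw [Submodule.coe_add, map_add, mul_add, map_add]
      map_smul' := fun c b => by rw [Submodule.coe_smul, map_smul, mul_smul_comm, map_smul]; rfl }
  obtain ⟨z, hz⟩ := solve_form B F (by
    intro b hb
    change X.deg (X.br β * X.br b.1) = 0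
    obtain ⟨l, hl⟩ := lin_of_HR_vert (X := X) (u := u) (z := b.1) (fun z => by
      have : 2 * X.deg (X.xv u * X.br z * X.br b.1) = 0 := hb z
      linarith)
    have h1 : X.deg (X.br β * X.br (X.lin l)) = 0 := by
      rw [mul_comm]; exact deg_lin_mul l (PP.le (by omega) (br_mem β))
    have h2 : X.deg (X.br β * X.br (b.1 - X.lin l)) = 0 := by
      rw [deg_br_sum']
      refine sum_eq_zero fun v _ => ?_
      by_cases hv : X.Face {u, v}
      · rw [Pi.sub_apply, hl v hv, lin_apply, sub_self, zero_mul]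
      by_cases hv2 : X.Face {u, X.neg v}
      · have e1 := hl _ hv2
        rw [b.2 v, X.p_neg, map_neg] at e1
        rw [Pi.sub_apply, lin_apply, show b.1 v = l (X.p v) by linarith, sub_self, zero_mul]
      · rw [← Om_sum, ← hΔβ, sum_eq_zero, mul_zero]
        intro w _
        rw [hΔ]; beta_reduce
        rw [hΩ1 v w hv, hΩ1 _ _ hv2, sub_zero]
    rw [map_sub, mul_sub, map_sub, h1, sub_zero] at h2
    exact h2)
  have hz2 : ∀ b ∈ X.OdV, 2 * X.deg (X.xv u * X.br z * X.br b) = X.deg (X.br β * X.br b) :=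
    fun b hb => LinearMap.congr_fun hz ⟨b, hb⟩
  obtain ⟨Q, hQ⟩ : ∃ Q, Q = X.xv u * X.br z := ⟨_, rfl⟩
  have hQm : Q ∈ X.PP (d - 2) := by
    rw [hQ]; exact PP.le (by omega) (PP.mul (xv_mem u) (br_mem z))
  have hdiff : X.Om (Q - X.S Q) = Δ := by
    rw [← sub_eq_zero]
    apply O2_zero hX
    · exact Submodule.sub_mem _ (Om_mem_O2 (Submodule.sub_mem _ hQm (S_mem hQm)) (by rw [map_sub, S_S]; abel)) hΔO
    · intro v
      simp only [Pi.sub_apply, sum_sub_distrib]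
      rw [hΔβ, Om_sum, Om_sum, sub_mul, map_sub, ← deg_mul_S, S_xv]
      have hb : (Pi.single v 1 - Pi.single (X.neg v) 1 : ι → ℝ) ∈ X.OdV := by
        intro w
        simp only [Pi.sub_apply, Pi.single_apply, X.neg_inj.eq_iff, X.neg_eq_iff w v]
        ring
      have h3 := hz2 _ hb
      have e : X.br (Pi.single v 1 - Pi.single (X.neg v) 1 : ι → ℝ) = X.xv v - X.xv (X.neg v) := by
        rw [map_sub]; rfl
      rw [e, mul_sub, mul_sub, map_sub, map_sub, deg_odd_half hβ, ← hQ] at h3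
      linarith
  have hev : ∀ v w, (Ω - X.Om Q) (X.neg v) (X.neg w) = (Ω - X.Om Q) v w := by
    intro v w
    have h4 := congrFun (congrFun hdiff v) w
    rw [map_sub, hΔ] at h4
    simp only [Pi.sub_apply] at h4 ⊢
    rw [Om_neg]; linarith
  have hsup : ∀ v w, ¬ X.Face {u, v} → (Ω - X.Om Q) v w = 0 := by
    intro v w h
    simp only [Pi.sub_apply]
    have e : X.xv u * X.br z * (X.xv v * X.xv w) = (X.xv u * X.xv v) * (X.br z * X.xv w) := by ring
    rw [hΩ1 v w h, Om_apply, hQ, e, xv_mul_eq_zero h, zero_mul, map_zero, sub_zero]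
  have hsy : Ω - X.Om Q ∈ Sy X.Fc := Submodule.sub_mem _ hΩF (Om_mem Q)
  have hsup2 : ∀ v w, ¬ X.WV u v → (Ω - X.Om Q) v w = 0 := by
    intro v w h
    by_cases hv : X.Face {u, v}
    · rw [← hev]; exact hsup _ _ fun h' => h ⟨hv, h'⟩
    · exact hsup v w hv
  refine ⟨Ω - X.Om Q, ⟨⟨hsy.1, ?_⟩, hev⟩, ?_⟩
  · intro v w h
    by_cases h1 : X.WV u v
    · by_cases h2 : X.WV u w
      · exact hsy.2 v w fun h3 => h ⟨h3, h1, h2⟩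
      · rw [hsy.1]; exact hsup2 w v h2
    · exact hsup2 v w h1
  · rw [map_sub, Om_row hQm, hrow, sub_zero]

end maind

end CSP

namespace CSP

section maine

variable {ι : Type} [Fintype ι] {X : CSP 4 ι} {u : ι} {y : ι → ℝ}

theorem finrank_oddW_le (hX : X.Small) :
    Module.finrank ℝ (Sy (X.Rw u) ⊓ X.Od : Submodule ℝ (ι → ι → ℝ)) ≤ 3 * (X.HW u).card := by
  let N : Submodule ℝ (Fin 4 → ℝ) := Submodule.span ℝ {X.p u}
  let L : (Sy (X.Rw u) ⊓ X.Od : Submodule ℝ (ι → ι → ℝ)) →ₗ[ℝ] (X.HW u → ((Fin 4 → ℝ) ⧸ N)) :=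
    LinearMap.pi fun v => N.mkQ ∘ₗ (LinearMap.proj (R := ℝ) (φ := fun _ : ι => Fin 4 → ℝ) v.1) ∘ₗ X.row ∘ₗ Submodule.subtype _
  have hLa : ∀ Ω v, L Ω v = N.mkQ (X.row Ω.1 v.1) := fun _ _ => rfl
  have hinj : Function.Injective L := by
    rw [← LinearMap.ker_eq_bot, LinearMap.ker_eq_bot']
    intro Ω hΩ
    have hsy : Ω.1 ∈ Sy X.Fc := ⟨Ω.2.1.1, fun v w h => Ω.2.1.2 v w fun h' => h h'.1⟩
    have hW : ∀ v w, ¬ X.WV u v → Ω.1 v w = 0 := fun v w h => Ω.2.1.2 v w fun h' => h h'.2.1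
    have h1 : ∀ v ∈ X.HW u, ∃ c : ℝ, c • X.p u = X.row Ω.1 v := by
      intro v hv
      have := congrFun hΩ ⟨v, hv⟩
      rw [hLa, Pi.zero_apply, Submodule.mkQ_apply, Submodule.Quotient.mk_eq_zero,
        Submodule.mem_span_singleton] at this
      exact this
    have h2 : ∀ v, ∃ c : ℝ, c • X.p u = X.row Ω.1 v := by
      intro v
      by_cases hv : X.WV u v
      · by_cases hp : v ∈ X.Hp
        · exact h1 v (mem_HW.2 ⟨hp, hv⟩)
        · have := h1 _ (mem_HW.2 ⟨neg_mem_Hp.2 hp, hv.neg⟩)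
          rwa [row_odd Ω.2.2] at this
      · refine ⟨0, ?_⟩
        rw [zero_smul, row_apply, sum_eq_zero]
        intro w _; rw [hW v w hv, zero_smul]
    choose ρ hρ using h2
    exact Subtype.ext (star_key hX hsy Ω.2.2 hW ρ fun v => (hρ v).symm)
  have h3 := LinearMap.finrank_le_finrank_of_injective hinj
  have h4 : Module.finrank ℝ ((Fin 4 → ℝ) ⧸ N) = 3 := by
    have := Submodule.finrank_quotient_add_finrank N
    rw [finrank_span_singleton (X.p_ne u), Module.finrank_fin_fun] at this
    omega
  rw [Module.finrank_pi_fintype] at h3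
  simp only [h4, sum_const, card_univ, Fintype.card_coe, smul_eq_mul] at h3
  omega

theorem finrank_evenW_le (hX : X.Small) :
    Module.finrank ℝ (Sy (X.Rw u) ⊓ X.Ev : Submodule ℝ (ι → ι → ℝ)) ≤ 3 * (X.HW u).card := by
  refine le_trans ?_ (finrank_oddW_le hX)
  let L : (Sy (X.Rw u) ⊓ X.Ev : Submodule ℝ (ι → ι → ℝ)) →ₗ[ℝ]
      (Sy (X.Rw u) ⊓ X.Od : Submodule ℝ (ι → ι → ℝ)) :=
    { toFun := fun Ω => ⟨fun v w => X.phi (X.p v + X.p w) * Ω.1 v w, by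
        refine ⟨⟨?_, ?_⟩, ?_⟩
        · intro v w; beta_reduce; rw [add_comm, Ω.2.1.1 v w]
        · intro v w h; beta_reduce; rw [Ω.2.1.2 v w h, mul_zero]
        · intro v w; beta_reduce; rw [Ω.2.2 v w, X.p_neg, X.p_neg, ← neg_add, map_neg, neg_mul]⟩
      map_add' := fun a b => by
        ext v w; simp [mul_add]
      map_smul' := fun c a => by
        ext v w; simp; ring }
  apply LinearMap.finrank_le_finrank_of_injective (f := L)
  rw [← LinearMap.ker_eq_bot, LinearMap.ker_eq_bot']
  intro Ω hΩ
  apply Subtype.ext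
  ext v w
  by_cases h : X.Rw u v w
  · have := congrFun (congrFun (congrArg Subtype.val hΩ) v) w
    have h1 : X.phi (X.p v + X.p w) * Ω.1 v w = 0 := this
    exact (mul_eq_zero.1 h1).resolve_left (phi_ne2 h.1)
  · exact Ω.2.1.2 v w h

theorem final_four (hX : X.Small) (hk : 4 ≤ (X.HW u).card) : False := by
  have hYex : ∀ v : X.HW u, ∃ y, X.YY u y ∧ ∀ z, X.Dy u y (X.br z) = z v + z (X.neg v) :=
    fun v => exists_y (mem_HW.1 v.2).2
  choose Y hY hYz using hYex
  have hself : ∀ v w : X.HW u, X.Dy u (Y v) (X.xv w) = if v = w then 1 else 0 := by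
    intro v w
    rw [xv, hYz]
    have : X.neg v ≠ (w : ι) := by
      intro h
      have := (mem_HW.1 w.2).1
      rw [← h] at this
      exact neg_mem_Hp.1 this (mem_HW.1 v.2).1
    rw [Pi.single_eq_of_ne this, Pi.single_apply, add_zero]
    simp only [Subtype.ext_iff]
  let Φ : (Sy (X.Rw u) ⊓ X.Ev : Submodule ℝ (ι → ι → ℝ)) →ₗ[ℝ] (X.HW u → (Fin 4 → ℝ)) :=
    LinearMap.pi fun v => (LinearMap.proj (R := ℝ) (φ := fun _ : ι => Fin 4 → ℝ) v.1) ∘ₗ X.row ∘ₗ Submodule.subtype _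
  have hΦ : ∀ Ω v, Φ Ω v = X.row Ω.1 v.1 := fun _ _ => rfl
  have hmemE : ∀ v, X.Om (X.xv u * X.br (Y v)) ∈ Sy (X.Rw u) ⊓ X.Ev := by
    intro v
    have hD : ∀ a b, X.Om (X.xv u * X.br (Y v)) a b = X.Dy u (Y v) (X.xv a * X.xv b) := by
      intro a b; rfl
    have hW : ∀ a b, ¬ X.WV u a → X.Om (X.xv u * X.br (Y v)) a b = 0 := by
      intro a b h; rw [hD]; exact Dy_notW hX (hY v) h (xv_mem b)
    refine ⟨⟨(Om_mem _).1, ?_⟩, ?_⟩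
    · intro a b h
      by_cases h1 : X.WV u a
      · by_cases h2 : X.WV u b
        · exact (Om_mem _).2 a b fun h3 => h ⟨h3, h1, h2⟩
        · rw [(Om_mem _).1]; exact hW b a h2
      · exact hW a b h1
    · intro a b
      rw [hD, hD, ← S_xv, ← S_xv, ← map_mul]
      exact Dy_S hX (hY v) (PP.mul (xv_mem a) (xv_mem b))
  let K : (X.HW u → ℝ) →ₗ[ℝ] (Sy (X.Rw u) ⊓ X.Ev : Submodule ℝ (ι → ι → ℝ)) :=
    ∑ v, (LinearMap.proj (R := ℝ) (φ := fun _ : X.HW u => ℝ) v).smulRight ⟨_, hmemE v⟩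
  have hK : ∀ lam, (K lam).1 = ∑ v, lam v • X.Om (X.xv u * X.br (Y v)) := by
    intro lam
    simp only [K, LinearMap.sum_apply, LinearMap.smulRight_apply, LinearMap.proj_apply,
      Submodule.coe_sum, Submodule.coe_smul]
  have hKinj : Function.Injective K := by
    rw [← LinearMap.ker_eq_bot, LinearMap.ker_eq_bot']
    intro lam hlam
    ext w
    have h1 := hK lam
    rw [hlam] at h1
    have h2 : ∑ b, (∑ v, lam v • X.Om (X.xv u * X.br (Y v))) w.1 b = 0 := by
      rw [← h1]; simp
    simp only [Finset.sum_apply, Pi.smul_apply, smul_eq_mul] at h2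
    rw [sum_comm] at h2
    simp only [← mul_sum, Om_sum] at h2
    simp only [← Dy_apply, hself] at h2
    simpa using h2
  have hKker : LinearMap.range K ≤ LinearMap.ker Φ := by
    rintro _ ⟨lam, rfl⟩
    rw [LinearMap.mem_ker]
    ext1 v
    rw [hΦ, hK, map_sum]
    simp only [map_smul]
    rw [sum_eq_zero]; rfl
    intro w _
    rw [Om_row, smul_zero]
    exact PP.mul (xv_mem u) (br_mem (Y w))
  have k1 : (X.HW u).card ≤ Module.finrank ℝ (LinearMap.ker Φ) := by
    have h1 := LinearMap.finrank_range_of_inj hKinj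
    rw [Module.finrank_fintype_fun_eq_card, Fintype.card_coe] at h1
    rw [← h1]
    exact Submodule.finrank_mono hKker
  let N : (X.HW u → (Fin 4 → ℝ)) →ₗ[ℝ] ({ij : Fin 4 × Fin 4 // ij.1 < ij.2} → ℝ) :=
    { toFun := fun r ij => ∑ v, (X.p v.1 ij.1.1 * r v ij.1.2 - X.p v.1 ij.1.2 * r v ij.1.1)
      map_add' := fun a b => by
        ext ij; simp only [Pi.add_apply, ← sum_add_distrib]
        exact sum_congr rfl fun v _ => by ring
      map_smul' := fun c a => by
        ext ij; simp only [Pi.smul_apply, smul_eq_mul, mul_sum, RingHom.id_apply]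
        exact sum_congr rfl fun v _ => by ring }
  have hNr : LinearMap.ker N ≤ LinearMap.range Φ := by
    intro r hr
    have hsymm : ∀ i j, ∑ v, X.p v.1 i * r v j = ∑ v, X.p v.1 j * r v i := by
      have hlt : ∀ i j, i < j → ∑ v, X.p v.1 i * r v j = ∑ v, X.p v.1 j * r v i := by
        intro i j hij
        have : ∑ v, (X.p v.1 i * r v j - X.p v.1 j * r v i) = 0 := congrFun hr ⟨(i, j), hij⟩
        rw [sum_sub_distrib] at this; linarith
      intro i j
      rcases lt_trichotomy i j with h | h | h
      · exact hlt i j h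
      · rw [h]
      · exact (hlt j i h).symm
    have hskew : ∀ A : (Fin 4 → ℝ) →ₗ[ℝ] (Fin 4 → ℝ) →ₗ[ℝ] ℝ, (∀ x y, A x y = - A y x) →
        ∑ v, A (X.p v.1) (r v) = 0 := by
      intro A hA
      have he : ∀ x y, A x y = ∑ i, ∑ j, x i * y j * A (Pi.single i 1) (Pi.single j 1) := by
        intro x y
        conv_lhs => rw [pi_eq_sum_univ' x, pi_eq_sum_univ' y]
        simp only [map_sum, map_smul, LinearMap.sum_apply, LinearMap.smul_apply, smul_eq_mul, mul_sum]
        rw [sum_comm]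
        refine sum_congr rfl fun i _ => sum_congr rfl fun j _ => ?_
        ring
      have h1 : ∑ v, A (X.p v.1) (r v) = ∑ i, ∑ j, (∑ v, X.p v.1 i * r v j) * A (Pi.single i 1) (Pi.single j 1) := by
        rw [sum_congr rfl fun v _ => he (X.p v.1) (r v)]
        simp only [sum_mul]
        rw [sum_comm]
        refine sum_congr rfl fun i _ => ?_
        rw [sum_comm]
      have h2 : ∑ v, A (X.p v.1) (r v) = - ∑ v, A (X.p v.1) (r v) := by
        conv_rhs => rw [h1, sum_comm, ← sum_neg_distrib]
        rw [h1]
        refine sum_congr rfl fun i _ => ?_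
        rw [← sum_neg_distrib]
        refine sum_congr rfl fun j _ => ?_
        rw [hsymm i j, hA (Pi.single i 1)]; ring
      linarith
    obtain ⟨R, hR⟩ : ∃ R : ι → (Fin 4 → ℝ), R = fun v => if h : v ∈ X.HW u then r ⟨v, h⟩ else
      if h : X.neg v ∈ X.HW u then - r ⟨X.neg v, h⟩ else 0 := ⟨_, rfl⟩
    have hnn : ∀ v, v ∈ X.HW u → X.neg v ∉ X.HW u := by
      intro v hv h
      exact neg_mem_Hp.1 (mem_HW.1 h).1 (mem_HW.1 hv).1
    have hRodd : ∀ v, R (X.neg v) = - R v := by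
      intro v
      rw [hR]; beta_reduce
      by_cases h1 : v ∈ X.HW u
      · rw [dif_neg (hnn v h1), dif_pos h1]
        simp only [X.neg_neg, dif_pos h1]
      · by_cases h2 : X.neg v ∈ X.HW u
        · simp only [dif_pos h2, dif_neg h1, _root_.neg_neg]
        · simp only [X.neg_neg, dif_neg h2, dif_neg h1, neg_zero]
    have hR0 : ∀ v, ¬ X.WV u v → R v = 0 := by
      intro v hv
      rw [hR]; beta_reduce
      rw [dif_neg (fun h => hv (mem_HW.1 h).2), dif_neg (fun h => hv (WV_neg.1 (mem_HW.1 h).2))]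
    have hRr : ∀ v : X.HW u, R v.1 = r v := by
      intro v; rw [hR]; beta_reduce; rw [dif_pos v.2]
    obtain ⟨Ω, hΩ, hrow⟩ := range_even hX R hR0 hRodd (by
      intro A hA
      have h1 : ∀ v, A (X.p v) (R v) = (if v ∈ X.HW u then A (X.p v) (R v) else 0) +
          (if X.neg v ∈ X.HW u then A (X.p (X.neg v)) (R (X.neg v)) else 0) := by
        intro v
        by_cases h1 : v ∈ X.HW u
        · rw [if_pos h1, if_neg (hnn v h1), add_zero]
        · rw [if_neg h1, zero_add]
          by_cases h2 : X.neg v ∈ X.HW u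
          · rw [if_pos h2, hRodd, X.p_neg]; simp
          · rw [if_neg h2, hR0, map_zero]
            intro hv
            by_cases h3 : v ∈ X.Hp
            · exact h1 (mem_HW.2 ⟨h3, hv⟩)
            · exact h2 (mem_HW.2 ⟨neg_mem_Hp.2 h3, hv.neg⟩)
      rw [sum_congr rfl fun v _ => h1 v, sum_add_distrib,
        X.sum_neg (fun v => if v ∈ X.HW u then A (X.p v) (R v) else 0)]
      have h2 : ∑ v, (if v ∈ X.HW u then A (X.p v) (R v) else 0) = 0 := by
        rw [← sum_filter, filter_mem_eq_inter, univ_inter, ← sum_coe_sort]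
        simp only [hRr]
        exact hskew A hA
      rw [h2, add_zero])
    refine ⟨⟨Ω, hΩ⟩, ?_⟩
    ext1 v
    rw [hΦ, hrow, hRr]
  have k2 := Submodule.finrank_mono hNr
  have k3 := LinearMap.finrank_range_add_finrank_ker N
  have k4 : Module.finrank ℝ (LinearMap.range N) ≤ 6 := by
    refine (Submodule.finrank_le _).trans ?_
    rw [Module.finrank_fintype_fun_eq_card]
    decide
  have k5 := LinearMap.finrank_range_add_finrank_ker Φ
  have k6 := finrank_evenW_le (u := u) hX
  rw [Module.finrank_pi_fintype] at k3
  simp only [Module.finrank_fin_fun, sum_const, card_univ, Fintype.card_coe, smul_eq_mul] at k3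
  omega

end maine

end CSP

namespace CSP

section bridge

variable {d : ℕ} {P : SPolytope d}

theorem mem_pair_classical {κ : Type} {a b j : κ} : j ∈ ({a, b} : Finset κ) ↔ j = a ∨ j = b := by
  simp

theorem le_body {l : (Fin d → ℝ) →ₗ[ℝ] ℝ} {c : ℝ} (h : ∀ v ∈ P.V, l v ≤ c) :
    ∀ y ∈ polyBody P.V, l y ≤ c := by
  intro y hy
  have : polyBody P.V ⊆ {w | l w ≤ c} :=
    convexHull_min (fun v hv => h v hv) (convex_halfSpace_le l.isLinear c)
  exact this hy

theorem mem_body {v : Fin d → ℝ} (h : v ∈ P.V) : v ∈ polyBody P.V :=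
  subset_convexHull ℝ _ h

theorem zero_body (hcs : IsCS P) {v : Fin d → ℝ} (h : v ∈ P.V) : (0 : Fin d → ℝ) ∈ polyBody P.V := by
  have h1 := mem_body h
  have h2 := mem_body (hcs v h)
  have := (convex_convexHull ℝ (P.V : Set (Fin d → ℝ))) h1 h2
    (by norm_num : (0:ℝ) ≤ 1/2) (by norm_num : (0:ℝ) ≤ 1/2) (by norm_num)
  simpa [polyBody] using this

theorem properFace (hcs : IsCS P) {v : Fin d → ℝ} (hv : v ∈ P.V) {l : (Fin d → ℝ) →ₗ[ℝ] ℝ}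
    (h : ∀ v ∈ P.V, l v ≤ 1) : IsProperFace P.V {y ∈ polyBody P.V | l y = 1} := by
  refine ⟨⟨l, 1, le_body h, rfl⟩, fun h1 => ?_⟩
  have h2 := zero_body hcs hv
  rw [← h1] at h2
  have := h2.2
  simp at this

theorem functional_of_properFace (hcs : IsCS P) {v : Fin d → ℝ} (hv : v ∈ P.V)
    {F : Set (Fin d → ℝ)} (hF : IsProperFace P.V F) :
    ∃ l : (Fin d → ℝ) →ₗ[ℝ] ℝ, (∀ v ∈ P.V, l v ≤ 1) ∧ ∀ x ∈ F, l x = 1 := by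
  obtain ⟨⟨f, c, h1, h2⟩, h3⟩ := hF
  have hle : ∀ w ∈ P.V, f w ≤ c := fun w hw => h1 w (mem_body hw)
  have hneg : ∀ w ∈ P.V, - f w ≤ c := fun w hw => by simpa using hle _ (hcs w hw)
  have hc0 : 0 ≤ c := by linarith [hle v hv, hneg v hv]
  rcases hc0.eq_or_lt with h0 | h0
  · exfalso
    apply h3
    rw [h2]
    ext y
    refine ⟨fun h => h.1, fun h => ⟨h, le_antisymm (h1 y h) ?_⟩⟩
    have := le_body (P := P) (l := -f) (c := c) (fun w hw => by simpa using hneg w hw) y h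
    simp only [LinearMap.neg_apply] at this
    linarith
  · refine ⟨c⁻¹ • f, fun w hw => ?_, fun x hx => ?_⟩
    · have := hle w hw
      simp only [LinearMap.smul_apply, smul_eq_mul]
      rw [inv_mul_le_iff₀ h0]; linarith
    · rw [h2] at hx
      simp only [LinearMap.smul_apply, smul_eq_mul, hx.2]
      exact inv_mul_cancel₀ h0.ne'

theorem span_V (P : SPolytope d) : Submodule.span ℝ (P.V : Set (Fin d → ℝ)) = ⊤ := by
  rw [eq_top_iff]
  intro x _
  have : x ∈ affineSpan ℝ (P.V : Set (Fin d → ℝ)) := by rw [P.span_top]; trivial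
  exact affineSpan_subset_span this

theorem card_V (P : SPolytope d) : d ≤ P.V.card := by
  have h := finrank_span_finset_le_card (R := ℝ) P.V
  rw [Set.finrank, span_V] at h
  simpa using h

theorem indep_V (hcs : IsCS P) {l : (Fin d → ℝ) →ₗ[ℝ] ℝ} {v : Fin d → ℝ} (hv : v ∈ P.V)
    (h : ∀ v ∈ P.V, l v ≤ 1) :
    LinearIndependent ℝ (fun i : {i : {x // x ∈ P.V} // l i = 1} => (i.1.1 : Fin d → ℝ)) := by
  have hA := (P.simplicial _ (properFace hcs hv h)).1
  rw [affineIndependent_iff] at hA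
  have hL : LinearIndependent ℝ (fun x : {y : Fin d → ℝ //
      y ∈ (P.V : Set (Fin d → ℝ)) ∩ {y ∈ polyBody P.V | l y = 1}} => (x : Fin d → ℝ)) := by
    rw [linearIndependent_iff']
    intro s g hg i hi
    refine hA s g ?_ hg i hi
    have := congrArg l hg
    rw [map_sum, map_zero] at this
    rw [← this]
    refine Finset.sum_congr rfl fun j _ => ?_
    rw [map_smul, j.2.2.2]; simp
  let φ : {i : {x // x ∈ P.V} // l i = 1} → {y : Fin d → ℝ //
      y ∈ (P.V : Set (Fin d → ℝ)) ∩ {y ∈ polyBody P.V | l y = 1}} :=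
    fun i => ⟨i.1.1, i.1.2, mem_body i.1.2, i.2⟩
  have hφ : Function.Injective φ := by
    intro a b hab
    have : a.1.1 = b.1.1 := congrArg (fun z => z.1) hab
    exact Subtype.ext (Subtype.ext this)
  exact hL.comp φ hφ

theorem vert_V (hd : 4 ≤ d) (hcs : IsCS P) {v : Fin d → ℝ} (hv : v ∈ P.V) :
    ∃ l : (Fin d → ℝ) →ₗ[ℝ] ℝ, (∀ w ∈ P.V, l w ≤ 1) ∧ l v = 1 := by
  obtain ⟨f, c, h1, h2⟩ := geometric_hahn_banach_closed_point
    (convex_convexHull ℝ ((P.V.erase v : Finset (Fin d → ℝ)) : Set (Fin d → ℝ)))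
    (Set.Finite.isClosed_convexHull ℝ (Finset.finite_toSet _)) (P.extreme v hv)
  have h3 : ∀ w ∈ P.V, w ≠ v → f w < f v := fun w hw hwv =>
    (h1 w (subset_convexHull ℝ _ (Finset.mem_coe.2 (Finset.mem_erase.2 ⟨hwv, hw⟩)))).trans h2
  have hpos : 0 < f v := by
    by_cases hvv : -v = v
    · have hv0 : v = 0 := by
        funext i
        have := congrFun hvv i
        simp only [Pi.neg_apply, Pi.zero_apply] at this ⊢
        linarith
      obtain ⟨w, hw, hwv⟩ := Finset.exists_mem_ne (by have := card_V P; omega : 1 < P.V.card) v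
      have a1 := h3 w hw hwv
      have a2 := h3 (-w) (hcs w hw) (by
        intro h; apply hwv; rw [hv0] at h ⊢; simpa using h)
      subst hv0
      simp at a1 a2
      linarith
    · have := h3 (-v) (hcs v hv) hvv
      simp at this
      linarith
  refine ⟨(f v)⁻¹ • (f : (Fin d → ℝ) →ₗ[ℝ] ℝ), fun w hw => ?_, ?_⟩
  · have : f w ≤ f v := by
      by_cases h : w = v
      · rw [h]
      · exact (h3 w hw h).le
    simp only [LinearMap.smul_apply, smul_eq_mul]
    change (f v)⁻¹ * f w ≤ 1
    rw [inv_mul_le_iff₀ hpos]; linarith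
  · simp only [LinearMap.smul_apply, smul_eq_mul]
    exact inv_mul_cancel₀ hpos.ne'

/-- The abstract structure attached to a centrally symmetric simplicial polytope. -/
def ofPoly (hd : 4 ≤ d) (P : SPolytope d) (hcs : IsCS P) : CSP d {x // x ∈ P.V} where
  hd := hd
  p := fun x => x.1
  neg := fun x => ⟨-x.1, hcs _ x.2⟩
  p_inj := Subtype.val_injective
  p_neg := fun _ => rfl
  span := by
    have : Set.range (fun x : {x // x ∈ P.V} => x.1) = (P.V : Set (Fin d → ℝ)) := by
      ext y; simp
    rw [this, span_V]
  indep := by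
    intro l hl
    have hne : 0 < P.V.card := by have := card_V P; omega
    obtain ⟨v, hv⟩ := Finset.card_pos.1 hne
    exact indep_V hcs hv (fun v hv => hl ⟨v, hv⟩)
  vert := by
    intro i
    obtain ⟨l, h1, h2⟩ := vert_V hd hcs i.2
    exact ⟨l, fun j => h1 _ j.2, h2⟩

theorem face_of_BFace (hd : 4 ≤ d) (hcs : IsCS P) {t : Finset (Fin d → ℝ)} (h : BFace P t)
    (s : Finset {x // x ∈ P.V}) (hs : ∀ i ∈ s, i.1 ∈ t) : (ofPoly hd P hcs).Face s := by
  obtain ⟨h1, F, hF, hsF⟩ := h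
  have hne : 0 < P.V.card := by have := card_V P; omega
  obtain ⟨v, hv⟩ := Finset.card_pos.1 hne
  obtain ⟨l, h2, h3⟩ := functional_of_properFace hcs hv hF
  exact ⟨l, fun i => h2 _ i.2, fun i hi => h3 _ (hsF (hs i hi))⟩

theorem BFace_of_face (hd : 4 ≤ d) (hcs : IsCS P) {s : Finset {x // x ∈ P.V}}
    (h : (ofPoly hd P hcs).Face s) : BFace P (s.map (Function.Embedding.subtype _)) := by
  obtain ⟨l, h1, h2⟩ := h
  have hne : 0 < P.V.card := by have := card_V P; omega
  obtain ⟨v, hv⟩ := Finset.card_pos.1 hne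
  refine ⟨fun x hx => ?_, _, properFace hcs hv (l := l) (fun v hv => h1 ⟨v, hv⟩), fun x hx => ?_⟩
  · obtain ⟨a, _, rfl⟩ := Finset.mem_map.1 hx
    exact a.2
  · obtain ⟨a, ha, rfl⟩ := Finset.mem_map.1 hx
    exact ⟨mem_body a.2, h2 a ha⟩

theorem small_of_g2 (hd : 4 ≤ d) (hcs : IsCS P) (h : g2 P ≤ (d.choose 2 : ℤ) - (d : ℤ)) :
    (ofPoly hd P hcs).Small := by
  have h1 : (univ.filter (fun s => (ofPoly hd P hcs).Face s ∧ s.card = 2)).card ≤ f1 P := by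
    refine Finset.card_le_card_of_injOn
      (fun s => s.map (Function.Embedding.subtype _)) (fun s hs => ?_) ?_
    · have hs := (Finset.mem_filter.1 hs).2
      have hB := BFace_of_face hd hcs hs.1
      simp only [edgeFinset, Finset.mem_coe, Finset.mem_filter, Finset.mem_powerset]
      exact ⟨hB.1, by rw [Finset.card_map]; exact hs.2, hB⟩
    · intro a _ b _ hab
      exact Finset.map_injective _ hab
  have h2 : Fintype.card {x // x ∈ P.V} = f0 P := by simp [f0]
  have h3 : (d + 1).choose 2 = d + d.choose 2 := by
    rw [Nat.choose_succ_succ' d 1, Nat.choose_one_right]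
  unfold Small
  rw [h2]
  unfold g2 at h
  rw [h3] at h
  push_cast at h
  have h4 : (f1 P : ℤ) + 2 * d ≤ d * f0 P := by linarith
  have h5 : f1 P + 2 * d ≤ d * f0 P := by exact_mod_cast h4
  omega

theorem HW_card (hd : 4 ≤ d) (hcs : IsCS P)
    (u : Fin d → ℝ) (hu : u ∈ P.V) (v : Fin d → (Fin d → ℝ))
    (hdist : ∀ i j, i ≠ j → v i ≠ v j ∧ v i ≠ -(v j))
    (hadj : ∀ i, Adj P u (v i) ∧ Adj P (-u) (v i) ∧
      Adj P u (-(v i)) ∧ Adj P (-u) (-(v i))) :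
    d ≤ ((ofPoly hd P hcs).HW ⟨u, hu⟩).card := by
  have hvV : ∀ i, v i ∈ P.V := fun i => (hadj i).1.2.1 (by simp)
  set X := ofPoly hd P hcs with hX
  have hW : ∀ i, X.WV ⟨u, hu⟩ ⟨v i, hvV i⟩ := by
    intro i
    refine ⟨face_of_BFace hd hcs (hadj i).1.2 _ ?_, face_of_BFace hd hcs (hadj i).2.2.1.2 _ ?_⟩
    · intro j hj
      rw [mem_pair_classical] at hj
      rcases hj with rfl | rfl
      · simp
      · simp
    · intro j hj
      rw [mem_pair_classical] at hj
      rcases hj with rfl | rfl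
      · simp
      · exact Finset.mem_insert_of_mem (Finset.mem_singleton.2 rfl)
  let φ : Fin d → {x // x ∈ P.V} := fun i =>
    if (⟨v i, hvV i⟩ : {x // x ∈ P.V}) ∈ X.Hp then ⟨v i, hvV i⟩ else X.neg ⟨v i, hvV i⟩
  have hφ : ∀ i, (φ i).1 = v i ∨ (φ i).1 = - v i := by
    intro i
    simp only [φ]
    split_ifs
    · left; rfl
    · right; rfl
  have key : (univ : Finset (Fin d)).card ≤ (X.HW ⟨u, hu⟩).card := by
    refine Finset.card_le_card_of_injOn φ (fun i _ => ?_) ?_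
    · rw [Finset.mem_coe, mem_HW]
      simp only [φ]
      split_ifs with h
      · exact ⟨h, hW i⟩
      · exact ⟨neg_mem_Hp.2 h, (hW i).neg⟩
    · intro i _ j _ hij
      by_contra hne
      obtain ⟨h1, h2⟩ := hdist i j hne
      have hij : (φ i).1 = (φ j).1 := congrArg Subtype.val hij
      rcases hφ i with hi | hi <;> rcases hφ j with hj | hj <;> rw [hi, hj] at hij
      · exact h1 hij
      · exact h2 hij
      · exact h2 (by rw [← hij]; simp)
      · exact h1 (neg_injective hij)
  simpa using key

end bridge

end CSP

/-- Let `d ≥ 4` and let `P` be a cs simplicial `d`-polytope. If some vertex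
`u` has `d` distinct antipodal pairs `{v_i, -v_i}` of common neighbors of `u` and `-u`,
then `g₂(P) > C(d,2) - d`. -/
theorem stmt13 {d : ℕ} (hd : 4 ≤ d) (P : SPolytope d) (hcs : IsCS P)
    (u : Fin d → ℝ) (hu : u ∈ P.V) (v : Fin d → (Fin d → ℝ))
    (hdist : ∀ i j, i ≠ j → v i ≠ v j ∧ v i ≠ -(v j))
    (hadj : ∀ i, Adj P u (v i) ∧ Adj P (-u) (v i) ∧
      Adj P u (-(v i)) ∧ Adj P (-u) (-(v i))) :
    (d.choose 2 : ℤ) - (d : ℤ) < g2 P := by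
  by_contra hcon
  have hS := CSP.small_of_g2 hd hcs (not_lt.1 hcon)
  have hk := CSP.HW_card hd hcs u hu v hdist hadj
  rcases hd.eq_or_lt with h4 | h5
  · subst h4
    exact CSP.final_four hS hk
  · exact CSP.final_five hS h5 hk
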